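/- Suppose K_n → ∞, K_n²/P_n → 0, and the sequence (n·p_{e,q}(n) − ln n)/ln ln n is bounded. Fix a constant integer h ≥ 0, and let Φ_{n,h} denote the number of vertices of 𝔾_q(n,K_n,P_n,p_n) whose degree equals h, and set λ_{n,h} = n·(h!)^{−1}·(n·p_{e,q}(n))^h·e^{−n·p_{e,q}(n)}. Then for every integer ℓ ≥ 0, the ratio P[Φ_{n,h} = ℓ] / ((ℓ!)^{−1}·λ_{n,h}^ℓ·e^{−λ_{n,h}}) converges to 1 as n → ∞; i.e., Φ_{n,h} is in distribution asymptotically equivalent to a Poisson random variable with mean λ_{n,h}. -/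

import Mathlib

open Finset Filter

/-- A configuration of the random graph `𝔾_q(n,K,P,p)`: a key-ring assignment
(one finite subset of the key pool `Fin P` per vertex) together with the
on/off states of the channels (one Boolean per unordered pair of vertices). -/
abbrev Config (n P : ℕ) : Type := (Fin n → Finset (Fin P)) × (Sym2 (Fin n) → Bool)

/-- Probability weight of a configuration: the key rings are independent and
uniform over the `K`-element subsets of the pool of size `P`, and the channels
are independent Bernoulli(`p`). -/
noncomputable def weight (n K P : ℕ) (p : ℝ) (ω : Config n P) : ℝ :=
  (∏ i : Fin n, if (ω.1 i).card = K then ((P.choose K : ℝ))⁻¹ else 0) *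
  (∏ e : Sym2 (Fin n), if ω.2 e then p else 1 - p)

/-- Probability of an event in `𝔾_q(n,K,P,p)`. -/
noncomputable def prob (n K P : ℕ) (p : ℝ) (E : Set (Config n P)) : ℝ :=
  ∑ ω : Config n P, Set.indicator E (weight n K P p) ω

/-- Adjacency in `𝔾_q(n,K,P,p)`: two distinct vertices are adjacent iff their
key rings share at least `q` keys and the channel between them is on. -/
def Adj (q n P : ℕ) (ω : Config n P) (i j : Fin n) : Prop :=
  i ≠ j ∧ q ≤ ((ω.1 i) ∩ (ω.1 j)).card ∧ ω.2 s(i, j) = true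

/-- Degree of a vertex. -/
noncomputable def degree (q n P : ℕ) (ω : Config n P) (i : Fin n) : ℕ :=
  Nat.card {j : Fin n // Adj q n P ω i j}

/-- Minimum degree of the graph. -/
noncomputable def minDeg (q n P : ℕ) (ω : Config n P) : ℕ :=
  sInf (Set.range fun i => degree q n P ω i)

/-- `p_{s,q}`: the probability that two key rings share at least `q` keys. -/
noncomputable def psq (q K P : ℕ) : ℝ :=
  1 - ∑ u ∈ Finset.range q,
    ((K.choose u : ℝ) * ((P - K).choose (K - u) : ℝ)) / (P.choose K : ℝ)

/-- `p_{e,q}`: the probability that two distinct vertices are adjacent. -/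
noncomputable def peq (q K P : ℕ) (p : ℝ) : ℝ := p * psq q K P

/-- The number of vertices of `𝔾_q(n,K,P,p)` whose degree equals `h`. -/
noncomputable def numDeg (q n P h : ℕ) (ω : Config n P) : ℕ :=
  Nat.card {i : Fin n // degree q n P ω i = h}

namespace RingGraph

/-- A probability weight on a finite type. -/
def IsProbWeight {α : Type*} [Fintype α] (w : α → ℝ) : Prop := (∀ a, 0 ≤ w a) ∧ ∑ a, w a = 1

/-- Expectation of a function of independent coordinates with common weight `w`. -/
noncomputable def iidExp {ι α : Type*} [Fintype ι] [DecidableEq ι] [Fintype α] (w : α → ℝ)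
    (f : (ι → α) → ℝ) : ℝ :=
  ∑ x, (∏ i, w (x i)) * f x

section IidExp

variable {ι α : Type*} [Fintype ι] [DecidableEq ι] [Fintype α] {w : α → ℝ}

lemma iidExp_add (f g : (ι → α) → ℝ) :
    iidExp w (fun x => f x + g x) = iidExp w f + iidExp w g := by
  simp [iidExp, mul_add, sum_add_distrib]

lemma iidExp_mul_left (c : ℝ) (f : (ι → α) → ℝ) :
    iidExp w (fun x => c * f x) = c * iidExp w f := by
  simp only [iidExp, mul_sum]
  exact sum_congr rfl fun x _ => by ring

lemma iidExp_sum {β : Type*} (s : Finset β) (f : β → (ι → α) → ℝ) :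
    iidExp w (fun x => ∑ b ∈ s, f b x) = ∑ b ∈ s, iidExp w (f b) := by
  simp only [iidExp, mul_sum]
  exact sum_comm

lemma iidExp_mono (hw : IsProbWeight w) {f g : (ι → α) → ℝ} (h : ∀ x, f x ≤ g x) :
    iidExp w f ≤ iidExp w g :=
  sum_le_sum fun x _ => mul_le_mul_of_nonneg_left (h x) (prod_nonneg fun _ _ => hw.1 _)

lemma iidExp_prod (hw : IsProbWeight w) {β : Type*} (s : Finset β) (e : β → ι)
    (he : Set.InjOn e s) (φ : β → α → ℝ) :
    iidExp w (fun x : ι → α => ∏ j ∈ s, φ j (x (e j))) = ∏ j ∈ s, ∑ a, w a * φ j a := by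
  classical
  have h1 : ∀ x : ι → α, ∏ j ∈ s, φ j (x (e j)) = ∏ i, ∏ j ∈ s with e j = i, φ j (x i) := by
    intro x
    rw [← prod_fiberwise s e]
    refine prod_congr rfl fun i _ => prod_congr rfl fun j hj => ?_
    rw [(mem_filter.1 hj).2]
  simp only [iidExp, h1, ← prod_mul_distrib]
  rw [← Fintype.prod_sum (fun i a => w a * ∏ j ∈ s with e j = i, φ j a)]
  rw [← prod_subset (subset_univ (s.image e)), prod_image he]
  · refine prod_congr rfl fun j hj => sum_congr rfl fun a _ => ?_
    have : s.filter (fun j' => e j' = e j) = {j} := by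
      ext j'
      simp only [mem_filter, mem_singleton]
      refine ⟨fun h => he h.1 hj h.2, ?_⟩
      rintro rfl
      exact ⟨hj, rfl⟩
    rw [this, prod_singleton]
  · intro i _ hi
    have : s.filter (fun j' => e j' = i) = ∅ := by
      refine filter_eq_empty_iff.2 fun j hj hji => hi (mem_image.2 ⟨j, hj, hji⟩)
    simp [this, hw.2]

lemma iidExp_const (hw : IsProbWeight w) (c : ℝ) : iidExp w (fun _ : ι → α => c) = c := by
  have := iidExp_prod hw (∅ : Finset ι) id (by simp) (fun _ _ => 1)
  have h2 := iidExp_mul_left (w := w) c (fun _ : ι → α => 1)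
  simp_all

lemma iidExp_nonneg (hw : IsProbWeight w) {f : (ι → α) → ℝ} (h : ∀ x, 0 ≤ f x) :
    0 ≤ iidExp w f :=
  sum_nonneg fun x _ => mul_nonneg (prod_nonneg fun _ _ => hw.1 _) (h x)

lemma iidExp_eval (hw : IsProbWeight w) (i : ι) (g : α → ℝ) :
    iidExp w (fun x : ι → α => g (x i)) = ∑ a, w a * g a := by
  simpa using iidExp_prod hw {i} id (by simp) (fun _ => g)

lemma iidExp_comp (hw : IsProbWeight w) {κ : Type*} [Fintype κ] [DecidableEq κ] (e : κ → ι)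
    (he : Function.Injective e) (f : (κ → α) → ℝ) :
    iidExp w (fun x : ι → α => f (x ∘ e)) = iidExp w f := by
  classical
  have h1 : ∀ x : ι → α, f (x ∘ e) =
      ∑ T : κ → α, f T * ∏ k, if x (e k) = T k then (1 : ℝ) else 0 := by
    intro x
    rw [sum_eq_single (x ∘ e)]
    · simp
    · intro T _ hT
      obtain ⟨k, hk⟩ := Function.ne_iff.1 hT
      rw [prod_eq_zero (mem_univ k), mul_zero]
      exact if_neg fun h => hk h.symm
    · simp
  simp only [h1]
  rw [iidExp_sum, iidExp]
  refine sum_congr rfl fun T _ => ?_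
  rw [iidExp_mul_left, iidExp_prod hw univ e he.injOn (fun k a => if a = T k then (1 : ℝ) else 0),
    mul_comm]
  simp

lemma iidExp_pow (m : ℕ) (φ : α → ℝ) :
    (∑ a, w a * φ a) ^ m = iidExp w (fun T : Fin m → α => ∏ i, φ (T i)) := by
  rw [Fintype.sum_pow]
  simp [iidExp, prod_mul_distrib]

lemma iidExp_piecewise (hw : IsProbWeight w) (J : Finset ι) (f : (ι → α) → ℝ) :
    iidExp w f = iidExp w fun x => iidExp w fun y => f (J.piecewise y x) := by
  have h1 : iidExp w f = iidExp w fun x => iidExp w fun _ : ι → α => f x := by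
    simp [iidExp_const hw]
  rw [h1]
  simp only [iidExp, mul_sum]
  rw [← Fintype.sum_prod_type', ← Fintype.sum_prod_type']
  have hinv : Function.Involutive (fun z : (ι → α) × (ι → α) =>
      (J.piecewise z.2 z.1, J.piecewise z.1 z.2)) := by
    rintro ⟨x, y⟩
    ext i <;> by_cases hi : i ∈ J <;> simp [hi]
  symm
  refine Fintype.sum_equiv hinv.toPerm _ _ ?_
  rintro ⟨x, y⟩
  simp only [Function.Involutive.coe_toPerm]
  rw [← mul_assoc, ← mul_assoc, ← prod_mul_distrib, ← prod_mul_distrib]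
  congr 1
  refine prod_congr rfl fun i _ => ?_
  by_cases hi : i ∈ J <;> simp [hi, mul_comm]

lemma iidExp_comm {κ γ : Type*} [Fintype κ] [DecidableEq κ] [Fintype γ] {w' : γ → ℝ}
    (f : (ι → α) → (κ → γ) → ℝ) :
    iidExp w (fun x => iidExp w' fun y => f x y) =
      iidExp w' fun y => iidExp w fun x => f x y := by
  simp only [iidExp, mul_sum]
  rw [sum_comm]
  exact sum_congr rfl fun _ _ => sum_congr rfl fun _ _ => by ring

end IidExp

/-- The real indicator of a Boolean. -/
def ind (b : Bool) : ℝ := if b then 1 else 0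

@[simp] lemma ind_true : ind true = 1 := rfl
@[simp] lemma ind_false : ind false = 0 := rfl

lemma ind_nonneg (b : Bool) : 0 ≤ ind b := by cases b <;> simp
lemma ind_le_one (b : Bool) : ind b ≤ 1 := by cases b <;> simp

/-- The Bernoulli weight. -/
def bern (p : ℝ) (b : Bool) : ℝ := if b then p else 1 - p

lemma isProbWeight_bern {p : ℝ} (h0 : 0 ≤ p) (h1 : p ≤ 1) : IsProbWeight (bern p) :=
  ⟨fun b => by cases b <;> simp [bern, h0, h1], by simp [bern]⟩

set_option linter.unusedSectionVars false

/-- Law of the labels of the vertices, compatibility relation between labels, and channel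
probability. -/
structure RingModel (R : Type*) [Fintype R] where
  w : R → ℝ
  isProbWeight : IsProbWeight w
  I : R → R → Bool
  I_comm : ∀ a b, I a b = I b a
  p : ℝ
  p_nonneg : 0 ≤ p
  p_le_one : p ≤ 1
  ps : ℝ
  sum_I : ∀ b, ∑ a, w a * ind (I a b) = ps

section Model

variable {V R : Type*} [Fintype V] [DecidableEq V] [Fintype R] (M : RingModel R)

namespace RingModel

/-- Edge probability. -/
def pe : ℝ := M.p * M.ps

lemma ps_nonneg [Nonempty R] : 0 ≤ M.ps := by
  rw [← M.sum_I (Classical.arbitrary R)]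
  exact sum_nonneg fun a _ => mul_nonneg (M.isProbWeight.1 a) (ind_nonneg _)

lemma ps_le_one [Nonempty R] : M.ps ≤ 1 := by
  rw [← M.sum_I (Classical.arbitrary R), ← M.isProbWeight.2]
  exact sum_le_sum fun a _ => mul_le_of_le_one_right (M.isProbWeight.1 a) (ind_le_one _)

lemma pe_nonneg [Nonempty R] : 0 ≤ M.pe := mul_nonneg M.p_nonneg M.ps_nonneg

lemma pe_le_one [Nonempty R] : M.pe ≤ 1 := mul_le_one₀ M.p_le_one M.ps_nonneg M.ps_le_one

lemma isProbWeight_bern : IsProbWeight (bern M.p) :=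
  RingGraph.isProbWeight_bern M.p_nonneg M.p_le_one

/-- Expectation over the labels and the channels. -/
noncomputable def exp (f : (V → R) × (Sym2 V → Bool) → ℝ) : ℝ :=
  iidExp M.w fun S => iidExp (bern M.p) fun c => f (S, c)

lemma exp_add (f g : (V → R) × (Sym2 V → Bool) → ℝ) :
    M.exp (fun ω => f ω + g ω) = M.exp f + M.exp g := by
  simp [exp, iidExp_add]

lemma exp_mul_left (c : ℝ) (f : (V → R) × (Sym2 V → Bool) → ℝ) :
    M.exp (fun ω => c * f ω) = c * M.exp f := by
  simp [exp, iidExp_mul_left]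

lemma exp_sub (f g : (V → R) × (Sym2 V → Bool) → ℝ) :
    M.exp (fun ω => f ω - g ω) = M.exp f - M.exp g := by
  have := M.exp_add f fun ω => (-1) * g ω
  rw [exp_mul_left] at this
  simpa [sub_eq_add_neg] using this

lemma exp_sum {β : Type*} (s : Finset β) (f : β → (V → R) × (Sym2 V → Bool) → ℝ) :
    M.exp (fun ω => ∑ b ∈ s, f b ω) = ∑ b ∈ s, M.exp (f b) := by
  simp [exp, iidExp_sum]

lemma exp_mono {f g : (V → R) × (Sym2 V → Bool) → ℝ} (h : ∀ ω, f ω ≤ g ω) :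
    M.exp f ≤ M.exp g :=
  iidExp_mono M.isProbWeight fun _ => iidExp_mono M.isProbWeight_bern fun _ => h _

lemma exp_const (c : ℝ) : M.exp (fun _ : (V → R) × (Sym2 V → Bool) => c) = c := by
  simp [exp, iidExp_const M.isProbWeight, iidExp_const M.isProbWeight_bern]

lemma exp_nonneg {f : (V → R) × (Sym2 V → Bool) → ℝ} (h : ∀ ω, 0 ≤ f ω) : 0 ≤ M.exp f := by
  simpa [exp_const] using M.exp_mono h

lemma abs_exp_le (f : (V → R) × (Sym2 V → Bool) → ℝ) : |M.exp f| ≤ M.exp fun ω => |f ω| := by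
  refine abs_le.2 ⟨?_, M.exp_mono fun ω => le_abs_self _⟩
  have := M.exp_mono fun ω => neg_abs_le (f ω)
  have h2 := M.exp_mul_left (-1) fun ω => |f ω|
  simp only [neg_one_mul] at h2
  linarith

lemma exp_labels (f : (V → R) → ℝ) :
    M.exp (fun ω : (V → R) × (Sym2 V → Bool) => f ω.1) = iidExp M.w f := by
  simp [exp, iidExp_const M.isProbWeight_bern]

lemma exp_piecewise (J : Finset V) (F : Finset (Sym2 V)) (f : (V → R) × (Sym2 V → Bool) → ℝ) :
    M.exp f = M.exp fun ω => M.exp fun ω' =>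
      f (J.piecewise ω'.1 ω.1, F.piecewise ω'.2 ω.2) := by
  simp only [exp]
  rw [iidExp_piecewise M.isProbWeight J]
  refine congrArg _ (funext fun S => ?_)
  refine (congrArg _ (funext fun S' => ?_)).trans (iidExp_comm _)
  exact iidExp_piecewise M.isProbWeight_bern F _

/-- The graph on the vertex set `V`. -/
def adj (ω : (V → R) × (Sym2 V → Bool)) (i j : V) : Bool :=
  decide (i ≠ j) && M.I (ω.1 i) (ω.1 j) && ω.2 s(i, j)

/-- Degree of `i` into `A`. -/
def deg (ω : (V → R) × (Sym2 V → Bool)) (A : Finset V) (i : V) : ℕ :=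
  #{j ∈ A | M.adj ω i j}

/-- Number of vertices of degree `h` in the graph induced on `A`. -/
def cnt (h : ℕ) (ω : (V → R) × (Sym2 V → Bool)) (A : Finset V) : ℕ :=
  #{i ∈ A | M.deg ω A i = h}

/-- Vertices of degree at most `h + 1` in the graph induced on `A`. -/
def low (h : ℕ) (ω : (V → R) × (Sym2 V → Bool)) (A : Finset V) : Finset V :=
  {i ∈ A | M.deg ω A i ≤ h + 1}

/-- Replace the label and the channels of `v` in `ω` by those in `ω'`. -/
def resample (v : V) (ω ω' : (V → R) × (Sym2 V → Bool)) : (V → R) × (Sym2 V → Bool) :=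
  (({v} : Finset V).piecewise ω'.1 ω.1, (univ.filter fun e => v ∈ e).piecewise ω'.2 ω.2)

lemma exp_resample (v : V) (f : (V → R) × (Sym2 V → Bool) → ℝ) :
    M.exp f = M.exp fun ω => M.exp fun ω' => f (resample v ω ω') :=
  M.exp_piecewise _ _ _

lemma adj_comm (ω : (V → R) × (Sym2 V → Bool)) (i j : V) : M.adj ω i j = M.adj ω j i := by
  simp only [adj, M.I_comm (ω.1 i), Sym2.eq_swap (a := i), ne_comm (a := i)]

@[simp] lemma adj_self (ω : (V → R) × (Sym2 V → Bool)) (i : V) : M.adj ω i i = false := by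
  simp [adj]

lemma adj_resample {v i j : V} (hi : i ≠ v) (hj : j ≠ v) (ω ω' : (V → R) × (Sym2 V → Bool)) :
    M.adj (resample v ω ω') i j = M.adj ω i j := by
  simp [adj, resample, hi, hj, hi.symm, hj.symm, Finset.piecewise]

lemma adj_resample_left {v j : V} (hj : j ≠ v) (ω ω' : (V → R) × (Sym2 V → Bool)) :
    M.adj (resample v ω ω') v j = (M.I (ω'.1 v) (ω.1 j) && ω'.2 s(v, j)) := by
  simp [adj, resample, hj, hj.symm, Finset.piecewise]

lemma deg_resample {v i : V} {A : Finset V} (hi : i ≠ v) (hA : v ∉ A)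
    (ω ω' : (V → R) × (Sym2 V → Bool)) :
    M.deg (resample v ω ω') A i = M.deg ω A i := by
  refine congrArg _ (filter_congr fun j hj => ?_)
  rw [M.adj_resample hi (ne_of_mem_of_not_mem hj hA)]

lemma cnt_resample (h : ℕ) {v : V} {A : Finset V} (hA : v ∉ A)
    (ω ω' : (V → R) × (Sym2 V → Bool)) :
    M.cnt h (resample v ω ω') A = M.cnt h ω A := by
  refine congrArg _ (filter_congr fun j hj => ?_)
  rw [M.deg_resample (ne_of_mem_of_not_mem hj hA) hA]

lemma low_resample (h : ℕ) {v : V} {A : Finset V} (hA : v ∉ A)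
    (ω ω' : (V → R) × (Sym2 V → Bool)) :
    M.low h (resample v ω ω') A = M.low h ω A := by
  refine filter_congr fun j hj => ?_
  rw [M.deg_resample (ne_of_mem_of_not_mem hj hA) hA]

lemma exp_prod_adj_resample {v : V} {B : Finset V} (hB : v ∉ B)
    (ω : (V → R) × (Sym2 V → Bool)) (φ : V → Bool → ℝ) :
    M.exp (fun ω' => ∏ j ∈ B, φ j (M.adj (resample v ω ω') v j)) =
      ∑ T, M.w T * ∏ j ∈ B, (φ j false + M.p * ind (M.I T (ω.1 j)) * (φ j true - φ j false)) := by
  rw [← iidExp_eval M.isProbWeight v, exp]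
  refine congrArg _ (funext fun S' => ?_)
  have h1 : ∀ c', ∏ j ∈ B, φ j (M.adj (resample v ω (S', c')) v j) =
      ∏ j ∈ B, φ j (M.I (S' v) (ω.1 j) && c' s(v, j)) := fun c' =>
    prod_congr rfl fun j hj => by rw [M.adj_resample_left (ne_of_mem_of_not_mem hj hB)]
  simp only [h1]
  rw [iidExp_prod M.isProbWeight_bern B (fun j => s(v, j)) (fun i _ j _ hij => by aesop)
    (fun j b => φ j (M.I (S' v) (ω.1 j) && b))]
  refine prod_congr rfl fun j _ => ?_
  cases M.I (S' v) (ω.1 j) <;> simp [bern] <;> ring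

lemma exp_adj_resample {v u : V} (huv : u ≠ v) (ω : (V → R) × (Sym2 V → Bool)) :
    M.exp (fun ω' => ind (M.adj (resample v ω ω') v u)) = M.pe := by
  have := M.exp_prod_adj_resample (v := v) (B := {u}) (by simpa using huv.symm) ω fun _ => ind
  simp only [prod_singleton, ind_false, ind_true] at this
  rw [this, pe, ← M.sum_I (ω.1 u), mul_sum]
  exact sum_congr rfl fun _ _ => by ring

/-- Probability generating quantity of a vertex tested against the labels `S` on `B`, weighted by
its adjacency with `u`. -/
noncomputable def tilt (z : ℝ) (B : Finset V) (u : V) (S : V → R) : ℝ :=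
  ∑ T, M.w T * ((M.p * ind (M.I T (S u)) + M.pe) *
    ∏ j ∈ B, (1 - (1 - z) * M.p * ind (M.I T (S j))))

/-- Probability generating quantity of a random label tested against a tuple of labels. -/
noncomputable def joint (z : ℝ) {κ : Type*} [Fintype κ] (T : κ → R) : ℝ :=
  ∑ s, M.w s * ∏ i, (1 - (1 - z) * M.p * ind (M.I (T i) s))

lemma pow_deg (z : ℝ) (ω : (V → R) × (Sym2 V → Bool)) (B : Finset V) (v : V) :
    z ^ M.deg ω B v = ∏ j ∈ B, if M.adj ω v j then z else 1 := by
  rw [prod_ite]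
  simp [deg]

lemma exp_mul_pow_deg {v u : V} {B : Finset V} (hvB : v ∉ B) (huB : u ∉ B) (huv : u ≠ v) (z : ℝ)
    {f : (V → R) × (Sym2 V → Bool) → ℝ} (hf : ∀ ω ω', f (resample v ω ω') = f ω) :
    M.exp (fun ω => f ω * ((ind (M.adj ω v u) + M.pe) * z ^ M.deg ω B v)) =
      M.exp fun ω => f ω * M.tilt z B u ω.1 := by
  rw [M.exp_resample v]
  refine congrArg _ (funext fun ω => ?_)
  simp only [hf, exp_mul_left]
  congr 1
  have h1 : ∀ ω' : (V → R) × (Sym2 V → Bool), (ind (M.adj (resample v ω ω') v u) + M.pe) *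
      z ^ M.deg (resample v ω ω') B v = ∏ j ∈ insert u B,
        (fun j b => if j = u then ind b + M.pe else if b then z else 1) j
          (M.adj (resample v ω ω') v j) := by
    intro ω'
    rw [prod_insert huB, pow_deg]
    simp only [if_true]
    congr 1
    refine prod_congr rfl fun j hj => ?_
    rw [if_neg (ne_of_mem_of_not_mem hj huB)]
  simp only [h1]
  refine (M.exp_prod_adj_resample (by simp [huv.symm, hvB]) ω
    (fun j b => if j = u then ind b + M.pe else if b then z else 1)).trans ?_
  refine sum_congr rfl fun T _ => ?_
  rw [prod_insert huB]
  simp only [if_true, ind_false, ind_true]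
  congr 2
  · ring
  · refine prod_congr rfl fun j hj => ?_
    simp only [if_neg (ne_of_mem_of_not_mem hj huB), Bool.false_eq_true, if_false]
    ring

end RingModel

end Model

namespace RingModel

set_option linter.unusedSectionVars false

variable {V R : Type*} [Fintype V] [DecidableEq V] [Fintype R] (M : RingModel R)

/-- The factor `1 - (1 - z) p 1[a ~ b]`. -/
noncomputable def fac (z : ℝ) (a b : R) : ℝ := 1 - (1 - z) * M.p * ind (M.I a b)

lemma fac_nonneg {z : ℝ} (hz0 : 0 ≤ z) (a b : R) : 0 ≤ M.fac z a b := by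
  have h1 : (1 - z) * M.p * ind (M.I a b) ≤ 1 :=
    mul_le_one₀ (mul_le_one₀ (by linarith) M.p_nonneg M.p_le_one) (ind_nonneg _) (ind_le_one _)
  rw [fac]; linarith

lemma fac_le_one {z : ℝ} (hz1 : z ≤ 1) (a b : R) : M.fac z a b ≤ 1 := by
  have h1 : 0 ≤ (1 - z) * M.p * ind (M.I a b) :=
    mul_nonneg (mul_nonneg (by linarith) M.p_nonneg) (ind_nonneg _)
  rw [fac]; linarith

lemma joint_nonneg {z : ℝ} (hz0 : 0 ≤ z) {κ : Type*} [Fintype κ] (T : κ → R) :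
    0 ≤ M.joint z T :=
  sum_nonneg fun _ _ => mul_nonneg (M.isProbWeight.1 _)
    (prod_nonneg fun _ _ => M.fac_nonneg hz0 _ _)

lemma joint_le_one {z : ℝ} (hz0 : 0 ≤ z) (hz1 : z ≤ 1) {κ : Type*} [Fintype κ] (T : κ → R) :
    M.joint z T ≤ 1 := by
  rw [← M.isProbWeight.2]
  exact sum_le_sum fun _ _ => mul_le_of_le_one_right (M.isProbWeight.1 _)
    (prod_le_one (fun _ _ => M.fac_nonneg hz0 _ _) fun _ _ => M.fac_le_one hz1 _ _)

lemma iidExp_joint_pow_le {z : ℝ} (hz0 : 0 ≤ z) (hz1 : z ≤ 1) {m : ℕ} {κ₀ δ : ℝ} (hκ₀ : 0 ≤ κ₀)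
    (hH : iidExp M.w (fun T : Fin m → R => if κ₀ < M.joint z T then 1 else 0) ≤ δ) (N : ℕ) :
    iidExp M.w (fun T : Fin m → R => M.joint z T ^ N) ≤ κ₀ ^ N + δ := by
  refine le_trans (iidExp_mono M.isProbWeight (g := fun T =>
    κ₀ ^ N + if κ₀ < M.joint z T then 1 else 0) fun T => ?_) ?_
  · have := M.joint_nonneg hz0 T
    split_ifs with h
    · have := pow_le_one₀ (n := N) this (M.joint_le_one hz0 hz1 T)
      have := pow_nonneg hκ₀ N
      linarith
    · rw [add_zero]
      exact pow_le_pow_left₀ this (not_lt.1 h) N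
  · rw [iidExp_add, iidExp_const M.isProbWeight]
    linarith

lemma sum_w_mul_ind_add (s : R) : ∑ T, M.w T * (M.p * ind (M.I T s) + M.pe) = 2 * M.pe := by
  have h1 := M.sum_I s
  have : ∀ T, M.w T * (M.p * ind (M.I T s) + M.pe) =
      M.p * (M.w T * ind (M.I T s)) + M.pe * M.w T := fun T => by ring
  rw [sum_congr rfl fun T _ => this T, sum_add_distrib, ← mul_sum, ← mul_sum, h1,
    M.isProbWeight.2, pe]
  ring

lemma iidExp_tilt_pow_le [Nonempty R] {z : ℝ} (hz0 : 0 ≤ z) (hz1 : z ≤ 1) {m : ℕ} {κ₀ δ : ℝ}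
    (hκ₀ : 0 ≤ κ₀)
    (hH : iidExp M.w (fun T : Fin m → R => if κ₀ < M.joint z T then 1 else 0) ≤ δ)
    {B : Finset V} {u : V} (hu : u ∉ B) :
    iidExp M.w (fun S : V → R => M.tilt z B u S ^ m) ≤ 2 ^ m * (M.pe ^ m * κ₀ ^ #B + δ) := by
  have hpe := M.pe_nonneg
  set G : (Fin m → R) → R → ℝ := fun T s => ∏ i, (M.p * ind (M.I (T i) s) + M.pe) with hG
  have hG0 : ∀ T s, 0 ≤ G T s := fun T s => prod_nonneg fun i _ =>
    add_nonneg (mul_nonneg M.p_nonneg (ind_nonneg _)) hpe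
  have hG2 : ∀ T s, G T s ≤ 2 ^ m := by
    intro T s
    calc G T s ≤ ∏ i : Fin m, (2 : ℝ) := prod_le_prod
          (fun i _ => add_nonneg (mul_nonneg M.p_nonneg (ind_nonneg _)) hpe) fun i _ => by
            have := mul_le_one₀ M.p_le_one (ind_nonneg (M.I (T i) s)) (ind_le_one _)
            have := M.pe_le_one
            linarith
      _ = 2 ^ m := by simp
  set F : (Fin m → R) → ℝ := fun T => ∑ s, M.w s * G T s with hF
  have hF0 : ∀ T, 0 ≤ F T := fun T =>
    sum_nonneg fun s _ => mul_nonneg (M.isProbWeight.1 s) (hG0 T s)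
  have hF2 : ∀ T, F T ≤ 2 ^ m := fun T => by
    calc F T ≤ ∑ s, M.w s * 2 ^ m :=
          sum_le_sum fun s _ => mul_le_mul_of_nonneg_left (hG2 T s) (M.isProbWeight.1 s)
      _ = 2 ^ m := by rw [← sum_mul, M.isProbWeight.2, one_mul]
  have h1 : iidExp M.w (fun S : V → R => M.tilt z B u S ^ m) =
      iidExp M.w fun T : Fin m → R => F T * M.joint z T ^ #B := by
    have : ∀ S : V → R, M.tilt z B u S ^ m = iidExp M.w fun T : Fin m → R =>
        ∏ j ∈ insert u B, (if j = u then G T (S j) else ∏ i, M.fac z (T i) (S j)) := by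
      intro S
      rw [tilt, iidExp_pow]
      refine congrArg _ (funext fun T => ?_)
      rw [prod_insert hu, if_pos rfl, prod_mul_distrib, Finset.prod_comm]
      congr 1
      refine prod_congr rfl fun j hj => ?_
      rw [if_neg (ne_of_mem_of_not_mem hj hu)]
      rfl
    simp only [this]
    rw [iidExp_comm]
    refine congrArg _ (funext fun T => ?_)
    rw [iidExp_prod M.isProbWeight (insert u B) (fun j => j) (fun _ _ _ _ h => h)
      (fun j s => if j = u then G T s else ∏ i, M.fac z (T i) s), prod_insert hu]
    simp only [if_true]
    congr 1
    rw [← prod_const]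
    refine prod_congr rfl fun j hj => ?_
    simp only [if_neg (ne_of_mem_of_not_mem hj hu)]
    rfl
  have h2 : iidExp M.w F = (2 * M.pe) ^ m := by
    simp only [hF, iidExp_sum, iidExp_mul_left]
    have : ∀ s, iidExp M.w (fun T : Fin m → R => G T s) = (2 * M.pe) ^ m := by
      intro s
      rw [← M.sum_w_mul_ind_add s, iidExp_pow]
    simp only [this, ← sum_mul, M.isProbWeight.2, one_mul]
  rw [h1]
  refine le_trans (iidExp_mono M.isProbWeight (g := fun T =>
    κ₀ ^ #B * F T + 2 ^ m * if κ₀ < M.joint z T then 1 else 0) fun T => ?_) ?_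
  · have h0 := M.joint_nonneg hz0 T
    split_ifs with h
    · have h3 := mul_le_mul (hF2 T) (pow_le_one₀ (n := #B) h0 (M.joint_le_one hz0 hz1 T))
        (pow_nonneg h0 _) (by positivity)
      have h4 := mul_nonneg (pow_nonneg hκ₀ #B) (hF0 T)
      linarith
    · rw [mul_zero, add_zero, mul_comm]
      exact mul_le_mul_of_nonneg_right (pow_le_pow_left₀ h0 (not_lt.1 h) _) (hF0 T)
  · rw [iidExp_add, iidExp_mul_left, iidExp_mul_left, h2, mul_pow]
    have : (0 : ℝ) ≤ 2 ^ m := by positivity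
    nlinarith [mul_le_mul_of_nonneg_left hH this]

lemma exp_prod_pow_deg (z : ℝ) {A Q : Finset V} (hQ : Q ⊆ A) {m : ℕ} (hm : #Q = m) :
    M.exp (fun ω => ∏ i ∈ Q, z ^ M.deg ω (A \ Q) i) =
      iidExp M.w fun T : Fin m → R => M.joint z T ^ (#A - m) := by
  have h1 : ∀ S : V → R, iidExp (bern M.p) (fun c => ∏ i ∈ Q, z ^ M.deg (S, c) (A \ Q) i) =
      ∏ j ∈ A \ Q, ∏ i ∈ Q, M.fac z (S i) (S j) := by
    intro S
    have : ∀ c : Sym2 V → Bool, ∏ i ∈ Q, z ^ M.deg (S, c) (A \ Q) i =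
        ∏ x ∈ (A \ Q) ×ˢ Q, if M.I (S x.2) (S x.1) && c s(x.2, x.1) then z else 1 := by
      intro c
      rw [prod_product_right]
      refine prod_congr rfl fun i hi => ?_
      rw [pow_deg]
      refine prod_congr rfl fun j hj => ?_
      have : i ≠ j := fun h => (mem_sdiff.1 hj).2 (h ▸ hi)
      simp [adj, this]
    simp only [this]
    rw [iidExp_prod M.isProbWeight_bern ((A \ Q) ×ˢ Q) (fun x => s(x.2, x.1)) ?_
      (fun x b => if M.I (S x.2) (S x.1) && b then z else 1), prod_product]
    · refine prod_congr rfl fun j _ => prod_congr rfl fun i _ => ?_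
      cases hI : M.I (S i) (S j) <;> simp [bern, fac, hI] <;> ring
    · rintro ⟨j, i⟩ h ⟨j', i'⟩ h' he
      simp only [mem_coe, mem_product] at h h'
      simp only [Sym2.eq_iff] at he
      rcases he with ⟨rfl, rfl⟩ | ⟨rfl, rfl⟩
      · rfl
      · exact absurd h.2 (mem_sdiff.1 h'.1).2
  have hcard : #(A \ Q) = #A - m := by rw [card_sdiff_of_subset hQ, hm]
  let e : Fin m ≃ Q := (Q.equivFinOfCardEq hm).symm
  simp only [exp, h1]
  rw [iidExp_piecewise M.isProbWeight (A \ Q),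
    ← iidExp_comp M.isProbWeight (fun k => ((e k : Q) : V))
      (Subtype.val_injective.comp e.injective)]
  refine congrArg _ (funext fun S => ?_)
  have h2 : ∀ S' : V → R, ∏ j ∈ A \ Q, ∏ i ∈ Q,
      M.fac z ((A \ Q).piecewise S' S i) ((A \ Q).piecewise S' S j) =
      ∏ j ∈ A \ Q, ∏ k, M.fac z (S (e k)) (S' j) := by
    intro S'
    refine prod_congr rfl fun j hj => ?_
    rw [piecewise_eq_of_mem _ _ _ hj, Equiv.prod_comp e (fun x => M.fac z (S x) (S' j)),
      ← prod_coe_sort Q]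
    refine prod_congr rfl fun i _ => ?_
    rw [piecewise_eq_of_notMem _ _ _ (fun h => (mem_sdiff.1 h).2 i.2)]
  simp only [h2]
  rw [iidExp_prod M.isProbWeight (A \ Q) (fun j => j) (fun _ _ _ _ h => h)
    (fun _ s => ∏ k, M.fac z (S (e k)) s), prod_const, hcard]
  rfl

lemma exp_choose_low_le {z : ℝ} (hz0 : 0 < z) (hz1 : z ≤ 1) {m : ℕ} {κ₀ δ : ℝ} (hκ₀ : 0 ≤ κ₀)
    (hH : iidExp M.w (fun T : Fin m → R => if κ₀ < M.joint z T then 1 else 0) ≤ δ)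
    (h : ℕ) (A : Finset V) :
    M.exp (fun ω => ((#(M.low h ω A)).choose m : ℝ)) ≤
      (#A).choose m * ((z⁻¹ ^ (h + 1)) ^ m * (κ₀ ^ (#A - m) + δ)) := by
  have h1 : ∀ ω, ((#(M.low h ω A)).choose m : ℝ) ≤
      ∑ Q ∈ A.powersetCard m, (z⁻¹ ^ (h + 1)) ^ m * ∏ i ∈ Q, z ^ M.deg ω (A \ Q) i := by
    intro ω
    have hsub : (M.low h ω A).powersetCard m ⊆ A.powersetCard m :=
      powersetCard_mono (filter_subset _ _)
    rw [← card_powersetCard, card_eq_sum_ones, Nat.cast_sum]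
    refine le_trans (sum_le_sum fun Q hQ => ?_) (sum_le_sum_of_subset_of_nonneg hsub
      fun Q _ _ => by positivity)
    obtain ⟨hQ1, hQ2⟩ := mem_powersetCard.1 hQ
    rw [← hQ2, ← prod_const, ← prod_mul_distrib, Nat.cast_one]
    rw [← prod_const_one (s := Q)]
    refine prod_le_prod (fun _ _ => zero_le_one) fun i hi => ?_
    have hd : M.deg ω (A \ Q) i ≤ h + 1 :=
      (card_le_card (filter_subset_filter _ sdiff_subset)).trans (mem_filter.1 (hQ1 hi)).2
    have h3 : z ^ (h + 1) ≤ z ^ M.deg ω (A \ Q) i := pow_le_pow_of_le_one hz0.le hz1 hd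
    rw [inv_pow]
    have h4 : (0 : ℝ) < z ^ (h + 1) := by positivity
    calc (1 : ℝ) = (z ^ (h + 1))⁻¹ * z ^ (h + 1) := by field_simp
      _ ≤ _ := by gcongr
  refine (M.exp_mono h1).trans ?_
  rw [exp_sum, ← card_powersetCard, ← nsmul_eq_mul]
  refine sum_le_card_nsmul _ _ _ fun Q hQ => ?_
  obtain ⟨hQ1, hQ2⟩ := mem_powersetCard.1 hQ
  rw [exp_mul_left, M.exp_prod_pow_deg z hQ1 hQ2]
  exact mul_le_mul_of_nonneg_left (M.iidExp_joint_pow_le hz0.le hz1 hκ₀ hH _) (by positivity)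

end RingModel

namespace RingModel

set_option linter.unusedSectionVars false

variable {V R : Type*} [Fintype V] [DecidableEq V] [Fintype R] (M : RingModel R)

/-- Some neighbour of `v` in `A` has its property of having degree `h` affected by `v`. -/
def Pivotal (h : ℕ) (ω : (V → R) × (Sym2 V → Bool)) (A : Finset V) (v : V) : Prop :=
  ∃ j ∈ A, M.adj ω v j ∧ (M.deg ω A j = h ∨ M.deg ω A j + 1 = h)

open Classical in
/-- The real indicator of a proposition. -/
noncomputable def indic (p : Prop) : ℝ := if p then 1 else 0

lemma indic_nonneg (p : Prop) : 0 ≤ indic p := by unfold indic; split_ifs <;> simp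
lemma indic_le_one (p : Prop) : indic p ≤ 1 := by unfold indic; split_ifs <;> simp
lemma indic_of_true {p : Prop} (h : p) : indic p = 1 := if_pos h
lemma indic_of_false {p : Prop} (h : ¬p) : indic p = 0 := if_neg h

variable {M} {ω : (V → R) × (Sym2 V → Bool)} {A : Finset V} {v : V} {h : ℕ}

lemma deg_insert (hv : v ∉ A) (j : V) :
    M.deg ω (insert v A) j = M.deg ω A j + if M.adj ω v j then 1 else 0 := by
  unfold deg
  rw [filter_insert, M.adj_comm ω v j]
  split_ifs with h1
  · rw [card_insert_of_notMem (by simp [hv])]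
  · simp

lemma deg_insert_self (hv : v ∉ A) : M.deg ω (insert v A) v = M.deg ω A v := by
  simp [deg_insert hv]

lemma deg_mono {B : Finset V} (hBA : B ⊆ A) (i : V) : M.deg ω B i ≤ M.deg ω A i :=
  card_le_card (filter_subset_filter _ hBA)

lemma cnt_insert_of_not_pivotal (hv : v ∉ A) (hJ : ¬M.Pivotal h ω A v) :
    M.cnt h ω (insert v A) = M.cnt h ω A + if M.deg ω A v = h then 1 else 0 := by
  have h1 : A.filter (fun i => M.deg ω (insert v A) i = h) =
      A.filter (fun i => M.deg ω A i = h) := by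
    refine filter_congr fun j hj => ?_
    rw [deg_insert hv]
    by_cases hadj : M.adj ω v j
    · have : ¬(M.deg ω A j = h ∨ M.deg ω A j + 1 = h) := fun hd => hJ ⟨j, hj, hadj, hd⟩
      rw [if_pos hadj]
      tauto
    · rw [if_neg hadj, add_zero]
  unfold cnt
  rw [filter_insert, h1, deg_insert_self hv]
  split_ifs with h2
  · rw [card_insert_of_notMem (by simp [hv])]
  · simp

lemma cnt_add_one_le (hv : v ∉ A) (hd : M.deg ω A v = h) :
    M.cnt h ω A + 1 ≤ M.cnt h ω (insert v A) + h := by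
  have h1 : A.filter (fun i => M.deg ω A i = h) ⊆
      A.filter (fun i => M.deg ω (insert v A) i = h) ∪ A.filter (fun j => M.adj ω v j) := by
    intro j hj
    rw [mem_filter] at hj
    by_cases hadj : M.adj ω v j
    · exact mem_union_right _ (mem_filter.2 ⟨hj.1, hadj⟩)
    · refine mem_union_left _ (mem_filter.2 ⟨hj.1, ?_⟩)
      rw [deg_insert hv, if_neg hadj, hj.2, add_zero]
  have h2 := (card_le_card h1).trans (card_union_le _ _)
  have h3 : M.cnt h ω (insert v A) = #(A.filter fun i => M.deg ω (insert v A) i = h) + 1 := by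
    unfold cnt
    rw [filter_insert, deg_insert_self hv, if_pos hd, card_insert_of_notMem (by simp [hv])]
  have h4 : #(A.filter fun j => M.adj ω v j) = h := hd
  rw [h3]
  unfold cnt
  omega

lemma indic_pivotal_le : indic (M.Pivotal h ω A v) ≤
    ∑ j ∈ M.low h ω A, ind (M.adj ω v j) := by
  by_cases hJ : M.Pivotal h ω A v
  · obtain ⟨j, hj, hadj, hd⟩ := id hJ
    rw [indic_of_true hJ]
    have h1 : j ∈ M.low h ω A := mem_filter.2 ⟨hj, by omega⟩
    refine le_trans ?_ (single_le_sum (fun i _ => ind_nonneg (M.adj ω v i)) h1)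
    simp [hadj]
  · rw [indic_of_false hJ]
    exact sum_nonneg fun i _ => ind_nonneg _

lemma indic_pivotal_le_insert (hv : v ∉ A) : indic (M.Pivotal h ω A v) ≤
    ∑ j ∈ M.low h ω (insert v A), ind (M.adj ω v j) := by
  by_cases hJ : M.Pivotal h ω A v
  · obtain ⟨j, hj, hadj, hd⟩ := id hJ
    rw [indic_of_true hJ]
    have h1 : j ∈ M.low h ω (insert v A) := mem_filter.2 ⟨mem_insert_of_mem hj, by
      rw [deg_insert hv, if_pos hadj]; omega⟩
    refine le_trans ?_ (single_le_sum (fun i _ => ind_nonneg (M.adj ω v i)) h1)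
    simp [hadj]
  · rw [indic_of_false hJ]
    exact sum_nonneg fun i _ => ind_nonneg _

lemma sum_ind_adj (B : Finset V) (j : V) : ∑ u ∈ B, ind (M.adj ω u j) = M.deg ω B j := by
  simp [deg, ind, sum_boole, M.adj_comm ω _ j]

lemma sum_indic_pivotal_le :
    ∑ u ∈ A, indic (M.Pivotal h ω (A.erase u) u) ≤ (h + 1) * #(M.low h ω A) := by
  calc _ ≤ ∑ u ∈ A, ∑ j ∈ M.low h ω A, ind (M.adj ω u j) := sum_le_sum fun u hu => by
        have := indic_pivotal_le_insert (M := M) (ω := ω) (h := h) (notMem_erase u A)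
        rwa [insert_erase hu] at this
    _ = ∑ j ∈ M.low h ω A, (M.deg ω A j : ℝ) := by
        rw [sum_comm]
        exact sum_congr rfl fun j _ => sum_ind_adj A j
    _ ≤ ∑ j ∈ M.low h ω A, ((h : ℝ) + 1) := sum_le_sum fun j hj => by
        exact_mod_cast (mem_filter.1 hj).2
    _ = _ := by rw [sum_const, nsmul_eq_mul]; ring

lemma abs_pow_cnt_sub_le {t : ℝ} (ht : 0 < t) (ht1 : t ≤ 1) (hv : v ∉ A) :
    |t ^ M.cnt h ω (insert v A) - t ^ M.cnt h ω A| ≤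
      t⁻¹ * (t ^ M.cnt h ω (insert v A) * indic (M.deg ω (insert v A) v = h)) +
        indic (M.Pivotal h ω A v) * (t ^ M.cnt h ω (insert v A) + t ^ M.cnt h ω A) := by
  have h0 : 0 < t ^ M.cnt h ω (insert v A) := by positivity
  have h1 : 0 < t ^ M.cnt h ω A := by positivity
  by_cases hJ : M.Pivotal h ω A v
  · rw [indic_of_true hJ, one_mul]
    have := indic_nonneg (M.deg ω (insert v A) v = h)
    have : 0 ≤ t⁻¹ * (t ^ M.cnt h ω (insert v A) * indic (M.deg ω (insert v A) v = h)) := by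
      positivity
    rw [abs_le]
    constructor <;> linarith
  · rw [indic_of_false hJ, zero_mul, add_zero, cnt_insert_of_not_pivotal hv hJ, deg_insert_self hv]
    split_ifs with hd
    · rw [indic_of_true hd, mul_one, abs_sub_comm, pow_succ, abs_of_nonneg (by nlinarith)]
      have : t⁻¹ * (t ^ M.cnt h ω A * t) = t ^ M.cnt h ω A := by field_simp
      rw [this]
      nlinarith
    · rw [indic_of_false hd]
      simp

lemma abs_pow_cnt_pred_sub_le {t : ℝ} (ht : 0 < t) (ht1 : t ≤ 1) (hv : v ∉ A)
    (hd : M.deg ω A v = h) :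
    |t ^ (M.cnt h ω (insert v A) - 1) - t ^ M.cnt h ω A| ≤
      t⁻¹ ^ h * t ^ M.cnt h ω A * indic (M.Pivotal h ω A v) := by
  by_cases hJ : M.Pivotal h ω A v
  · rw [indic_of_true hJ, mul_one]
    have h1 := cnt_add_one_le hv hd
    have h0 : 0 < t ^ (M.cnt h ω (insert v A) - 1) := by positivity
    have h2 : 0 < t ^ M.cnt h ω A := by positivity
    have h3 : (1 : ℝ) ≤ t⁻¹ ^ h := one_le_pow₀ ((one_le_inv₀ ht).2 ht1)
    have h4 : t ^ (M.cnt h ω (insert v A) - 1) ≤ t⁻¹ ^ h * t ^ M.cnt h ω A := by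
      calc t ^ (M.cnt h ω (insert v A) - 1)
          = t⁻¹ ^ h * t ^ ((M.cnt h ω (insert v A) - 1) + h) := by
            rw [pow_add, inv_pow]; field_simp
        _ ≤ _ := by
            refine mul_le_mul_of_nonneg_left ?_ (by positivity)
            exact pow_le_pow_of_le_one ht.le ht1 (by omega)
    rw [abs_le]
    constructor <;> nlinarith
  · rw [indic_of_false hJ, cnt_insert_of_not_pivotal hv hJ, if_pos hd]
    simp

end RingModel

namespace RingModel

set_option linter.unusedSectionVars false

variable {V R : Type*} [Fintype V] [DecidableEq V] [Fintype R] {M : RingModel R}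

lemma le_add_pow_div {Z β : ℝ} (hβ : 0 < β) (hZ : 0 ≤ Z) {m : ℕ} (hm : 1 ≤ m) :
    Z ≤ β + Z ^ m / β ^ (m - 1) := by
  obtain ⟨k, rfl⟩ := Nat.exists_eq_add_of_le' hm
  rw [Nat.add_sub_cancel]
  rcases le_total Z β with h | h
  · have : 0 ≤ Z ^ (k + 1) / β ^ k := by positivity
    linarith
  · have : Z ≤ Z ^ (k + 1) / β ^ k := by
      rw [le_div_iff₀ (by positivity), pow_succ, mul_comm]
      exact mul_le_mul_of_nonneg_right (pow_le_pow_left₀ hβ.le h k) hZ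
    linarith

lemma tilt_nonneg [Nonempty R] {z : ℝ} (hz0 : 0 ≤ z) (B : Finset V) (u : V) (S : V → R) :
    0 ≤ M.tilt z B u S :=
  sum_nonneg fun _ _ => mul_nonneg (M.isProbWeight.1 _) (mul_nonneg
    (add_nonneg (mul_nonneg M.p_nonneg (ind_nonneg _)) M.pe_nonneg)
    (prod_nonneg fun _ _ => M.fac_nonneg hz0 _ _))

lemma exp_mul_pow_deg_le [Nonempty R] {z β ξ c : ℝ} (hz0 : 0 ≤ z) (hβ : 0 < β) (hc : 0 ≤ c)
    {m : ℕ} (hm : 1 ≤ m) {v u : V} {B : Finset V} (hvB : v ∉ B) (huB : u ∉ B) (huv : u ≠ v)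
    (hξ : c ^ m * iidExp M.w (fun S : V → R => M.tilt z B u S ^ m) ≤ ξ * β ^ (m - 1))
    {f : (V → R) × (Sym2 V → Bool) → ℝ} (hf : ∀ ω ω', f (resample v ω ω') = f ω)
    (hf0 : ∀ ω, 0 ≤ f ω) (hf1 : ∀ ω, f ω ≤ 1) :
    c * M.exp (fun ω => f ω * ((ind (M.adj ω v u) + M.pe) * z ^ M.deg ω B v)) ≤
      β * M.exp f + ξ := by
  rw [exp_mul_pow_deg M hvB huB huv z hf, ← exp_mul_left]
  calc _ ≤ M.exp (fun ω => β * f ω + c ^ m / β ^ (m - 1) * M.tilt z B u ω.1 ^ m) := by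
        refine M.exp_mono fun ω => ?_
        have h1 := mul_nonneg hc (tilt_nonneg (M := M) hz0 B u ω.1)
        have h2 := le_add_pow_div hβ h1 hm
        have h3 := mul_le_mul_of_nonneg_left h2 (hf0 ω)
        have h4 : 0 ≤ (c * M.tilt z B u ω.1) ^ m / β ^ (m - 1) := by positivity
        have h5 := mul_le_mul_of_nonneg_right (hf1 ω) h4
        have h6 : c ^ m / β ^ (m - 1) * M.tilt z B u ω.1 ^ m =
          (c * M.tilt z B u ω.1) ^ m / β ^ (m - 1) := by rw [mul_pow]; ring
        rw [h6]
        nlinarith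
    _ ≤ _ := by
        rw [exp_add, exp_mul_left, exp_mul_left, M.exp_labels fun S => M.tilt z B u S ^ m]
        have : c ^ m / β ^ (m - 1) * iidExp M.w (fun S : V → R => M.tilt z B u S ^ m) ≤ ξ := by
          rw [div_mul_eq_mul_div, div_le_iff₀ (by positivity)]
          exact hξ
        linarith

lemma exp_low_mul_le {t : ℝ} (ht : 0 < t) (ht1 : t ≤ 1) {h m a : ℕ} (ham : m ≤ a) {cL : ℝ}
    {A : Finset V} (hL : M.exp (fun ω => ((#(M.low h ω A)).choose m : ℝ)) ≤ cL) :
    M.exp (fun ω => #(M.low h ω A) * t ^ M.cnt h ω A) ≤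
      a * M.exp (fun ω => t ^ M.cnt h ω A) + Fintype.card V * cL / a.choose m := by
  have hC : (0 : ℝ) < a.choose m := by exact_mod_cast Nat.choose_pos ham
  calc _ ≤ M.exp (fun ω => a * t ^ M.cnt h ω A +
        Fintype.card V / a.choose m * ((#(M.low h ω A)).choose m : ℝ)) := by
        refine M.exp_mono fun ω => ?_
        have h0 : 0 < t ^ M.cnt h ω A := by positivity
        have h1 : t ^ M.cnt h ω A ≤ 1 := pow_le_one₀ ht.le ht1
        rcases le_total #(M.low h ω A) a with hle | hle
        · have h2 : (#(M.low h ω A) : ℝ) ≤ a := by exact_mod_cast hle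
          have h3 : (0 : ℝ) ≤ Fintype.card V / a.choose m * ((#(M.low h ω A)).choose m : ℝ) := by
            positivity
          nlinarith
        · have h2 : (a.choose m : ℝ) ≤ (#(M.low h ω A)).choose m := by
            exact_mod_cast Nat.choose_le_choose m hle
          have h3 : (#(M.low h ω A) : ℝ) ≤ Fintype.card V := by exact_mod_cast card_le_univ _
          have h4 : (Fintype.card V : ℝ) ≤
              Fintype.card V / a.choose m * ((#(M.low h ω A)).choose m : ℝ) := by
            rw [div_mul_eq_mul_div, le_div_iff₀ hC]
            exact mul_le_mul_of_nonneg_left h2 (by positivity)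
          have h5 : (0 : ℝ) ≤ a * t ^ M.cnt h ω A := by positivity
          have h6 : (0 : ℝ) ≤ #(M.low h ω A) := by positivity
          nlinarith
    _ ≤ _ := by
        rw [exp_add, exp_mul_left, exp_mul_left]
        have h2 : (Fintype.card V : ℝ) / a.choose m *
          M.exp (fun ω => ((#(M.low h ω A)).choose m : ℝ)) ≤
          Fintype.card V / a.choose m * cL := mul_le_mul_of_nonneg_left hL (by positivity)
        have h3 : (Fintype.card V : ℝ) / a.choose m * cL = Fintype.card V * cL / a.choose m := by
          ring
        linarith

variable (M) in
/-- Total influence of the vertices of `A` on `t ^ cnt`. -/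
noncomputable def infl (h : ℕ) (t : ℝ) (A : Finset V) : ℝ :=
  ∑ u ∈ A, M.exp fun ω => |t ^ M.cnt h ω A - t ^ M.cnt h ω (A.erase u)|

lemma infl_nonneg (h : ℕ) (t : ℝ) (A : Finset V) : 0 ≤ M.infl h t A :=
  sum_nonneg fun _ _ => M.exp_nonneg fun _ => abs_nonneg _

lemma abs_sum_exp_erase_sub_le (h : ℕ) (t : ℝ) (A : Finset V) :
    |∑ u ∈ A, M.exp (fun ω => t ^ M.cnt h ω (A.erase u)) -
      #A * M.exp (fun ω => t ^ M.cnt h ω A)| ≤ M.infl h t A := by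
  rw [← nsmul_eq_mul, ← sum_const, ← sum_sub_distrib]
  refine (abs_sum_le_sum_abs _ _).trans (sum_le_sum fun u _ => ?_)
  rw [abs_sub_comm, ← exp_sub]
  exact M.abs_exp_le _

lemma cnt_le_card_low (h : ℕ) (ω : (V → R) × (Sym2 V → Bool)) (A : Finset V) :
    M.cnt h ω A ≤ #(M.low h ω A) :=
  card_le_card fun i hi => by
    rw [mem_filter] at hi
    exact mem_filter.2 ⟨hi.1, by omega⟩

lemma sum_indic_deg (h : ℕ) (ω : (V → R) × (Sym2 V → Bool)) (A : Finset V) :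
    ∑ u ∈ A, indic (M.deg ω A u = h) = M.cnt h ω A := by
  rw [cnt, card_filter, Nat.cast_sum]
  refine sum_congr rfl fun u _ => ?_
  unfold indic
  split_ifs <;> simp

lemma infl_le [Nonempty R] {t : ℝ} (ht : 0 < t) (ht1 : t ≤ 1) {h : ℕ} {a b c : ℝ} (ha : 0 ≤ a)
    (hb : 0 ≤ b)
    (hlow : ∀ A : Finset V, Fintype.card V ≤ #A + 2 →
      M.exp (fun ω => #(M.low h ω A) * t ^ M.cnt h ω A) ≤
      a * M.exp (fun ω => t ^ M.cnt h ω A) + b)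
    (hpa : M.pe * a ≤ 1 / 2) (hc : Fintype.card V * M.pe ≤ c) {A : Finset V}
    (hA : Fintype.card V ≤ #A + 1) :
    M.infl h t A ≤ 2 * (t⁻¹ + h + 1 + c) * (a * M.exp (fun ω => t ^ M.cnt h ω A) + b) := by
  set g := M.exp (fun ω => t ^ M.cnt h ω A) with hg
  have hg0 : 0 ≤ g := M.exp_nonneg fun _ => by positivity
  have hpe := M.pe_nonneg
  have h1 : M.infl h t A ≤
      M.exp (fun ω => t⁻¹ * (∑ u ∈ A, t ^ M.cnt h ω A * indic (M.deg ω A u = h)) +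
        (∑ u ∈ A, indic (M.Pivotal h ω (A.erase u) u)) * t ^ M.cnt h ω A) +
      ∑ u ∈ A, M.exp (fun ω => indic (M.Pivotal h ω (A.erase u) u) *
        t ^ M.cnt h ω (A.erase u)) := by
    rw [infl, ← exp_sum, ← exp_sum, ← exp_add]
    refine M.exp_mono fun ω => ?_
    rw [mul_sum, sum_mul, ← sum_add_distrib, ← sum_add_distrib]
    refine sum_le_sum fun u hu => ?_
    have := abs_pow_cnt_sub_le (M := M) (ω := ω) (h := h) ht ht1 (notMem_erase u A)
    rw [insert_erase hu] at this
    linarith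
  have h2 : M.exp (fun ω => t⁻¹ * (∑ u ∈ A, t ^ M.cnt h ω A * indic (M.deg ω A u = h)) +
        (∑ u ∈ A, indic (M.Pivotal h ω (A.erase u) u)) * t ^ M.cnt h ω A) ≤
      (t⁻¹ + (h + 1)) * (a * g + b) := by
    refine le_trans ?_ (mul_le_mul_of_nonneg_left (hlow A (by omega)) (by positivity))
    rw [← exp_mul_left]
    refine M.exp_mono fun ω => ?_
    rw [← mul_sum, sum_indic_deg]
    have h3 := sum_indic_pivotal_le (M := M) (h := h) (ω := ω) (A := A)
    have h4 : (M.cnt h ω A : ℝ) ≤ #(M.low h ω A) := by exact_mod_cast cnt_le_card_low h ω A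
    have h5 : 0 < t ^ M.cnt h ω A := by positivity
    have h6 : t⁻¹ * (t ^ M.cnt h ω A * M.cnt h ω A) ≤
        t⁻¹ * (t ^ M.cnt h ω A * #(M.low h ω A)) := by gcongr
    have h7 := mul_le_mul_of_nonneg_right h3 h5.le
    linarith
  have h3 : ∀ u ∈ A, M.exp (fun ω => indic (M.Pivotal h ω (A.erase u) u) *
        t ^ M.cnt h ω (A.erase u)) ≤
      M.pe * (a * M.exp (fun ω => t ^ M.cnt h ω (A.erase u)) + b) := by
    intro u hu
    refine le_trans ?_ (mul_le_mul_of_nonneg_left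
      (hlow _ (by have := card_erase_add_one hu; omega)) hpe)
    have hu' := notMem_erase u A
    calc _ ≤ M.exp (fun ω => ∑ j ∈ M.low h ω (A.erase u), ind (M.adj ω u j) *
          t ^ M.cnt h ω (A.erase u)) := by
          refine M.exp_mono fun ω => ?_
          rw [← sum_mul]
          exact mul_le_mul_of_nonneg_right indic_pivotal_le (by positivity)
      _ = _ := by
          rw [M.exp_resample u, ← exp_mul_left]
          refine congrArg _ (funext fun ω => ?_)
          simp only [M.low_resample h hu', M.cnt_resample h hu']
          rw [exp_sum]
          have : ∀ j ∈ M.low h ω (A.erase u), M.exp (fun ω' =>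
              ind (M.adj (resample u ω ω') u j) * t ^ M.cnt h ω (A.erase u)) =
              M.pe * t ^ M.cnt h ω (A.erase u) := by
            intro j hj
            have hj' : j ≠ u := ne_of_mem_of_not_mem (filter_subset _ _ hj) hu'
            simp only [mul_comm _ (t ^ M.cnt h ω (A.erase u))]
            rw [exp_mul_left, M.exp_adj_resample hj']
          rw [sum_congr rfl this, sum_const, nsmul_eq_mul]
          ring
  have h4 : ∑ u ∈ A, M.exp (fun ω => indic (M.Pivotal h ω (A.erase u) u) *
        t ^ M.cnt h ω (A.erase u)) ≤ M.pe * (a * (#A * g + M.infl h t A) + #A * b) := by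
    refine (sum_le_sum h3).trans ?_
    rw [← mul_sum, sum_add_distrib, ← mul_sum, sum_const, nsmul_eq_mul]
    have := (abs_le.1 (abs_sum_exp_erase_sub_le (M := M) h t A)).2
    refine mul_le_mul_of_nonneg_left ?_ hpe
    have := mul_le_mul_of_nonneg_left (sub_le_iff_le_add'.1 this) ha
    linarith
  have hI := infl_nonneg (M := M) h t A
  have h5 : M.pe * a * M.infl h t A ≤ 1 / 2 * M.infl h t A := mul_le_mul_of_nonneg_right hpa hI
  have h6 : (#A : ℝ) * M.pe ≤ c :=
    (mul_le_mul_of_nonneg_right (by exact_mod_cast card_le_univ A) hpe).trans hc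
  have h7 : (#A : ℝ) * M.pe * (a * g + b) ≤ c * (a * g + b) :=
    mul_le_mul_of_nonneg_right h6 (by positivity)
  nlinarith

variable (M) in
/-- Probability that `d` plus a binomial variable with parameters `j` and `pe` equals `h`. -/
noncomputable def binProb (h : ℕ) : ℕ → ℕ → ℝ
  | 0, d => if d = h then 1 else 0
  | j + 1, d => (1 - M.pe) * binProb h j d + M.pe * binProb h j (d + 1)

lemma binProb_nonneg [Nonempty R] (h j d : ℕ) : 0 ≤ M.binProb h j d := by
  have h0 := M.pe_nonneg
  have h1 := M.pe_le_one
  induction j generalizing d with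
  | zero => unfold binProb; split_ifs <;> simp
  | succ j ih =>
    exact add_nonneg (mul_nonneg (by linarith) (ih d)) (mul_nonneg h0 (ih (d + 1)))

lemma binProb_le [Nonempty R] {z : ℝ} (hz : 0 < z) (h j d : ℕ) :
    M.binProb h j d ≤ z⁻¹ ^ h * (z ^ d * (1 - (1 - z) * M.pe) ^ j) := by
  have h0 := M.pe_nonneg
  have h1 := M.pe_le_one
  induction j generalizing d with
  | zero =>
    unfold binProb
    split_ifs with hd
    · subst hd
      rw [pow_zero, mul_one, ← mul_pow, inv_mul_cancel₀ hz.ne', one_pow]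
    · positivity
  | succ j ih =>
    calc M.binProb h (j + 1) d = (1 - M.pe) * M.binProb h j d + M.pe * M.binProb h j (d + 1) := rfl
      _ ≤ (1 - M.pe) * (z⁻¹ ^ h * (z ^ d * (1 - (1 - z) * M.pe) ^ j)) +
          M.pe * (z⁻¹ ^ h * (z ^ (d + 1) * (1 - (1 - z) * M.pe) ^ j)) :=
        add_le_add (mul_le_mul_of_nonneg_left (ih d) (by linarith))
          (mul_le_mul_of_nonneg_left (ih (d + 1)) h0)
      _ = _ := by ring

lemma abs_binProb_sub_le [Nonempty R] {z : ℝ} (hz : 0 < z) (hz1 : z ≤ 1) (h j d : ℕ) :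
    |M.binProb h j (d + 1) - M.binProb h j d| ≤ z⁻¹ ^ h * (z ^ d * (1 - (1 - z) * M.pe) ^ j) := by
  have h0 := M.pe_nonneg
  have h1 := M.pe_le_one
  have h2 := binProb_le (M := M) hz h j d
  have h3 := binProb_le (M := M) hz h j (d + 1)
  have h4 := binProb_nonneg (M := M) h j d
  have h5 := binProb_nonneg (M := M) h j (d + 1)
  have h7 : 0 ≤ 1 - (1 - z) * M.pe := by nlinarith
  have h6 : z⁻¹ ^ h * (z ^ (d + 1) * (1 - (1 - z) * M.pe) ^ j) ≤
      z⁻¹ ^ h * (z ^ d * (1 - (1 - z) * M.pe) ^ j) := by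
    have := pow_le_pow_of_le_one hz.le hz1 (Nat.le_succ d)
    gcongr
  rw [abs_le]
  constructor <;> linarith

end RingModel

namespace RingModel

set_option linter.unusedSectionVars false

variable {V R : Type*} [Fintype V] [DecidableEq V] [Fintype R] {M : RingModel R}

lemma deg_insert_left {ω : (V → R) × (Sym2 V → Bool)} {B : Finset V} {u : V} (hu : u ∉ B) (v : V) :
    M.deg ω (insert u B) v = M.deg ω B v + if M.adj ω v u then 1 else 0 := by
  rw [deg_insert hu, M.adj_comm ω u v]

lemma low_subset (h : ℕ) (ω : (V → R) × (Sym2 V → Bool)) (A : Finset V) : M.low h ω A ⊆ A :=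
  filter_subset _ A

lemma abs_hybrid_step_le [Nonempty R] {z β ξ t : ℝ} (hz0 : 0 < z) (hz1 : z ≤ 1) (hβ : 0 < β)
    (ht : 0 < t) (ht1 : t ≤ 1) {m : ℕ} (hm : 1 ≤ m) {h : ℕ} {v u : V} {A B : Finset V}
    (hvA : v ∉ A) (huA : u ∈ A) (hBA : B ⊆ A) (huB : u ∉ B) (j : ℕ)
    (hξ : ((1 - (1 - z) * M.pe) ^ j) ^ m * iidExp M.w (fun S : V → R => M.tilt z B u S ^ m) ≤
      ξ * β ^ (m - 1)) :
    |M.exp (fun ω => t ^ M.cnt h ω A * M.binProb h j (M.deg ω (insert u B) v)) -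
      M.exp (fun ω => t ^ M.cnt h ω A * M.binProb h (j + 1) (M.deg ω B v))| ≤
      z⁻¹ ^ h * (β * M.exp (fun ω => |t ^ M.cnt h ω A - t ^ M.cnt h ω (A.erase u)|) + ξ) := by
  have hpe := M.pe_nonneg
  have hpe1 := M.pe_le_one
  have huv : u ≠ v := ne_of_mem_of_not_mem huA hvA
  have hvB : v ∉ B := fun hv => hvA (hBA hv)
  set D : (V → R) × (Sym2 V → Bool) → ℝ := fun ω => M.binProb h j (M.deg ω B v + 1) -
    M.binProb h j (M.deg ω B v) with hD
  have h1 : ∀ ω, t ^ M.cnt h ω A * M.binProb h j (M.deg ω (insert u B) v) -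
      t ^ M.cnt h ω A * M.binProb h (j + 1) (M.deg ω B v) =
      t ^ M.cnt h ω A * ((ind (M.adj ω v u) - M.pe) * D ω) := by
    intro ω
    rw [deg_insert_left huB]
    simp only [binProb, hD]
    cases M.adj ω v u <;> simp <;> ring
  have h2 : M.exp (fun ω => t ^ M.cnt h ω (A.erase u) * ((ind (M.adj ω v u) - M.pe) * D ω)) =
      0 := by
    rw [M.exp_resample u]
    have : ∀ ω, M.exp (fun ω' => t ^ M.cnt h (resample u ω ω') (A.erase u) *
        ((ind (M.adj (resample u ω ω') v u) - M.pe) * D (resample u ω ω'))) = 0 := by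
      intro ω
      have h3 : ∀ ω', D (resample u ω ω') = D ω := by
        intro ω'
        simp only [hD, M.deg_resample huv.symm huB]
      simp only [M.cnt_resample h (notMem_erase u A), exp_mul_left, h3, M.adj_comm _ v u,
        mul_comm _ (D ω), exp_sub, M.exp_adj_resample huv.symm, exp_const, sub_self, mul_zero]
    simp only [this, exp_const]
  rw [← exp_sub]
  have h4 : M.exp (fun ω => t ^ M.cnt h ω A * M.binProb h j (M.deg ω (insert u B) v) -
      t ^ M.cnt h ω A * M.binProb h (j + 1) (M.deg ω B v)) =
      M.exp (fun ω => (t ^ M.cnt h ω A - t ^ M.cnt h ω (A.erase u)) *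
        ((ind (M.adj ω v u) - M.pe) * D ω)) := by
    simp only [h1, sub_mul (t ^ _) (t ^ _)]
    rw [exp_sub, h2, sub_zero]
  rw [h4]
  have hc : 0 ≤ (1 - (1 - z) * M.pe) ^ j := pow_nonneg (by nlinarith) _
  have hcnt : ∀ ω ω', |t ^ M.cnt h (resample v ω ω') A -
      t ^ M.cnt h (resample v ω ω') (A.erase u)| =
      |t ^ M.cnt h ω A - t ^ M.cnt h ω (A.erase u)| := fun ω ω' => by
    rw [M.cnt_resample h hvA, M.cnt_resample h (fun hv => hvA (mem_of_mem_erase hv))]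
  have hle1 : ∀ ω, |t ^ M.cnt h ω A - t ^ M.cnt h ω (A.erase u)| ≤ 1 := by
    intro ω
    have h5 : 0 < t ^ M.cnt h ω A := by positivity
    have h6 : t ^ M.cnt h ω A ≤ 1 := pow_le_one₀ ht.le ht1
    have h7 : 0 < t ^ M.cnt h ω (A.erase u) := by positivity
    have h8 : t ^ M.cnt h ω (A.erase u) ≤ 1 := pow_le_one₀ ht.le ht1
    rw [abs_le]
    constructor <;> linarith
  refine (M.abs_exp_le _).trans ?_
  refine le_trans ?_ (mul_le_mul_of_nonneg_left (exp_mul_pow_deg_le hz0.le hβ hc hm hvB huB huv hξ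
    hcnt (fun _ => abs_nonneg _) hle1) (by positivity))
  rw [← exp_mul_left, ← exp_mul_left]
  refine M.exp_mono fun ω => ?_
  rw [abs_mul, abs_mul]
  have h5 : |ind (M.adj ω v u) - M.pe| ≤ ind (M.adj ω v u) + M.pe := by
    have := ind_nonneg (M.adj ω v u)
    rw [abs_le]
    constructor <;> linarith
  have h6 := abs_binProb_sub_le (M := M) hz0 hz1 h j (M.deg ω B v)
  have h7 := abs_nonneg (t ^ M.cnt h ω A - t ^ M.cnt h ω (A.erase u))
  calc _ ≤ |t ^ M.cnt h ω A - t ^ M.cnt h ω (A.erase u)| * ((ind (M.adj ω v u) + M.pe) *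
        (z⁻¹ ^ h * (z ^ M.deg ω B v * (1 - (1 - z) * M.pe) ^ j))) :=
        mul_le_mul_of_nonneg_left (mul_le_mul h5 h6 (abs_nonneg _)
          (add_nonneg (ind_nonneg _) hpe)) h7
    _ = _ := by ring

lemma abs_hybrid_le [Nonempty R] {z β ξ t : ℝ} (hz0 : 0 < z) (hz1 : z ≤ 1) (hβ : 0 < β)
    (ht : 0 < t) (ht1 : t ≤ 1) {m : ℕ} (hm : 1 ≤ m) {h : ℕ} {v : V} {A : Finset V} (hvA : v ∉ A)
    (hξ : ∀ (B : Finset V) (u : V) (j : ℕ), u ∉ B → j + #B + 1 = #A →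
      ((1 - (1 - z) * M.pe) ^ j) ^ m * iidExp M.w (fun S : V → R => M.tilt z B u S ^ m) ≤
      ξ * β ^ (m - 1)) :
    |M.exp (fun ω => t ^ M.cnt h ω A * indic (M.deg ω A v = h)) -
      M.binProb h #A 0 * M.exp (fun ω => t ^ M.cnt h ω A)| ≤
      z⁻¹ ^ h * (β * M.infl h t A + #A * ξ) := by
  have key : ∀ B : Finset V, B ⊆ A →
      |M.exp (fun ω => t ^ M.cnt h ω A * M.binProb h (#A - #B) (M.deg ω B v)) -
        M.binProb h #A 0 * M.exp (fun ω => t ^ M.cnt h ω A)| ≤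
      ∑ u ∈ B, z⁻¹ ^ h *
        (β * M.exp (fun ω => |t ^ M.cnt h ω A - t ^ M.cnt h ω (A.erase u)|) + ξ) := by
    intro B
    induction B using Finset.induction_on with
    | empty =>
      intro _
      have : ∀ ω, M.deg ω ∅ v = 0 := fun ω => by simp [deg]
      simp only [this, card_empty, tsub_zero, mul_comm _ (M.binProb h #A 0), exp_mul_left,
        sub_self, abs_zero, sum_empty, le_refl]
    | insert u B huB ih =>
      intro hBA
      have hBA' : B ⊆ A := (subset_insert u B).trans hBA
      have huA : u ∈ A := hBA (mem_insert_self u B)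
      have hcard : #B + 1 ≤ #A := by
        rw [← card_insert_of_notMem huB]
        exact card_le_card hBA
      obtain ⟨j, hj⟩ : ∃ j, j + #B + 1 = #A := ⟨#A - (#B + 1), by omega⟩
      have h1 := ih hBA'
      have h2 := abs_hybrid_step_le (h := h) hz0 hz1 hβ ht ht1 hm hvA huA hBA' huB j
        (hξ B u j huB hj)
      rw [sum_insert huB, card_insert_of_notMem huB]
      have e1 : #A - (#B + 1) = j := by omega
      have e2 : #A - #B = j + 1 := by omega
      rw [e2] at h1
      rw [e1]
      refine (abs_sub_le _ _ _).trans (add_le_add h2 h1)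
  have h1 := key A Subset.rfl
  rw [← mul_sum, sum_add_distrib, ← mul_sum, sum_const, nsmul_eq_mul, Nat.sub_self] at h1
  have h2 : ∀ ω, M.binProb h 0 (M.deg ω A v) = indic (M.deg ω A v = h) := fun ω => by
    unfold binProb indic
    split_ifs <;> rfl
  simp only [h2] at h1
  exact h1

lemma exp_low_adj_le [Nonempty R] {z β ξ t : ℝ} (hz0 : 0 < z) (hz1 : z ≤ 1) (hβ : 0 < β)
    (ht : 0 < t) (ht1 : t ≤ 1) {m : ℕ} (hm : 1 ≤ m) {h : ℕ} {v : V} {A : Finset V} (hvA : v ∉ A)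
    (hξ : ∀ (B : Finset V) (u : V), u ∉ B → #B + 1 = #A →
      iidExp M.w (fun S : V → R => M.tilt z B u S ^ m) ≤ ξ * β ^ (m - 1)) :
    M.exp (fun ω => indic (M.deg ω A v = h) *
      (t ^ M.cnt h ω A * indic (M.Pivotal h ω A v))) ≤
      z⁻¹ ^ h * (β * M.exp (fun ω => #(M.low h ω A) * t ^ M.cnt h ω A) + #A * ξ) := by
  have hpe := M.pe_nonneg
  set f : V → (V → R) × (Sym2 V → Bool) → ℝ := fun u ω =>
    t ^ M.cnt h ω A * indic (u ∈ M.low h ω A) with hf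
  have hf0 : ∀ u ω, 0 ≤ f u ω := fun u ω => mul_nonneg (by positivity) (indic_nonneg _)
  have h1 : ∀ u ∈ A, M.exp (fun ω => f u ω * ((ind (M.adj ω v u) + M.pe) *
      z ^ M.deg ω (A.erase u) v)) ≤ β * M.exp (f u) + ξ := by
    intro u hu
    have := exp_mul_pow_deg_le (M := M) (c := 1) (ξ := ξ) (f := f u) hz0.le hβ zero_le_one hm
      (v := v) (u := u) (B := A.erase u)
      (fun hv => hvA (mem_of_mem_erase hv)) (notMem_erase u A) (ne_of_mem_of_not_mem hu hvA)
      (by rw [one_pow, one_mul]; exact hξ _ _ (notMem_erase u A) (card_erase_add_one hu))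
      (fun ω ω' => by simp only [hf, M.cnt_resample h hvA, M.low_resample h hvA]) (hf0 u)
      (fun ω => mul_le_one₀ (pow_le_one₀ ht.le ht1) (indic_nonneg _) (indic_le_one _))
    rwa [one_mul] at this
  have h2 : M.exp (fun ω => indic (M.deg ω A v = h) *
      (t ^ M.cnt h ω A * indic (M.Pivotal h ω A v))) ≤
      z⁻¹ ^ h * ∑ u ∈ A, M.exp (fun ω => f u ω * ((ind (M.adj ω v u) + M.pe) *
      z ^ M.deg ω (A.erase u) v)) := by
    rw [← exp_sum, ← exp_mul_left]
    refine M.exp_mono fun ω => ?_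
    have hnn : ∀ u, 0 ≤ f u ω * ((ind (M.adj ω v u) + M.pe) * z ^ M.deg ω (A.erase u) v) :=
      fun u => mul_nonneg (hf0 u ω) (mul_nonneg (add_nonneg (ind_nonneg _) hpe) (by positivity))
    by_cases hd : M.deg ω A v = h
    · rw [indic_of_true hd, one_mul]
      have h3 : ∀ u ∈ A, f u ω * ind (M.adj ω v u) ≤
          z⁻¹ ^ h * (f u ω * ((ind (M.adj ω v u) + M.pe) * z ^ M.deg ω (A.erase u) v)) := by
        intro u _
        have h4 : M.deg ω (A.erase u) v ≤ h := hd ▸ deg_mono (erase_subset u A) v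
        have h5 : z ^ h ≤ z ^ M.deg ω (A.erase u) v := pow_le_pow_of_le_one hz0.le hz1 h4
        have h6 : 1 ≤ z⁻¹ ^ h * z ^ M.deg ω (A.erase u) v := by
          calc (1 : ℝ) = z⁻¹ ^ h * z ^ h := by rw [← mul_pow, inv_mul_cancel₀ hz0.ne', one_pow]
            _ ≤ _ := by gcongr
        have h7 : ind (M.adj ω v u) ≤ (ind (M.adj ω v u) + M.pe) *
            (z⁻¹ ^ h * z ^ M.deg ω (A.erase u) v) := by
          have := ind_nonneg (M.adj ω v u)
          nlinarith
        calc _ ≤ f u ω * ((ind (M.adj ω v u) + M.pe) *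
              (z⁻¹ ^ h * z ^ M.deg ω (A.erase u) v)) := mul_le_mul_of_nonneg_left h7 (hf0 u ω)
          _ = _ := by ring
      rw [mul_sum]
      refine le_trans ?_ (sum_le_sum h3)
      have h8 : ∑ u ∈ A, f u ω * ind (M.adj ω v u) =
          t ^ M.cnt h ω A * ∑ u ∈ M.low h ω A, ind (M.adj ω v u) := by
        rw [mul_sum, ← sum_subset (low_subset h ω A)]
        · refine sum_congr rfl fun u hu => ?_
          simp only [hf, indic_of_true hu, mul_one]
        · intro u _ hu
          simp only [hf, indic_of_false hu, mul_zero, zero_mul]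
      rw [h8]
      exact mul_le_mul_of_nonneg_left indic_pivotal_le (by positivity)
    · rw [indic_of_false hd, zero_mul]
      exact mul_nonneg (by positivity) (sum_nonneg fun u _ => hnn u)
  refine h2.trans (mul_le_mul_of_nonneg_left ?_ (by positivity))
  refine (sum_le_sum h1).trans ?_
  rw [sum_add_distrib, ← mul_sum, sum_const, nsmul_eq_mul, ← exp_sum]
  have h9 : ∀ ω, ∑ u ∈ A, f u ω = #(M.low h ω A) * t ^ M.cnt h ω A := by
    intro ω
    simp only [hf]
    rw [← mul_sum, mul_comm]
    congr 1
    rw [← sum_subset (low_subset h ω A)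
      (fun u _ hu => indic_of_false hu), sum_congr rfl (fun u hu => indic_of_true hu)]
    simp
  simp only [h9, le_refl]

theorem abs_exp_cnt_mul_pow_sub_le [Nonempty R] {z β ξ t a b c : ℝ} (hz0 : 0 < z) (hz1 : z ≤ 1)
    (hβ : 0 < β) (hξ0 : 0 ≤ ξ) (ht : 0 < t) (ht1 : t ≤ 1) {m : ℕ} (hm : 1 ≤ m) {h : ℕ} (ha : 0 ≤ a)
    (hb : 0 ≤ b)
    (hlow : ∀ A : Finset V, Fintype.card V ≤ #A + 2 →
      M.exp (fun ω => #(M.low h ω A) * t ^ M.cnt h ω A) ≤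
      a * M.exp (fun ω => t ^ M.cnt h ω A) + b)
    (hpa : M.pe * a ≤ 1 / 2) (hc : Fintype.card V * M.pe ≤ c)
    (hξ : ∀ (B : Finset V) (u : V) (j : ℕ), u ∉ B → j + #B + 2 = Fintype.card V →
      ((1 - (1 - z) * M.pe) ^ j) ^ m * iidExp M.w (fun S : V → R => M.tilt z B u S ^ m) ≤
      ξ * β ^ (m - 1)) :
    |M.exp (fun ω : (V → R) × (Sym2 V → Bool) =>
        M.cnt h ω univ * t ^ (M.cnt h ω univ - 1)) -
      (Fintype.card V * M.binProb h (Fintype.card V - 1) 0) *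
        M.exp (fun ω : (V → R) × (Sym2 V → Bool) => t ^ M.cnt h ω univ)| ≤
      (M.binProb h (Fintype.card V - 1) 0 + t⁻¹ ^ h * z⁻¹ ^ h * β *
          (a + 2 * (t⁻¹ + h + 1 + c) * a)) * (2 * (t⁻¹ + h + 1 + c) *
          (a * M.exp (fun ω : (V → R) × (Sym2 V → Bool) => t ^ M.cnt h ω univ) + b)) +
      Fintype.card V * (t⁻¹ ^ h * z⁻¹ ^ h *
        (β * ((1 + 2 * (t⁻¹ + h + 1 + c)) *
          (a * M.exp (fun ω : (V → R) × (Sym2 V → Bool) => t ^ M.cnt h ω univ) + b)) +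
          2 * (Fintype.card V * ξ))) := by
  set n := Fintype.card V with hn
  set b₀ := M.binProb h (n - 1) 0
  set g := M.exp (fun ω : (V → R) × (Sym2 V → Bool) => t ^ M.cnt h ω univ)
  set D := 2 * (t⁻¹ + h + 1 + c)
  set ζ := t⁻¹ ^ h * z⁻¹ ^ h with hζ
  have hpe := M.pe_nonneg
  have hb0 : 0 ≤ b₀ := binProb_nonneg _ _ _
  have hD0 : 0 ≤ D := by
    have : 0 ≤ c := le_trans (by positivity) hc
    positivity
  have hth : (1 : ℝ) ≤ t⁻¹ ^ h := one_le_pow₀ ((one_le_inv₀ ht).2 ht1)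
  have hvert : ∀ v : V, |M.exp (fun ω : (V → R) × (Sym2 V → Bool) =>
      indic (M.deg ω univ v = h) * t ^ (M.cnt h ω univ - 1)) -
      b₀ * M.exp (fun ω => t ^ M.cnt h ω (univ.erase v))| ≤
      ζ * (β * ((1 + D) * (a * M.exp (fun ω => t ^ M.cnt h ω (univ.erase v)) + b)) +
        2 * (n * ξ)) := by
    intro v
    set A := (univ : Finset V).erase v with hA
    have hvA : v ∉ A := notMem_erase v _
    have hins : insert v A = univ := insert_erase (mem_univ v)
    have hcard : #A + 1 = n := by rw [hA, card_erase_add_one (mem_univ v), card_univ]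
    have hξ' : ∀ (B : Finset V) (u : V) (j : ℕ), u ∉ B → j + #B + 1 = #A →
      ((1 - (1 - z) * M.pe) ^ j) ^ m * iidExp M.w (fun S : V → R => M.tilt z B u S ^ m) ≤
      ξ * β ^ (m - 1) := fun B u j hu hj => hξ B u j hu (by omega)
    have h1 := abs_hybrid_le (h := h) hz0 hz1 hβ ht ht1 hm hvA hξ'
    have h2 := exp_low_adj_le (h := h) (ξ := ξ) hz0 hz1 hβ ht ht1 hm hvA (fun B u hu hB => by
      simpa using hξ' B u 0 hu (by omega))
    have hinfl := infl_le ht ht1 ha hb hlow hpa hc (A := A) (by omega)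
    have h3 : |M.exp (fun ω : (V → R) × (Sym2 V → Bool) =>
        indic (M.deg ω univ v = h) * t ^ (M.cnt h ω univ - 1)) -
        M.exp (fun ω => t ^ M.cnt h ω A * indic (M.deg ω A v = h))| ≤
        t⁻¹ ^ h * M.exp (fun ω => indic (M.deg ω A v = h) *
          (t ^ M.cnt h ω A * indic (M.Pivotal h ω A v))) := by
      rw [← exp_sub, ← exp_mul_left]
      refine (M.abs_exp_le _).trans (M.exp_mono fun ω => ?_)
      rw [← hins, deg_insert_self hvA]
      by_cases hd : M.deg ω A v = h
      · have := abs_pow_cnt_pred_sub_le ht ht1 hvA hd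
        rw [indic_of_true hd, one_mul, one_mul, mul_one]
        linarith
      · rw [indic_of_false hd]
        simp
    have e : b₀ = M.binProb h #A 0 := by
      change M.binProb h (n - 1) 0 = _
      rw [← hcard, Nat.add_sub_cancel]
    rw [e]
    set gA := M.exp (fun ω => t ^ M.cnt h ω A)
    set X := M.exp (fun ω => indic (M.deg ω A v = h) *
          (t ^ M.cnt h ω A * indic (M.Pivotal h ω A v)))
    have hgA : 0 ≤ gA := M.exp_nonneg fun _ => by positivity
    have hzh : (0 : ℝ) < z⁻¹ ^ h := by positivity
    have hAn : (#A : ℝ) * ξ ≤ n * ξ :=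
      mul_le_mul_of_nonneg_right (by exact_mod_cast (by omega : #A ≤ n)) hξ0
    have hAξ : 0 ≤ #A * ξ := by positivity
    have h4 : X ≤ z⁻¹ ^ h * (β * (a * gA + b) + n * ξ) := by
      refine h2.trans (mul_le_mul_of_nonneg_left ?_ hzh.le)
      have := mul_le_mul_of_nonneg_left (hlow A (by omega)) hβ.le
      linarith
    have h5 : z⁻¹ ^ h * (β * M.infl h t A + #A * ξ) ≤
        t⁻¹ ^ h * (z⁻¹ ^ h * (β * (D * (a * gA + b)) + n * ξ)) := by
      have h6 : z⁻¹ ^ h * (β * M.infl h t A + #A * ξ) ≤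
          z⁻¹ ^ h * (β * (D * (a * gA + b)) + n * ξ) := by
        refine mul_le_mul_of_nonneg_left ?_ hzh.le
        have := mul_le_mul_of_nonneg_left hinfl hβ.le
        linarith
      refine h6.trans (le_mul_of_one_le_left (mul_nonneg hzh.le ?_) hth)
      have : 0 ≤ a * gA + b := by positivity
      have : 0 ≤ β * (D * (a * gA + b)) := by positivity
      linarith
    have h6 := mul_le_mul_of_nonneg_left h4 (by positivity : (0 : ℝ) ≤ t⁻¹ ^ h)
    refine (abs_sub_le _ _ _).trans ((add_le_add h3 h1).trans ?_)
    rw [hζ]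
    linarith
  have hsum : M.exp (fun ω : (V → R) × (Sym2 V → Bool) =>
      M.cnt h ω univ * t ^ (M.cnt h ω univ - 1)) =
      ∑ v, M.exp (fun ω : (V → R) × (Sym2 V → Bool) =>
        indic (M.deg ω univ v = h) * t ^ (M.cnt h ω univ - 1)) := by
    rw [← exp_sum]
    refine congrArg _ (funext fun ω => ?_)
    rw [← sum_mul, sum_indic_deg]
  have hI := infl_le ht ht1 ha hb hlow hpa hc (A := univ) (by rw [card_univ]; omega)
  have hE := abs_sum_exp_erase_sub_le (M := M) h t (univ : Finset V)
  rw [card_univ] at hE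
  set G := ∑ v, M.exp (fun ω : (V → R) × (Sym2 V → Bool) => t ^ M.cnt h ω (univ.erase v))
  have hE' := hE.trans hI
  have h1 : |M.exp (fun ω : (V → R) × (Sym2 V → Bool) =>
      M.cnt h ω univ * t ^ (M.cnt h ω univ - 1)) - b₀ * G| ≤
      ζ * (β * ((1 + D) * (a * G + n * b)) + n * (2 * (n * ξ))) := by
    rw [hsum, mul_sum, ← sum_sub_distrib]
    refine (abs_sum_le_sum_abs _ _).trans ((sum_le_sum fun v _ => hvert v).trans (le_of_eq ?_))
    rw [← mul_sum, sum_add_distrib, ← mul_sum, ← mul_sum, sum_add_distrib, ← mul_sum, sum_const,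
      sum_const, card_univ, nsmul_eq_mul, nsmul_eq_mul]
  have h2 : |b₀ * G - n * b₀ * g| ≤ b₀ * (D * (a * g + b)) := by
    have : b₀ * G - n * b₀ * g = b₀ * (G - n * g) := by ring
    rw [this, abs_mul, abs_of_nonneg hb0]
    exact mul_le_mul_of_nonneg_left hE' hb0
  refine (abs_sub_le _ _ _).trans ((add_le_add h1 h2).trans ?_)
  have h3 : G ≤ n * g + D * (a * g + b) := by linarith [(abs_le.1 hE').2]
  have h4 : ζ * (β * ((1 + D) * (a * G))) ≤
      ζ * (β * ((1 + D) * (a * (n * g + D * (a * g + b))))) := by gcongr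
  have h5 : (b₀ + ζ * β * (a + D * a)) * (D * (a * g + b)) +
      n * (ζ * (β * ((1 + D) * (a * g + b)) + 2 * (n * ξ))) =
      ζ * (β * ((1 + D) * (a * (n * g + D * (a * g + b))))) +
      ζ * (β * ((1 + D) * (n * b))) + ζ * (n * (2 * (n * ξ))) + b₀ * (D * (a * g + b)) := by
    ring
  rw [h5]
  linarith

end RingModel

open Topology

lemma abs_mul_exp_sub_one_le {g g' : ℝ → ℝ} {t₀ μ ε b : ℝ} (ht₀ : 0 ≤ t₀) (hμ : 0 ≤ μ)
    (hε : 0 ≤ ε) (hb : 0 ≤ b) (hg : ∀ t, HasDerivAt g (g' t) t) (hg1 : g 1 = 1)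
    (h : ∀ t ∈ Set.Icc t₀ 1, |g' t - μ * g t| ≤ ε * (g t + b)) {t : ℝ}
    (ht : t ∈ Set.Icc t₀ 1) :
    |g t * Real.exp (μ * (1 - t)) - 1| ≤ (1 + b * Real.exp μ) * (Real.exp ε - 1) := by
  set B := b * Real.exp μ
  have hB : 0 ≤ B := by positivity
  set Y : ℝ → ℝ := fun t => g t * Real.exp (μ * (1 - t)) + B with hY
  set Y' : ℝ → ℝ := fun t => (g' t - μ * g t) * Real.exp (μ * (1 - t)) with hY'
  have hd : ∀ t, HasDerivAt Y (Y' t) t := by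
    intro t
    have h1 : HasDerivAt (fun t => Real.exp (μ * (1 - t)))
        (Real.exp (μ * (1 - t)) * (μ * (-1))) t :=
      (((hasDerivAt_id t).const_sub 1).const_mul μ).exp
    exact (((hg t).mul h1).add_const B).congr_deriv (by simp only [hY']; ring)
  have hbd : ∀ t ∈ Set.Icc t₀ 1, |Y' t| ≤ ε * Y t := by
    intro t ht
    simp only [hY, hY', abs_mul, Real.abs_exp]
    have h1 := mul_le_mul_of_nonneg_right (h t ht) (Real.exp_pos (μ * (1 - t))).le
    have h2 : Real.exp (μ * (1 - t)) ≤ Real.exp μ :=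
      Real.exp_le_exp.2 (mul_le_of_le_one_right hμ (by linarith [ht.1]))
    have h3 : ε * (b * Real.exp (μ * (1 - t))) ≤ ε * B :=
      mul_le_mul_of_nonneg_left (mul_le_mul_of_nonneg_left h2 hb) hε
    linarith
  have hY1 : Y 1 = 1 + B := by simp [hY, hg1]
  have hdexp : ∀ σ t : ℝ, HasDerivAt (fun t => Y t * Real.exp (σ * t))
      ((Y' t + σ * Y t) * Real.exp (σ * t)) t := by
    intro σ t
    have h1 : HasDerivAt (fun t => Real.exp (σ * t)) (Real.exp (σ * t) * (σ * 1)) t :=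
      ((hasDerivAt_id t).const_mul σ).exp
    exact ((hd t).mul h1).congr_deriv (by ring)
  have hmem1 : (1 : ℝ) ∈ Set.Icc t₀ 1 := ⟨ht.1.trans ht.2, le_rfl⟩
  have hup : Y t * Real.exp (ε * t) ≤ Y 1 * Real.exp (ε * 1) := by
    refine monotoneOn_of_deriv_nonneg (convex_Icc t₀ 1)
      (fun x _ => (hdexp ε x).continuousAt.continuousWithinAt)
      (fun x _ => (hdexp ε x).differentiableAt.differentiableWithinAt) (fun x hx => ?_) ht hmem1
      ht.2
    rw [(hdexp ε x).deriv]
    have := (abs_le.1 (hbd x (interior_subset hx))).1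
    exact mul_nonneg (by linarith) (Real.exp_pos _).le
  have hdown : Y 1 * Real.exp (-ε * 1) ≤ Y t * Real.exp (-ε * t) := by
    refine antitoneOn_of_deriv_nonpos (convex_Icc t₀ 1)
      (fun x _ => (hdexp (-ε) x).continuousAt.continuousWithinAt)
      (fun x _ => (hdexp (-ε) x).differentiableAt.differentiableWithinAt) (fun x hx => ?_) ht hmem1
      ht.2
    rw [(hdexp (-ε) x).deriv]
    have := (abs_le.1 (hbd x (interior_subset hx))).2
    exact mul_nonpos_of_nonpos_of_nonneg (by linarith) (Real.exp_pos _).le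
  have ht0 : 0 ≤ t := ht₀.trans ht.1
  have hYup : Y t ≤ (1 + B) * Real.exp ε := by
    have h1 : Y t = Y t * Real.exp (ε * t) * Real.exp (-(ε * t)) := by
      rw [mul_assoc, ← Real.exp_add, add_neg_cancel, Real.exp_zero, mul_one]
    rw [h1]
    calc _ ≤ Y 1 * Real.exp (ε * 1) * 1 := by
          refine mul_le_mul hup ?_ (Real.exp_pos _).le (by rw [hY1]; positivity)
          exact Real.exp_le_one_iff.2 (by nlinarith)
      _ = _ := by rw [hY1, mul_one, mul_one]
  have hYdown : (1 + B) * Real.exp (-ε) ≤ Y t := by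
    have h1 : Y t = Y t * Real.exp (-ε * t) * Real.exp (ε * t) := by
      rw [mul_assoc, ← Real.exp_add, neg_mul, neg_add_cancel, Real.exp_zero, mul_one]
    rw [h1]
    calc (1 + B) * Real.exp (-ε) = Y 1 * Real.exp (-ε * 1) * 1 := by rw [hY1, mul_one, mul_one]
      _ ≤ _ := by
          refine mul_le_mul hdown (Real.one_le_exp (by positivity)) zero_le_one ?_
          exact le_trans (by rw [hY1]; positivity) hdown
  have hYt : Y t = g t * Real.exp (μ * (1 - t)) + B := rfl
  have hee : 1 - Real.exp (-ε) ≤ Real.exp ε - 1 := by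
    have h1 := Real.add_one_le_exp ε
    have h2 := Real.add_one_le_exp (-ε)
    linarith
  have h5 : (1 + B) * (1 - Real.exp (-ε)) ≤ (1 + B) * (Real.exp ε - 1) := by gcongr
  rw [abs_le]
  constructor <;> nlinarith

lemma abs_coeff_mul_pow_le {d : ℕ → ℝ} {s τ C F : ℝ} (hs : 0 < s) (hτ : 0 < τ) (hτs : 2 * τ ≤ s)
    (hd : ∀ k, |d k| ≤ C * s⁻¹ ^ k) (hF : HasSum (fun k => d k * τ ^ k) F) (ℓ : ℕ) :
    |d ℓ| * τ ^ ℓ ≤ |F| + ∑ k ∈ range ℓ, |d k| * τ ^ k + 2 * C * (τ / s) ^ (ℓ + 1) := by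
  have hC : 0 ≤ C := by simpa using (abs_nonneg _).trans (hd 0)
  have hr : τ / s ≤ 1 / 2 := by rw [div_le_div_iff₀ hs two_pos]; linarith
  have hr0 : 0 ≤ τ / s := by positivity
  have h1 := hF.summable.sum_add_tsum_nat_add (ℓ + 1)
  rw [hF.tsum_eq, sum_range_succ] at h1
  have hgeo : HasSum (fun k => C * (τ / s) ^ (ℓ + 1) * (τ / s) ^ k)
      (C * (τ / s) ^ (ℓ + 1) * (1 - τ / s)⁻¹) :=
    (hasSum_geometric_of_lt_one hr0 (by linarith)).mul_left _
  have h2 : |∑' k, d (k + (ℓ + 1)) * τ ^ (k + (ℓ + 1))| ≤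
      C * (τ / s) ^ (ℓ + 1) * (1 - τ / s)⁻¹ := by
    rw [← Real.norm_eq_abs]
    refine tsum_of_norm_bounded hgeo fun k => ?_
    rw [Real.norm_eq_abs, abs_mul, abs_of_pos (by positivity : 0 < τ ^ (k + (ℓ + 1)))]
    refine (mul_le_mul_of_nonneg_right (hd _) (by positivity)).trans (le_of_eq ?_)
    rw [div_eq_mul_inv]
    ring
  have h3 : (1 - τ / s)⁻¹ ≤ 2 := by
    rw [inv_le_comm₀ (by linarith) two_pos]
    linarith
  have h4 : C * (τ / s) ^ (ℓ + 1) * (1 - τ / s)⁻¹ ≤ C * (τ / s) ^ (ℓ + 1) * 2 := by gcongr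
  have h5 : |∑ k ∈ range ℓ, d k * τ ^ k| ≤ ∑ k ∈ range ℓ, |d k| * τ ^ k := by
    refine (abs_sum_le_sum_abs _ _).trans (le_of_eq (sum_congr rfl fun k _ => ?_))
    rw [abs_mul, abs_of_pos (by positivity : 0 < τ ^ k)]
  have h6 : |d ℓ| * τ ^ ℓ = |d ℓ * τ ^ ℓ| := by
    rw [abs_mul, abs_of_pos (by positivity : 0 < τ ^ ℓ)]
  have h7 : d ℓ * τ ^ ℓ = F - ∑ k ∈ range ℓ, d k * τ ^ k -
      ∑' k, d (k + (ℓ + 1)) * τ ^ (k + (ℓ + 1)) := by linarith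
  rw [h6, h7]
  have h8 := abs_sub (F - ∑ k ∈ range ℓ, d k * τ ^ k)
    (∑' k, d (k + (ℓ + 1)) * τ ^ (k + (ℓ + 1)))
  have h9 := abs_sub F (∑ k ∈ range ℓ, d k * τ ^ k)
  linarith

section Extraction

variable {a : ℕ → ℕ → ℝ} {μ x : ℕ → ℝ} {g : ℕ → ℝ → ℝ} {c : ℕ}

lemma eventually_abs_coeff_sub_le (hx : Tendsto x atTop (𝓝 0)) (hx0 : ∀ᶠ n in atTop, 0 < x n)
    (ha : ∀ n k, 0 ≤ a n k) (hg : ∀ n t, HasSum (fun k => a n k * t ^ k) (g n t))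
    (hμ0 : ∀ᶠ n in atTop, 0 ≤ μ n) (hμ : ∀ᶠ n in atTop, μ n * x n ^ c ≤ 1)
    (hclose : ∀ A r : ℕ, ∀ᶠ n in atTop, ∀ t ∈ Set.Icc (x n ^ A) 1,
      |g n t * Real.exp (μ n) - Real.exp (μ n * t)| ≤ x n ^ r * Real.exp (μ n * t)) (ℓ : ℕ) :
    ∀ r : ℕ, ∀ᶠ n in atTop, |a n ℓ * Real.exp (μ n) - μ n ^ ℓ / ℓ.factorial| ≤ x n ^ r := by
  induction ℓ using Nat.strong_induction_on with
  | _ ℓ ih =>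
  intro r
  set B := c * (ℓ + 1) + r + 2 with hB
  have hsmall : ∀ᶠ n in atTop, x n < 1 / 100 ∧ ℓ * x n < 1 / 100 := by
    have h1 : Tendsto (fun n => (ℓ : ℝ) * x n) atTop (𝓝 0) := by simpa using hx.const_mul (ℓ : ℝ)
    exact (hx.eventually_lt_const (by norm_num)).and (h1.eventually_lt_const (by norm_num))
  have hprev : ∀ᶠ n in atTop, ∀ k ∈ Set.Iio ℓ,
      |a n k * Real.exp (μ n) - μ n ^ k / k.factorial| ≤ x n ^ (B * ℓ + r + 1) :=
    (Set.finite_Iio ℓ).eventually_all.2 fun k hk => ih k hk _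
  filter_upwards [hx0, hμ0, hμ, hsmall, hprev, hclose c 0, hclose B (B * ℓ + r + 2)] with n hx0 hμ0
    hμ hsmall hprev hcl0 hcl1
  set y := x n
  have hy1 : y ≤ 1 := by linarith [hsmall.1]
  have hB2 : B = (c * ℓ + r + 1) + c + 1 := by rw [hB]; ring
  have hBc : y ^ B ≤ y ^ c * y := by
    rw [← pow_succ]
    exact pow_le_pow_of_le_one hx0.le hy1 (by omega)
  have hs : 0 < y ^ c := by positivity
  have hs1 : y ^ c ≤ 1 := pow_le_one₀ hx0.le hy1
  have hτ1 : y ^ B ≤ 1 := pow_le_one₀ hx0.le hy1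
  have hexp3 : Real.exp 1 ≤ 3 := by linarith [Real.exp_one_lt_d9]
  set d : ℕ → ℝ := fun k => a n k * Real.exp (μ n) - μ n ^ k / k.factorial with hd
  have hexps : Real.exp (μ n * y ^ c) ≤ 3 := (Real.exp_le_exp.2 hμ).trans hexp3
  have hdb : ∀ k, |d k| ≤ 9 * (y ^ c)⁻¹ ^ k := by
    intro k
    have h1 : g n (y ^ c) * Real.exp (μ n) ≤ 6 := by
      have := (abs_le.1 (hcl0 _ ⟨le_rfl, hs1⟩)).2
      rw [pow_zero, one_mul] at this
      linarith
    have h2 : a n k * (y ^ c) ^ k ≤ g n (y ^ c) :=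
      le_hasSum (hg n (y ^ c)) k fun j _ => mul_nonneg (ha n j) (by positivity)
    have h3 : μ n ^ k / k.factorial * (y ^ c) ^ k ≤ 3 := by
      have := Real.pow_div_factorial_le_exp (x := μ n * y ^ c) (by positivity) k
      rw [mul_pow] at this
      refine le_trans (le_of_eq (by ring)) (this.trans hexps)
    have h4 : a n k * Real.exp (μ n) * (y ^ c) ^ k ≤ 6 := by
      have := mul_le_mul_of_nonneg_right h2 (Real.exp_pos (μ n)).le
      linarith
    have h5 : 0 ≤ a n k * Real.exp (μ n) := mul_nonneg (ha n k) (Real.exp_pos _).le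
    have h6 : 0 ≤ μ n ^ k / k.factorial := by positivity
    have h7 : |d k| ≤ a n k * Real.exp (μ n) + μ n ^ k / k.factorial := by
      rw [abs_le]
      constructor <;> simp only [hd] <;> linarith
    rw [inv_pow, ← div_eq_mul_inv, le_div_iff₀ (by positivity)]
    calc _ ≤ (a n k * Real.exp (μ n) + μ n ^ k / k.factorial) * (y ^ c) ^ k := by gcongr
      _ ≤ 9 := by linarith
  have hsumF : HasSum (fun k => d k * (y ^ B) ^ k)
      (g n (y ^ B) * Real.exp (μ n) - Real.exp (μ n * y ^ B)) := by
    have h1 := (hg n (y ^ B)).mul_right (Real.exp (μ n))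
    have h2 : HasSum (fun k : ℕ => (μ n * y ^ B) ^ k / k.factorial) (Real.exp (μ n * y ^ B)) := by
      have := NormedSpace.expSeries_div_hasSum_exp (μ n * y ^ B)
      rwa [← Real.exp_eq_exp_ℝ] at this
    refine (h1.sub h2).congr_fun fun k => ?_
    simp only [hd]
    rw [mul_pow]
    ring
  have hkey := abs_coeff_mul_pow_le hs (by positivity : 0 < y ^ B) (by nlinarith) hdb hsumF ℓ
  have hF : |g n (y ^ B) * Real.exp (μ n) - Real.exp (μ n * y ^ B)| ≤
      (y ^ B) ^ ℓ * (y ^ r * (3 * y)) := by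
    have h1 : Real.exp (μ n * y ^ B) ≤ 3 := by
      refine le_trans (Real.exp_le_exp.2 ?_) hexps
      have : y ^ B ≤ y ^ c := hBc.trans (mul_le_of_le_one_right hs.le hy1)
      gcongr
    have h2 : y ^ (B * ℓ + r + 2) = (y ^ B) ^ ℓ * (y ^ r * y) * y := by
      rw [← pow_mul]; ring
    refine (hcl1 _ ⟨le_rfl, hτ1⟩).trans ?_
    rw [h2]
    calc _ ≤ (y ^ B) ^ ℓ * (y ^ r * y) * 1 * 3 := by gcongr
      _ = _ := by ring
  have hsum : ∑ k ∈ range ℓ, |d k| * (y ^ B) ^ k ≤ (y ^ B) ^ ℓ * (y ^ r * (ℓ * y)) := by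
    have h2 : y ^ (B * ℓ + r + 1) = (y ^ B) ^ ℓ * (y ^ r * y) := by
      rw [← pow_mul]; ring
    calc _ ≤ ∑ k ∈ range ℓ, (y ^ B) ^ ℓ * (y ^ r * y) := sum_le_sum fun k hk => by
          have h1 := hprev k (mem_range.1 hk)
          rw [h2] at h1
          exact (mul_le_of_le_one_right (abs_nonneg _) (pow_le_one₀ (by positivity) hτ1)).trans h1
      _ = _ := by rw [sum_const, card_range, nsmul_eq_mul]; ring
  have htail : 2 * 9 * (y ^ B / y ^ c) ^ (ℓ + 1) ≤ (y ^ B) ^ ℓ * (y ^ r * (18 * y)) := by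
    have h1 : (y ^ B / y ^ c) ^ (ℓ + 1) = (y ^ B) ^ ℓ * (y ^ B / (y ^ c) ^ (ℓ + 1)) := by
      rw [div_pow]; ring
    have h3 : y ^ B / (y ^ c) ^ (ℓ + 1) = y ^ r * y * y := by
      rw [← pow_mul, hB, div_eq_iff (by positivity)]; ring
    rw [h1, h3]
    calc _ = (y ^ B) ^ ℓ * (y ^ r * (18 * y)) * y := by ring
      _ ≤ _ := mul_le_of_le_one_right (by positivity) hy1
  have hfin : |d ℓ| * (y ^ B) ^ ℓ ≤ y ^ r * (y ^ B) ^ ℓ := by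
    have h1 : 3 * y + ℓ * y + 18 * y ≤ 1 := by linarith [hsmall.1, hsmall.2]
    have h2 : (y ^ B) ^ ℓ * (y ^ r * (3 * y + ℓ * y + 18 * y)) ≤ (y ^ B) ^ ℓ * (y ^ r * 1) := by
      gcongr
    linarith
  exact le_of_mul_le_mul_right hfin (by positivity)

lemma tendsto_coeff_div (hx : Tendsto x atTop (𝓝 0)) (hx0 : ∀ᶠ n in atTop, 0 < x n)
    (ha : ∀ n k, 0 ≤ a n k) (hg : ∀ n t, HasSum (fun k => a n k * t ^ k) (g n t))
    (hμ0 : ∀ᶠ n in atTop, x n ^ c ≤ μ n) (hμ : ∀ᶠ n in atTop, μ n * x n ^ c ≤ 1)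
    (hclose : ∀ A r : ℕ, ∀ᶠ n in atTop, ∀ t ∈ Set.Icc (x n ^ A) 1,
      |g n t * Real.exp (μ n) - Real.exp (μ n * t)| ≤ x n ^ r * Real.exp (μ n * t)) (ℓ : ℕ) :
    Tendsto (fun n => a n ℓ / ((ℓ.factorial : ℝ)⁻¹ * μ n ^ ℓ * Real.exp (-μ n))) atTop (𝓝 1) := by
  have hμ1 : ∀ᶠ n in atTop, 0 ≤ μ n := by
    filter_upwards [hμ0, hx0] with n h1 h2
    exact le_trans (by positivity) h1
  have h1 := eventually_abs_coeff_sub_le hx hx0 ha hg hμ1 hμ hclose ℓ (c * ℓ + 1)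
  rw [tendsto_iff_norm_sub_tendsto_zero]
  have hz : Tendsto (fun n => (ℓ.factorial : ℝ) * x n) atTop (𝓝 0) := by
    simpa using hx.const_mul (ℓ.factorial : ℝ)
  refine squeeze_zero' (Eventually.of_forall fun _ => norm_nonneg _) ?_ hz
  filter_upwards [h1, hμ0, hx0] with n h1 h2 h3
  have hμp : 0 < μ n := lt_of_lt_of_le (by positivity) h2
  have h4 : a n ℓ / ((ℓ.factorial : ℝ)⁻¹ * μ n ^ ℓ * Real.exp (-μ n)) - 1 =
      (a n ℓ * Real.exp (μ n) - μ n ^ ℓ / ℓ.factorial) * (ℓ.factorial / μ n ^ ℓ) := by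
    rw [Real.exp_neg]
    have := Real.exp_pos (μ n)
    field_simp
  rw [h4, Real.norm_eq_abs, abs_mul, abs_of_pos (by positivity : 0 < (ℓ.factorial : ℝ) / μ n ^ ℓ)]
  have h5 : x n ^ (c * ℓ) ≤ μ n ^ ℓ := by
    rw [pow_mul]
    exact pow_le_pow_left₀ (by positivity) h2 _
  calc _ ≤ x n ^ (c * ℓ + 1) * (ℓ.factorial / μ n ^ ℓ) := by gcongr
    _ = ℓ.factorial * x n * (x n ^ (c * ℓ) / μ n ^ ℓ) := by ring
    _ ≤ ℓ.factorial * x n * 1 := by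
        gcongr
        exact (div_le_one (by positivity)).2 h5
    _ = _ := mul_one _

end Extraction

/-- The key rings. -/
abbrev KeyRing (P K : ℕ) : Type := {S : Finset (Fin P) // #S = K}

/-- The uniform weight on the key rings. -/
noncomputable def keyWeight (P K : ℕ) (_ : KeyRing P K) : ℝ := (P.choose K : ℝ)⁻¹

section KeyRing

variable {q K P : ℕ}

lemma sum_keyWeight_mul (f : Finset (Fin P) → ℝ) :
    ∑ S : KeyRing P K, keyWeight P K S * f S =
      (P.choose K : ℝ)⁻¹ * ∑ S ∈ powersetCard K univ, f S := by
  rw [mul_sum, sum_subtype (powersetCard K univ) (p := fun S => #S = K) (by simp)]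
  rfl

lemma isProbWeight_keyWeight (hKP : K ≤ P) : IsProbWeight (keyWeight P K) := by
  refine ⟨fun _ => by unfold keyWeight; positivity, ?_⟩
  have h := sum_keyWeight_mul (P := P) (K := K) fun _ => 1
  have h0 : (P.choose K : ℝ) ≠ 0 := by exact_mod_cast (Nat.choose_pos hKP).ne'
  simpa [h0] using h

lemma nonempty_keyRing (hKP : K ≤ P) : Nonempty (KeyRing P K) := by
  obtain ⟨S, hS⟩ := powersetCard_nonempty.2 (show K ≤ #(univ : Finset (Fin P)) by simpa using hKP)
  exact ⟨⟨S, (mem_powersetCard.1 hS).2⟩⟩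

lemma sum_choose_card_inter (U : Finset (Fin P)) {j : ℕ} (hj : j ≤ K) :
    ∑ S ∈ powersetCard K univ, (#(S ∩ U)).choose j = (#U).choose j * (P - j).choose (K - j) := by
  have h1 : ∀ S : Finset (Fin P), (#(S ∩ U)).choose j =
      #((powersetCard j U).bipartiteAbove (fun S J => J ⊆ S) S) := by
    intro S
    rw [← card_powersetCard]
    congr 1
    ext J
    simp only [mem_powersetCard, bipartiteAbove, mem_filter, subset_inter_iff]
    tauto
  rw [sum_congr rfl fun S _ => h1 S, sum_card_bipartiteAbove_eq_sum_card_bipartiteBelow,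
    sum_congr rfl (g := fun _ => (P - j).choose (K - j)), sum_const, card_powersetCard,
    smul_eq_mul]
  intro J hJ
  have hJj := (mem_powersetCard.1 hJ).2
  have := card_filter_powersetCard_subset J univ K (subset_univ _) (hJj.trans_le hj)
  rw [hJj, card_univ, Fintype.card_fin] at this
  rw [← this]
  rfl

lemma sum_keyWeight_choose (hKP : K ≤ P) (U : Finset (Fin P)) (j : ℕ) :
    ∑ S : KeyRing P K, keyWeight P K S * ((#(S.1 ∩ U)).choose j : ℝ) =
      (#U).choose j * (K.choose j / P.choose j) := by
  rcases le_or_gt j K with hj | hj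
  · rw [sum_keyWeight_mul fun S => ((#(S ∩ U)).choose j : ℝ)]
    have h1 : ∑ S ∈ powersetCard K univ, ((#(S ∩ U)).choose j : ℝ) =
        (#U).choose j * (P - j).choose (K - j) := by exact_mod_cast sum_choose_card_inter U hj
    have h2 : (P.choose K : ℝ) * K.choose j = P.choose j * (P - j).choose (K - j) := by
      exact_mod_cast Nat.choose_mul (n := P) hj
    have h3 : (P.choose K : ℝ) ≠ 0 := by exact_mod_cast (Nat.choose_pos hKP).ne'
    have h4 : (P.choose j : ℝ) ≠ 0 := by exact_mod_cast (Nat.choose_pos (hj.trans hKP)).ne'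
    rw [h1]
    field_simp
    linear_combination -((#U).choose j : ℝ) * h2
  · rw [Nat.choose_eq_zero_of_lt hj, Nat.cast_zero, zero_div, mul_zero]
    refine sum_eq_zero fun S _ => ?_
    have : #(S.1 ∩ U) < j := ((card_le_card inter_subset_left).trans S.2.le).trans_lt hj
    rw [Nat.choose_eq_zero_of_lt this, Nat.cast_zero, mul_zero]

lemma choose_div_choose_le (hKP : K ≤ P) (j : ℕ) :
    (K.choose j : ℝ) / P.choose j ≤ ((K : ℝ) / P) ^ j := by
  rcases le_or_gt j P with hj | hj
  · have h1 : ∀ i, K.descFactorial i * P ^ i ≤ K ^ i * P.descFactorial i := by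
      intro i
      induction i with
      | zero => simp
      | succ i ih =>
        rw [Nat.descFactorial_succ, Nat.descFactorial_succ, pow_succ, pow_succ]
        have h2 : (K - i) * P ≤ K * (P - i) := by
          rw [Nat.sub_mul, Nat.mul_sub]
          exact Nat.sub_le_sub_left (by rw [mul_comm]; gcongr) _
        calc _ = (K - i) * P * (K.descFactorial i * P ^ i) := by ring
          _ ≤ K * (P - i) * (K ^ i * P.descFactorial i) := Nat.mul_le_mul h2 ih
          _ = _ := by ring
    have h2 := h1 j
    rw [Nat.descFactorial_eq_factorial_mul_choose, Nat.descFactorial_eq_factorial_mul_choose] at h2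
    have h3 : K.choose j * P ^ j ≤ K ^ j * P.choose j := by
      refine Nat.le_of_mul_le_mul_left ?_ (Nat.factorial_pos j)
      calc _ = j.factorial * K.choose j * P ^ j := by ring
        _ ≤ _ := h2
        _ = _ := by ring
    have h4 : (0 : ℝ) < P.choose j := by exact_mod_cast Nat.choose_pos hj
    rcases Nat.eq_zero_or_pos P with rfl | hP
    · obtain rfl : j = 0 := by omega
      simp
    · rw [div_pow, div_le_div_iff₀ h4 (by positivity)]
      exact_mod_cast h3
  · rw [Nat.choose_eq_zero_of_lt hj, Nat.cast_zero, div_zero]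
    positivity

lemma sum_keyWeight_choose_le (hKP : K ≤ P) (U : Finset (Fin P)) (j : ℕ) {N : ℝ} (hN : #U ≤ N) :
    ∑ S : KeyRing P K, keyWeight P K S * ((#(S.1 ∩ U)).choose j : ℝ) ≤ (N * (K / P)) ^ j := by
  rw [sum_keyWeight_choose hKP, mul_pow]
  have h1 : ((#U).choose j : ℝ) ≤ N ^ j :=
    (by exact_mod_cast Nat.choose_le_pow _ _ : ((#U).choose j : ℝ) ≤ (#U : ℝ) ^ j).trans
      (pow_le_pow_left₀ (by positivity) hN _)
  exact mul_le_mul h1 (choose_div_choose_le hKP j) (by positivity)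
    (pow_nonneg ((Nat.cast_nonneg _).trans hN) _)

lemma card_filter_card_inter (T : Finset (Fin P)) {u : ℕ} (hu : u ≤ K) :
    #{S ∈ powersetCard K (univ : Finset (Fin P)) | #(S ∩ T) = u} =
      (#T).choose u * (P - #T).choose (K - u) := by
  have h1 : (#T).choose u * (P - #T).choose (K - u) =
      #(powersetCard u T ×ˢ powersetCard (K - u) Tᶜ) := by
    rw [card_product, card_powersetCard, card_powersetCard, card_compl, Fintype.card_fin]
  rw [h1]
  refine card_nbij' (fun S => (S ∩ T, S \ T)) (fun A => A.1 ∪ A.2) ?_ ?_ ?_ ?_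
  · intro S hS
    simp only [coe_filter, mem_powersetCard, subset_univ, true_and, Set.mem_ofPred_eq] at hS
    simp only [coe_product, Set.mem_prod, mem_coe, mem_powersetCard]
    refine ⟨⟨inter_subset_right, hS.2⟩, fun x hx => by simp_all, ?_⟩
    have := card_sdiff_add_card_inter S T
    omega
  · rintro ⟨A, B⟩ hAB
    simp only [coe_product, Set.mem_prod, mem_coe, mem_powersetCard] at hAB
    obtain ⟨⟨hA, hAu⟩, hB, hBu⟩ := hAB
    have hd : Disjoint T B := (disjoint_compl_right (a := T)).mono_right hB
    simp only [coe_filter, mem_powersetCard, subset_univ, true_and, Set.mem_ofPred_eq]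
    rw [card_union_of_disjoint (hd.mono_left hA), union_inter_distrib_right,
      inter_eq_left.2 hA, disjoint_iff_inter_eq_empty.1 hd.symm, union_empty]
    omega
  · intro S _
    exact (union_comm _ _).trans (sdiff_union_inter S T)
  · rintro ⟨A, B⟩ hAB
    simp only [coe_product, Set.mem_prod, mem_coe, mem_powersetCard] at hAB
    obtain ⟨⟨hA, hAu⟩, hB, hBu⟩ := hAB
    have hd : Disjoint T B := (disjoint_compl_right (a := T)).mono_right hB
    ext x
    · simp only [mem_inter, mem_union]
      constructor
      · rintro ⟨h | h, hx⟩
        · exact h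
        · exact absurd h (disjoint_left.1 hd hx)
      · exact fun h => ⟨Or.inl h, hA h⟩
    · simp only [Finset.mem_sdiff, mem_union]
      constructor
      · rintro ⟨h | h, hx⟩
        · exact absurd (hA h) hx
        · exact h
      · exact fun h => ⟨Or.inr h, fun hx => disjoint_left.1 hd hx h⟩

lemma sum_keyWeight_le_card_inter (hKP : K ≤ P) (T : Finset (Fin P)) (hT : #T = K) :
    ∑ S : KeyRing P K, keyWeight P K S * ind (decide (q ≤ #(S.1 ∩ T))) = psq q K P := by
  have h1 : ∀ S : KeyRing P K, ind (decide (q ≤ #(S.1 ∩ T))) =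
      1 - ∑ u ∈ range q, if #(S.1 ∩ T) = u then (1 : ℝ) else 0 := by
    intro S
    rw [sum_ite_eq]
    simp only [mem_range, ind, decide_eq_true_eq]
    split_ifs <;> first | omega | simp
  simp only [h1, mul_sub, mul_one, sum_sub_distrib, (isProbWeight_keyWeight hKP).2, psq]
  congr 1
  simp only [mul_sum]
  rw [sum_comm]
  refine sum_congr rfl fun u _ => ?_
  rw [sum_keyWeight_mul fun S => if #(S ∩ T) = u then (1 : ℝ) else 0, sum_boole]
  rcases le_or_gt u K with hu | hu
  · rw [card_filter_card_inter T hu, hT, Nat.cast_mul, div_eq_inv_mul]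
  · rw [Nat.choose_eq_zero_of_lt hu, filter_eq_empty_iff.2]
    · simp
    · intro S hS h
      have h2 := card_le_card (inter_subset_left (s₁ := S) (s₂ := T))
      rw [h, (mem_powersetCard.1 hS).2] at h2
      omega

/-- The random graph with key rings of size `K` out of a pool of size `P`. -/
noncomputable def keyModel (q : ℕ) (hKP : K ≤ P) {p : ℝ} (hp : p ∈ Set.Ioc (0 : ℝ) 1) :
    RingModel (KeyRing P K) where
  w := keyWeight P K
  isProbWeight := isProbWeight_keyWeight hKP
  I S T := decide (q ≤ #(S.1 ∩ T.1))
  I_comm S T := by rw [inter_comm]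
  p := p
  p_nonneg := hp.1.le
  p_le_one := hp.2
  ps := psq q K P
  sum_I T := sum_keyWeight_le_card_inter hKP T.1 T.2

end KeyRing

lemma prod_one_sub_le {ι : Type*} [LinearOrder ι] (s : Finset ι) {x : ι → ℝ}
    (h0 : ∀ i ∈ s, 0 ≤ x i) (h1 : ∀ i ∈ s, x i ≤ 1) :
    ∏ i ∈ s, (1 - x i) ≤ 1 - ∑ i ∈ s, x i + ∑ i ∈ s, x i * ∑ j ∈ s with j < i, x j := by
  rw [prod_one_sub_ordered, sub_add, ← sum_sub_distrib]
  refine sub_le_sub_left (sum_le_sum fun i hi => ?_) 1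
  have h2 : 1 - ∑ j ∈ s with j < i, x j ≤ ∏ j ∈ s with j < i, (1 - x j) := by
    have hmem : ∀ j ∈ s.filter (· < i), j ∈ s := fun j hj => (mem_filter.1 hj).1
    generalize s.filter (· < i) = t at hmem
    induction t using Finset.induction_on with
    | empty => simp
    | insert a t ha ih =>
      have ih := ih fun j hj => hmem j (mem_insert_of_mem hj)
      have h3 : ∏ j ∈ t, (1 - x j) ≤ 1 := prod_le_one
        (fun j hj => sub_nonneg.2 (h1 j (hmem j (mem_insert_of_mem hj))))
        fun j hj => sub_le_self _ (h0 j (hmem j (mem_insert_of_mem hj)))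
      have ha0 := h0 a (hmem a (mem_insert_self _ _))
      rw [sum_insert ha, prod_insert ha]
      nlinarith
  nlinarith [mul_le_mul_of_nonneg_left h2 (h0 i hi)]

namespace RingModel

variable {R : Type*} [Fintype R] (M : RingModel R)

lemma joint_le_of_mul_le {z η : ℝ} (hz0 : 0 ≤ z) (hz1 : z ≤ 1) {m : ℕ}
    (h : m * ((1 - z) * M.p) ≤ η) (T : Fin m → R) :
    M.joint z T ≤ 1 - (1 - η) * (m * ((1 - z) * M.pe)) := by
  have hp0 : 0 ≤ (1 - z) * M.p := mul_nonneg (by linarith) M.p_nonneg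
  have hp1 : (1 - z) * M.p ≤ 1 := mul_le_one₀ (by linarith) M.p_nonneg M.p_le_one
  have h1 : ∀ s, ∏ i, (1 - (1 - z) * M.p * ind (M.I (T i) s)) ≤
      1 - (1 - η) * ∑ i, (1 - z) * M.p * ind (M.I (T i) s) := by
    intro s
    have hx0 : ∀ i, 0 ≤ (1 - z) * M.p * ind (M.I (T i) s) := fun i =>
      mul_nonneg hp0 (ind_nonneg _)
    have hx1 : ∀ i, (1 - z) * M.p * ind (M.I (T i) s) ≤ (1 - z) * M.p := fun i =>
      mul_le_of_le_one_right hp0 (ind_le_one _)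
    refine (prod_one_sub_le univ (fun i _ => hx0 i) fun i _ => (hx1 i).trans hp1).trans ?_
    have h2 : ∀ i, ∑ j with j < i, (1 - z) * M.p * ind (M.I (T j) s) ≤ η := by
      intro i
      refine le_trans ?_ h
      refine (sum_le_card_nsmul _ _ _ fun j _ => hx1 j).trans ?_
      rw [nsmul_eq_mul]
      refine mul_le_mul_of_nonneg_right ?_ hp0
      exact_mod_cast (card_le_univ _).trans (Fintype.card_fin m).le
    have h3 := sum_le_sum fun i (_ : i ∈ univ) => mul_le_mul_of_nonneg_left (h2 i) (hx0 i)
    rw [← sum_mul] at h3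
    linarith
  have h4 : ∀ i, ∑ s, M.w s * ((1 - z) * M.p * ind (M.I (T i) s)) = (1 - z) * M.pe := by
    intro i
    rw [pe, ← M.sum_I (T i), mul_sum, mul_sum]
    exact sum_congr rfl fun s _ => by rw [M.I_comm]; ring
  calc M.joint z T ≤ ∑ s, M.w s * (1 - (1 - η) * ∑ i, (1 - z) * M.p * ind (M.I (T i) s)) :=
        sum_le_sum fun s _ => mul_le_mul_of_nonneg_left (h1 s) (M.isProbWeight.1 s)
    _ = ∑ s, M.w s - (1 - η) * ∑ i, ∑ s, M.w s * ((1 - z) * M.p * ind (M.I (T i) s)) := by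
        rw [sum_comm, mul_sum, ← sum_sub_distrib]
        refine sum_congr rfl fun s _ => ?_
        rw [mul_sub, mul_one, mul_left_comm, mul_sum univ _ (M.w s)]
    _ = _ := by
        simp only [h4, M.isProbWeight.2]
        simp

end RingModel

section KeyRing

variable {q K P : ℕ}

lemma ind_le_choose (x : ℕ) : ind (decide (q ≤ x)) ≤ x.choose q := by
  by_cases h : q ≤ x
  · have : 1 ≤ x.choose q := Nat.choose_pos h
    simpa [h] using this
  · simp [h]

lemma choose_sub_le_ind (x : ℕ) :
    (x.choose q : ℝ) - (q + 1) * x.choose (q + 1) ≤ ind (decide (q ≤ x)) := by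
  rcases lt_trichotomy x q with h | rfl | h
  · simp [Nat.choose_eq_zero_of_lt h, Nat.choose_eq_zero_of_lt (h.trans (Nat.lt_succ_self q)),
      ind_nonneg]
  · simp
  · have h1 : x.choose (q + 1) * (q + 1) = x.choose q * (x - q) := Nat.choose_succ_right_eq x q
    have h2 : x.choose q ≤ x.choose (q + 1) * (q + 1) := by
      rw [h1]
      exact Nat.le_mul_of_pos_right _ (by omega)
    have h3 : (x.choose q : ℝ) ≤ x.choose (q + 1) * (q + 1) := by exact_mod_cast h2
    have := ind_nonneg (decide (q ≤ x))
    linarith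

lemma le_sum_keyWeight_ind (hKP : K ≤ P) (hqK : q + 1 ≤ K) {r : ℕ} {η : ℝ}
    (hr : (1 - η + K ^ 2 / P) * K.choose q ≤ (K - r).choose q) {U : Finset (Fin P)}
    (hU : #U ≤ K) (hUr : K - r ≤ #U) :
    (1 - η) * (K.choose q * (K.choose q / P.choose q)) ≤
      ∑ S : KeyRing P K, keyWeight P K S * ind (decide (q ≤ #(S.1 ∩ U))) := by
  have hw := isProbWeight_keyWeight hKP
  have h1 : ∑ S : KeyRing P K, keyWeight P K S * ((#(S.1 ∩ U)).choose q : ℝ) - (q + 1) *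
      ∑ S : KeyRing P K, keyWeight P K S * ((#(S.1 ∩ U)).choose (q + 1) : ℝ) ≤
      ∑ S : KeyRing P K, keyWeight P K S * ind (decide (q ≤ #(S.1 ∩ U))) := by
    rw [mul_sum, ← sum_sub_distrib]
    refine sum_le_sum fun S _ => ?_
    have := mul_le_mul_of_nonneg_left (choose_sub_le_ind (q := q) #(S.1 ∩ U)) (hw.1 S)
    linarith
  rw [sum_keyWeight_choose hKP, sum_keyWeight_choose hKP] at h1
  have hPq : 0 < P.choose q := Nat.choose_pos (by omega)
  have hPpos : (0 : ℝ) < P := by exact_mod_cast (by omega : 0 < P)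
  set ρ : ℝ := K.choose q / P.choose q with hρ
  have hρ0 : 0 ≤ ρ := by positivity
  have h2 : (K.choose (q + 1) / P.choose (q + 1) : ℝ) ≤ ρ * (K / P) := by
    have e1 : (K.choose (q + 1) : ℝ) * (q + 1) = K.choose q * (K - q) := by
      have := Nat.choose_succ_right_eq K q
      rw [← Nat.cast_sub (by omega : q ≤ K)]
      exact_mod_cast this
    have e2 : (P.choose (q + 1) : ℝ) * (q + 1) = P.choose q * (P - q) := by
      have := Nat.choose_succ_right_eq P q
      rw [← Nat.cast_sub (by omega : q ≤ P)]
      exact_mod_cast this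
    have hq1 : (q : ℝ) + 1 ≤ K := by exact_mod_cast hqK
    have hq2 : (K : ℝ) ≤ P := by exact_mod_cast hKP
    have hPq' : (0 : ℝ) < P.choose q := by exact_mod_cast hPq
    have e3 : (K.choose (q + 1) / P.choose (q + 1) : ℝ) = ρ * ((K - q) / (P - q)) := by
      have hc : (0 : ℝ) < P.choose (q + 1) := by
        exact_mod_cast Nat.choose_pos (by omega : q + 1 ≤ P)
      have hd : (0 : ℝ) < P - q := by linarith
      have hq' : (0 : ℝ) < (q : ℝ) + 1 := by positivity
      rw [hρ, div_mul_div_comm, ← e1, ← e2]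
      field_simp
    rw [e3]
    refine mul_le_mul_of_nonneg_left ?_ hρ0
    rw [div_le_div_iff₀ (by linarith) hPpos]
    nlinarith [(Nat.cast_nonneg q : (0 : ℝ) ≤ q)]
  have h3 : ((q : ℝ) + 1) * (#U).choose (q + 1) ≤ K.choose q * K := by
    have e1 : ((#U).choose (q + 1) : ℝ) * (q + 1) ≤ K.choose q * K := by
      have := Nat.choose_succ_right_eq (#U) q
      have h4 : (#U).choose (q + 1) * (q + 1) ≤ K.choose q * K := by
        rw [this]
        exact Nat.mul_le_mul (Nat.choose_le_choose q hU) ((Nat.sub_le _ _).trans hU)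
      exact_mod_cast h4
    linarith
  have h4 : ((K - r).choose q : ℝ) ≤ (#U).choose q := by
    exact_mod_cast Nat.choose_le_choose q hUr
  have h5 : ((q : ℝ) + 1) * ((#U).choose (q + 1) * (K.choose (q + 1) / P.choose (q + 1))) ≤
      K.choose q * K * (ρ * (K / P)) := by
    rw [← mul_assoc]
    exact mul_le_mul h3 h2 (by positivity) (by positivity)
  have h6 := mul_le_mul_of_nonneg_right (hr.trans h4) hρ0
  have h7 : (K.choose q : ℝ) * K * (ρ * (K / P)) = K ^ 2 / P * K.choose q * ρ := by ring
  linarith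

lemma psq_le (hKP : K ≤ P) : psq q K P ≤ K.choose q * (K.choose q / P.choose q) := by
  obtain ⟨T⟩ := nonempty_keyRing hKP
  rw [← sum_keyWeight_le_card_inter hKP T.1 T.2]
  have := sum_keyWeight_choose hKP T.1 q
  rw [T.2] at this
  rw [← this]
  exact sum_le_sum fun S _ => mul_le_mul_of_nonneg_left (ind_le_choose _)
    ((isProbWeight_keyWeight hKP).1 S)

lemma sq_div_pow_le (hKP : K ≤ P) (hqK : 2 * q + 1 ≤ K) {r : ℕ} {η : ℝ} (hη : η ≤ 1 / 2)
    (hr : (1 - η + K ^ 2 / P) * K.choose q ≤ (K - r).choose q) :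
    ((K : ℝ) ^ 2 / P) ^ q ≤ 2 * (4 ^ q * q.factorial) * psq q K P := by
  obtain ⟨T⟩ := nonempty_keyRing hKP
  have h1 := le_sum_keyWeight_ind hKP (by omega) hr (U := T.1) T.2.le (by rw [T.2]; omega)
  rw [sum_keyWeight_le_card_inter hKP T.1 T.2] at h1
  have hPpos : (0 : ℝ) < P := by exact_mod_cast (by omega : 0 < P)
  have hPq : (0 : ℝ) < P.choose q := by exact_mod_cast Nat.choose_pos (by omega : q ≤ P)
  set A : ℝ := K.choose q * (K.choose q / P.choose q)
  have hA : 0 ≤ A := by positivity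
  have hf : (0 : ℝ) < q.factorial := by exact_mod_cast q.factorial_pos
  have h2 : ((K : ℝ) ^ 2 / P) ^ q ≤ 4 ^ q * q.factorial * A := by
    have e1 : ((K : ℝ) / 2) ^ q / q.factorial ≤ K.choose q := by
      refine le_trans ?_ (Nat.pow_le_choose q K)
      gcongr
      rw [Nat.cast_sub (by omega)]
      have : (2 : ℝ) * q + 1 ≤ K := by exact_mod_cast hqK
      push_cast
      linarith
    have e2 : (P.choose q : ℝ) ≤ P ^ q / q.factorial := Nat.choose_le_pow_div q P
    have e3 : ((K : ℝ) / 2) ^ q / q.factorial * (((K : ℝ) / 2) ^ q / q.factorial /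
        (P ^ q / q.factorial)) ≤ A := by
      refine mul_le_mul e1 (div_le_div₀ (by positivity) e1 hPq e2) (by positivity) (by positivity)
    have e4 : ((K : ℝ) ^ 2 / P) ^ q = 4 ^ q * q.factorial * (((K : ℝ) / 2) ^ q / q.factorial *
        (((K : ℝ) / 2) ^ q / q.factorial / (P ^ q / q.factorial))) := by
      rw [div_pow, div_pow, ← pow_mul, mul_comm 2 q, pow_mul]
      have h4 : (4 : ℝ) ^ q = 2 ^ q * 2 ^ q := by rw [← mul_pow]; norm_num
      rw [h4]
      field_simp
    rw [e4]
    gcongr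
  have h3 : A ≤ 2 * psq q K P := by nlinarith
  calc _ ≤ _ := h2
    _ ≤ 4 ^ q * q.factorial * (2 * psq q K P) := by gcongr
    _ = _ := by ring

lemma sum_keyWeight_ind_mul_ind_le (hKP : K ≤ P) {U U' : Finset (Fin P)} (hU : #U ≤ K)
    (hU' : #U' ≤ K) (hd : Disjoint U U') :
    ∑ S : KeyRing P K, keyWeight P K S *
      (ind (decide (q ≤ #(S.1 ∩ U))) * ind (decide (q ≤ #(S.1 ∩ U')))) ≤
        4 ^ q * (((K : ℝ) ^ 2 / P) ^ q) ^ 2 := by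
  have h1 : (#(U ∪ U') : ℝ) ≤ 2 * K := by
    have := card_union_le U U'
    exact_mod_cast (by omega : #(U ∪ U') ≤ 2 * K)
  have h2 := sum_keyWeight_choose_le hKP (U ∪ U') (2 * q) h1
  have h3 : (2 * K * ((K : ℝ) / P)) ^ (2 * q) = 4 ^ q * (((K : ℝ) ^ 2 / P) ^ q) ^ 2 := by
    rw [← pow_mul, mul_comm q 2, show (4 : ℝ) = 2 ^ 2 by norm_num, ← pow_mul, ← mul_pow]
    ring
  rw [← h3]
  refine le_trans (sum_le_sum fun S _ => mul_le_mul_of_nonneg_left ?_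
    ((isProbWeight_keyWeight hKP).1 S)) h2
  refine le_trans ?_ (ind_le_choose (q := 2 * q) _)
  have h4 : #(S.1 ∩ (U ∪ U')) = #(S.1 ∩ U) + #(S.1 ∩ U') := by
    rw [inter_union_distrib_left, card_union_of_disjoint
      (hd.mono inter_subset_right inter_subset_right)]
  by_cases h5 : q ≤ #(S.1 ∩ U)
  · by_cases h6 : q ≤ #(S.1 ∩ U')
    · have : 2 * q ≤ #(S.1 ∩ (U ∪ U')) := by omega
      simp [h5, h6, this]
    · simp [h6, ind_nonneg]
  · simp [h5, ind_nonneg]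

end KeyRing

lemma iidExp_fin_succ {α : Type*} [Fintype α] {w : α → ℝ} {m : ℕ}
    (f : (Fin (m + 1) → α) → ℝ) :
    iidExp w f = iidExp w fun T : Fin m → α => ∑ t, w t * f (Fin.cons t T) := by
  rw [iidExp_sum]
  simp only [iidExp]
  rw [← (Fin.consEquiv fun _ => α).sum_comp, Fintype.sum_prod_type]
  refine sum_congr rfl fun t _ => sum_congr rfl fun T _ => ?_
  simp [Fin.consEquiv, Fin.prod_univ_succ, mul_assoc, mul_left_comm]

section KeyRing

variable {q K P : ℕ}

/-- The keys of `T i` that do not occur in a later key ring. -/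
def freshKeys {m : ℕ} (T : Fin m → KeyRing P K) (i : Fin m) : Finset (Fin P) :=
  (T i).1 \ (univ.filter (i < ·)).biUnion fun j => (T j).1

/-- Number of key rings sharing at least `r` keys with the union of the later ones. -/
def overlaps (r : ℕ) {m : ℕ} (T : Fin m → KeyRing P K) : ℕ :=
  #{i | r ≤ #((T i).1 ∩ (univ.filter (i < ·)).biUnion fun j => (T j).1)}

lemma overlaps_cons (r : ℕ) {m : ℕ} (t : KeyRing P K) (T : Fin m → KeyRing P K) :
    overlaps r (Fin.cons t T : Fin (m + 1) → KeyRing P K) =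
      (if r ≤ #(t.1 ∩ univ.biUnion fun j => (T j).1) then 1 else 0) + overlaps r T := by
  have h0 : ((univ : Finset (Fin (m + 1))).filter (0 < ·)).biUnion
      (fun j => ((Fin.cons t T : Fin (m + 1) → KeyRing P K) j).1) =
        univ.biUnion fun j => (T j).1 := by
    ext x
    simp [Fin.exists_fin_succ]
  have h1 : ∀ i : Fin m, ((univ : Finset (Fin (m + 1))).filter (i.succ < ·)).biUnion
      (fun j => ((Fin.cons t T : Fin (m + 1) → KeyRing P K) j).1) =
        (univ.filter (i < ·)).biUnion fun j => (T j).1 := by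
    intro i
    ext x
    simp [Fin.exists_fin_succ]
  simp only [overlaps]
  rw [Fin.card_filter_univ_succ, h0]
  simp only [h1, Fin.cons_zero, Fin.cons_succ]
  split_ifs <;> ring

lemma iidExp_pow_overlaps_le (hKP : K ≤ P) {r m : ℕ} {x N δ : ℝ} (hx : 0 ≤ x)
    (hN : m * K ≤ N) (hδ : (N * (K / P)) ^ r ≤ δ) :
    iidExp (keyWeight P K) (fun T : Fin m → KeyRing P K => x ^ overlaps r T) ≤
      (1 + x * δ) ^ m := by
  have hw := isProbWeight_keyWeight hKP
  have hN0 : 0 ≤ N := le_trans (by positivity) hN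
  have hδ0 : 0 ≤ δ := le_trans (by positivity) hδ
  induction m with
  | zero => simp [iidExp, overlaps]
  | succ m ih =>
    have ih := ih (le_trans (by gcongr; simp) hN)
    rw [iidExp_fin_succ]
    have h1 : ∀ T : Fin m → KeyRing P K, ∑ t, keyWeight P K t *
        x ^ overlaps r (Fin.cons t T : Fin (m + 1) → KeyRing P K) ≤
          (1 + x * δ) * x ^ overlaps r T := by
      intro T
      set W := univ.biUnion fun j => (T j).1
      have hW : (#W : ℝ) ≤ N := by
        refine le_trans ?_ hN
        have : #W ≤ (m + 1) * K := by
          refine (card_biUnion_le_card_mul _ _ K fun j _ => (T j).2.le).trans ?_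
          rw [card_univ, Fintype.card_fin]
          gcongr
          simp
        exact_mod_cast this
      have h2 : ∀ t : KeyRing P K, x ^ overlaps r (Fin.cons t T : Fin (m + 1) → KeyRing P K) ≤
          (1 + x * (#(t.1 ∩ W)).choose r) * x ^ overlaps r T := by
        intro t
        rw [overlaps_cons, pow_add]
        refine mul_le_mul_of_nonneg_right ?_ (by positivity)
        split_ifs with h
        · have : (1 : ℝ) ≤ (#(t.1 ∩ W)).choose r := by exact_mod_cast Nat.choose_pos h
          nlinarith
        · simpa using mul_nonneg hx (Nat.cast_nonneg _)
      have h3 := (sum_keyWeight_choose_le hKP W r hW).trans hδ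
      calc _ ≤ ∑ t, keyWeight P K t * ((1 + x * (#(t.1 ∩ W)).choose r) * x ^ overlaps r T) :=
            sum_le_sum fun t _ => mul_le_mul_of_nonneg_left (h2 t) (hw.1 t)
        _ = (∑ t, keyWeight P K t +
            x * ∑ t : KeyRing P K, keyWeight P K t * (#(t.1 ∩ W)).choose r) * x ^ overlaps r T := by
            rw [mul_sum, ← sum_add_distrib, sum_mul]
            exact sum_congr rfl fun t _ => by ring
        _ ≤ _ := by
            rw [hw.2]
            gcongr
    calc _ ≤ iidExp (keyWeight P K) (fun T : Fin m → KeyRing P K =>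
          (1 + x * δ) * x ^ overlaps r T) := iidExp_mono hw h1
      _ ≤ (1 + x * δ) * (1 + x * δ) ^ m := by
          rw [iidExp_mul_left]
          gcongr
      _ = _ := by ring

lemma disjoint_freshKeys {m : ℕ} (T : Fin m → KeyRing P K) {i j : Fin m} (hij : j < i) :
    Disjoint (freshKeys T i) (freshKeys T j) := by
  rw [disjoint_left]
  intro x hi hj
  simp only [freshKeys, Finset.mem_sdiff, mem_biUnion, mem_filter, mem_univ, true_and,
    not_exists, not_and] at hi hj
  exact hj.2 i hij hi.1

lemma joint_le_of_overlaps (hKP : K ≤ P) {p : ℝ} (hp : p ∈ Set.Ioc (0 : ℝ) 1)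
    (hqK : q + 1 ≤ K) {r : ℕ} {η z : ℝ} (hη : η ≤ 1) (hz0 : 0 ≤ z) (hz1 : z ≤ 1)
    (hr : (1 - η + K ^ 2 / P) * K.choose q ≤ (K - r).choose q) {m : ℕ}
    (T : Fin m → KeyRing P K) :
    (keyModel q hKP hp).joint z T ≤
      1 - (m - overlaps r T) * ((1 - z) * p * ((1 - η) * psq q K P)) +
        m ^ 2 * (((1 - z) * p) ^ 2 * (4 ^ q * (((K : ℝ) ^ 2 / P) ^ q) ^ 2)) := by
  have hw := isProbWeight_keyWeight hKP
  set π := (1 - z) * p with hπ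
  have hπ0 : 0 ≤ π := mul_nonneg (by linarith) hp.1.le
  have hπ1 : π ≤ 1 := mul_le_one₀ (by linarith) hp.1.le hp.2
  set G : Finset (Fin m) :=
    {i | ¬ r ≤ #((T i).1 ∩ (univ.filter (i < ·)).biUnion fun j => (T j).1)} with hG
  have hGcard : overlaps r T + #G = m := by
    have := card_filter_add_card_filter_not (s := (univ : Finset (Fin m)))
      (fun i => r ≤ #((T i).1 ∩ (univ.filter (i < ·)).biUnion fun j => (T j).1))
    rwa [card_univ, Fintype.card_fin] at this
  have hGcard' : (m : ℝ) - overlaps r T = #G := by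
    rw [sub_eq_iff_eq_add', ← Nat.cast_add, hGcard]
  have hGm : #G ≤ m := by omega
  have hU : ∀ i, #(freshKeys T i) ≤ K := fun i => (card_le_card sdiff_subset).trans (T i).2.le
  have hUG : ∀ i ∈ G, K - r ≤ #(freshKeys T i) := by
    intro i hi
    have h1 := (mem_filter.1 hi).2
    have h2 := card_sdiff_add_card_inter (T i).1 ((univ.filter (i < ·)).biUnion fun j => (T j).1)
    rw [(T i).2] at h2
    unfold freshKeys
    omega
  set J : Fin m → KeyRing P K → ℝ := fun i S => ind (decide (q ≤ #(S.1 ∩ freshKeys T i))) with hJ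
  have hJ0 : ∀ i S, 0 ≤ J i S := fun _ _ => ind_nonneg _
  have hJ1 : ∀ i S, J i S ≤ 1 := fun _ _ => ind_le_one _
  set I := (keyModel q hKP hp).I with hI
  have hJI : ∀ i S, J i S ≤ ind (I (T i) S) := by
    intro i S
    by_cases h : q ≤ #(S.1 ∩ freshKeys T i)
    · have h2 : q ≤ #((T i).1 ∩ S.1) := by
        rw [inter_comm]
        exact h.trans (card_le_card (inter_subset_inter_left sdiff_subset))
      simp [hJ, hI, keyModel, h, h2]
    · simp [hJ, h, ind_nonneg]
  have h1 : ∀ S, ∏ i, (1 - π * ind (I (T i) S)) ≤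
      1 - π * ∑ i ∈ G, J i S + π ^ 2 * ∑ i ∈ G, ∑ j ∈ G with j < i, J i S * J j S := by
    intro S
    have e1 : ∀ i, 0 ≤ 1 - π * ind (I (T i) S) := fun i =>
      sub_nonneg.2 (mul_le_one₀ hπ1 (ind_nonneg _) (ind_le_one _))
    calc ∏ i, (1 - π * ind (I (T i) S)) ≤ ∏ i ∈ G, (1 - π * ind (I (T i) S)) := by
          rw [← prod_sdiff (subset_univ G)]
          exact mul_le_of_le_one_left (prod_nonneg fun i _ => e1 i) (prod_le_one (fun i _ => e1 i)
            fun i _ => sub_le_self _ (mul_nonneg hπ0 (ind_nonneg _)))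
      _ ≤ ∏ i ∈ G, (1 - π * J i S) := prod_le_prod (fun i _ => e1 i) fun i _ =>
          sub_le_sub_left (mul_le_mul_of_nonneg_left (hJI i S) hπ0) 1
      _ ≤ _ := prod_one_sub_le G (fun i _ => mul_nonneg hπ0 (hJ0 i S))
          fun i _ => mul_le_one₀ hπ1 (hJ0 i S) (hJ1 i S)
      _ = _ := by
          simp only [mul_sum]
          congr 1
          exact sum_congr rfl fun i _ => sum_congr rfl fun j _ => by ring
  have h2 : ∀ i ∈ G, (1 - η) * psq q K P ≤ ∑ S, keyWeight P K S * J i S := fun i hi =>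
    (mul_le_mul_of_nonneg_left (psq_le hKP) (by linarith)).trans
      (le_sum_keyWeight_ind hKP hqK hr (hU i) (hUG i hi))
  set b := 4 ^ q * (((K : ℝ) ^ 2 / P) ^ q) ^ 2 with hb
  have hb0 : 0 ≤ b := by positivity
  have h3 : ∀ i, ∀ j ∈ G.filter (· < i), ∑ S, keyWeight P K S * (J i S * J j S) ≤ b :=
    fun i j hj => sum_keyWeight_ind_mul_ind_le hKP (hU i) (hU j)
      (disjoint_freshKeys T (mem_filter.1 hj).2)
  have h4 : #G * ((1 - η) * psq q K P) ≤ ∑ i ∈ G, ∑ S, keyWeight P K S * J i S := by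
    rw [← nsmul_eq_mul]
    exact card_nsmul_le_sum _ _ _ h2
  have h5 : ∑ i ∈ G, ∑ j ∈ G with j < i, ∑ S, keyWeight P K S * (J i S * J j S) ≤ m ^ 2 * b := by
    have e1 : ∀ i ∈ G, ∑ j ∈ G with j < i, ∑ S, keyWeight P K S * (J i S * J j S) ≤ m * b := by
      intro i _
      refine (sum_le_card_nsmul _ _ _ (h3 i)).trans ?_
      rw [nsmul_eq_mul]
      gcongr
      exact (card_filter_le _ _).trans hGm
    refine (sum_le_card_nsmul _ _ _ e1).trans ?_
    rw [nsmul_eq_mul, pow_two, mul_assoc]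
    gcongr
  calc (keyModel q hKP hp).joint z T = ∑ S, keyWeight P K S * ∏ i, (1 - π * ind (I (T i) S)) := rfl
    _ ≤ ∑ S, keyWeight P K S * (1 - π * ∑ i ∈ G, J i S +
        π ^ 2 * ∑ i ∈ G, ∑ j ∈ G with j < i, J i S * J j S) :=
        sum_le_sum fun S _ => mul_le_mul_of_nonneg_left (h1 S) (hw.1 S)
    _ = 1 - π * ∑ i ∈ G, ∑ S, keyWeight P K S * J i S +
        π ^ 2 * ∑ i ∈ G, ∑ j ∈ G with j < i, ∑ S, keyWeight P K S * (J i S * J j S) := by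
        have e1 : ∑ i ∈ G, ∑ j ∈ G with j < i, ∑ S, keyWeight P K S * (J i S * J j S) =
            ∑ S, keyWeight P K S * ∑ i ∈ G, ∑ j ∈ G with j < i, J i S * J j S := by
          simp only [mul_sum]
          rw [sum_comm (s := univ)]
          exact sum_congr rfl fun i _ => sum_comm
        simp only [mul_add, mul_sub, mul_one, sum_add_distrib, sum_sub_distrib, hw.2]
        have e2 : ∑ i ∈ G, ∑ S, keyWeight P K S * J i S =
            ∑ S, keyWeight P K S * ∑ i ∈ G, J i S := by
          simp only [mul_sum]
          exact sum_comm
        rw [e1, e2, mul_sum univ, mul_sum univ]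
        simp only [mul_left_comm (keyWeight P K _)]
    _ ≤ 1 - π * (#G * ((1 - η) * psq q K P)) + π ^ 2 * (m ^ 2 * b) := by gcongr
    _ = _ := by rw [hGcard']; ring

lemma le_mul_overlaps (hKP : K ≤ P) {p : ℝ} (hp : p ∈ Set.Ioc (0 : ℝ) 1) (hqK : q + 1 ≤ K)
    {N m r : ℕ} (hN : 0 < N) {C z : ℝ} (hz0 : 0 ≤ z) (hz1 : z ≤ 1)
    (hr : (1 - (N : ℝ)⁻¹ + K ^ 2 / P) * K.choose q ≤ (K - r).choose q)
    (hs : ((K : ℝ) ^ 2 / P) ^ q ≤ C * psq q K P)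
    (hm : m * (p * psq q K P) * (4 ^ q * C ^ 2) ≤ (N : ℝ)⁻¹) {T : Fin m → KeyRing P K}
    (hT : 1 - (1 - 3 * (N : ℝ)⁻¹) * (m * ((1 - z) * (p * psq q K P))) <
      (keyModel q hKP hp).joint z T) :
    m ≤ N * overlaps r T := by
  have : Nonempty (KeyRing P K) := nonempty_keyRing hKP
  have hps0 : 0 ≤ psq q K P := (keyModel q hKP hp).ps_nonneg
  have hN0 : (0 : ℝ) < N := by exact_mod_cast hN
  have hNi : 0 < (N : ℝ)⁻¹ := inv_pos.2 hN0
  have hN1 : (N : ℝ)⁻¹ ≤ 1 := inv_le_one_of_one_le₀ (by exact_mod_cast hN)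
  have hpp := hp.1
  have h6 := joint_le_of_overlaps hKP hp hqK hN1 hz0 hz1 hr T
  have hs0 : 0 ≤ (K : ℝ) ^ 2 / P := by positivity
  generalize psq q K P = ps at *
  generalize (K : ℝ) ^ 2 / P = s at *
  generalize overlaps r T = v at *
  generalize (keyModel q hKP hp).joint z T = J at *
  set η := (N : ℝ)⁻¹ with hη
  have hz' : 0 ≤ 1 - z := by linarith
  have hE0 : 0 ≤ m * ((1 - z) * (p * ps)) := by positivity
  have e4 : m * ((1 - z) * (p * ps)) ≤ m * (p * ps) :=
    mul_le_mul_of_nonneg_left (mul_le_of_le_one_left (mul_nonneg hpp.le hps0) (by linarith))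
      (Nat.cast_nonneg m)
  obtain ⟨E, hE⟩ : ∃ E, E = m * ((1 - z) * (p * ps)) := ⟨_, rfl⟩
  rw [← hE] at hE0 e4 hT
  by_contra! hlt
  have e1 : (v : ℝ) ≤ η * m := by
    rw [hη, inv_mul_eq_div, le_div_iff₀ hN0, mul_comm]
    exact_mod_cast hlt.le
  have e2 : (m : ℝ) ^ 2 * (((1 - z) * p) ^ 2 * (4 ^ q * (s ^ q) ^ 2)) ≤ η * E := by
    have e3 : (s ^ q) ^ 2 ≤ (C * ps) ^ 2 := by gcongr
    calc _ ≤ (m : ℝ) ^ 2 * (((1 - z) * p) ^ 2 * (4 ^ q * (C * ps) ^ 2)) := by gcongr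
      _ = E * (E * (4 ^ q * C ^ 2)) := by rw [hE]; ring
      _ ≤ E * (m * (p * ps) * (4 ^ q * C ^ 2)) := by gcongr
      _ ≤ E * η := by gcongr
      _ = η * E := mul_comm _ _
  have e5 : (1 - η) * ((1 - η) * E) ≤ (m - v) * ((1 - z) * p * ((1 - η) * ps)) := by
    have e6 : (1 - η) * m ≤ m - v := by linarith
    have e7 : 0 ≤ (1 - z) * p * ((1 - η) * ps) :=
      mul_nonneg (by positivity) (mul_nonneg (by linarith) hps0)
    calc _ = (1 - η) * m * ((1 - z) * p * ((1 - η) * ps)) := by rw [hE]; ring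
      _ ≤ _ := mul_le_mul_of_nonneg_right e6 e7
  have e8 : 0 ≤ η ^ 2 * E := by positivity
  have e9 : (1 - η) * ((1 - η) * E) = E - 2 * (η * E) + η ^ 2 * E := by ring
  have e10 : (1 - 3 * η) * E = E - 3 * (η * E) := by ring
  linarith

lemma iidExp_joint_tail_le (hKP : K ≤ P) {p : ℝ} (hp : p ∈ Set.Ioc (0 : ℝ) 1)
    (hqK : 2 * q + 1 ≤ K) {N m : ℕ} (hN : 2 ≤ N) {y z : ℝ} (hz0 : 0 ≤ z) (hz1 : z ≤ 1)
    (hr : (1 - (N : ℝ)⁻¹ + K ^ 2 / P) * K.choose q ≤ (K - 3 * N * q).choose q)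
    (hm : m * (p * psq q K P) * (4 ^ q * (2 * (4 ^ q * q.factorial)) ^ 2) ≤ (N : ℝ)⁻¹)
    (hy : N * (2 * (4 ^ q * q.factorial)) * m ^ (q + 1) * (p * psq q K P) ≤ y) (hy0 : 0 < y)
    (hy1 : y ≤ 1) :
    iidExp (keyModel q hKP hp).w (fun T : Fin m → KeyRing P K =>
      if Real.exp (-((1 - 3 * (N : ℝ)⁻¹) * (m * ((1 - z) * (p * psq q K P))))) <
        (keyModel q hKP hp).joint z T then 1 else 0) ≤ (2 * y ^ 3) ^ m := by
  have hw := (keyModel q hKP hp).isProbWeight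
  have : Nonempty (KeyRing P K) := nonempty_keyRing hKP
  have hps0 : 0 ≤ psq q K P := (keyModel q hKP hp).ps_nonneg
  have hN0 : (0 : ℝ) < N := by exact_mod_cast (by omega : 0 < N)
  have hN2 : (N : ℝ)⁻¹ ≤ 1 / 2 := by
    rw [one_div]
    exact inv_anti₀ two_pos (by exact_mod_cast hN)
  have hNi : 0 < (N : ℝ)⁻¹ := inv_pos.2 hN0
  have hpp := hp.1
  have hz' : 0 ≤ 1 - z := by linarith
  have hE0 : 0 ≤ m * ((1 - z) * (p * psq q K P)) := by positivity
  have hκ := Real.add_one_le_exp (-((1 - 3 * (N : ℝ)⁻¹) * (m * ((1 - z) * (p * psq q K P)))))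
  rcases le_or_gt (m * ((1 - z) * p)) (N : ℝ)⁻¹ with hcase | hcase
  · have h1 : ∀ T : Fin m → KeyRing P K,
        ¬ Real.exp (-((1 - 3 * (N : ℝ)⁻¹) * (m * ((1 - z) * (p * psq q K P))))) <
          (keyModel q hKP hp).joint z T := by
      intro T
      have h2 : (keyModel q hKP hp).joint z T ≤
          1 - (1 - (N : ℝ)⁻¹) * (m * ((1 - z) * (p * psq q K P))) :=
        (keyModel q hKP hp).joint_le_of_mul_le hz0 hz1 hcase T
      have h3 : 0 ≤ (N : ℝ)⁻¹ * (m * ((1 - z) * (p * psq q K P))) := by positivity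
      linarith
    simp only [h1, if_false, iidExp_const hw]
    positivity
  · have hs := sq_div_pow_le hKP hqK hN2 hr
    have hpsle : psq q K P ≤ N * m * (p * psq q K P) := by
      have h1 : 1 ≤ N * (m * ((1 - z) * p)) := by
        have := mul_le_mul_of_nonneg_left hcase.le hN0.le
        rwa [mul_inv_cancel₀ hN0.ne'] at this
      have h2 : N * (m * ((1 - z) * p)) ≤ N * (m * p) :=
        mul_le_mul_of_nonneg_left (mul_le_mul_of_nonneg_left
          (mul_le_of_le_one_left hpp.le (by linarith)) (Nat.cast_nonneg m)) hN0.le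
      calc psq q K P ≤ N * (m * p) * psq q K P := le_mul_of_one_le_left hps0 (h1.trans h2)
        _ = _ := by ring
    have h3 : (m * K * ((K : ℝ) / P)) ^ (3 * N * q) ≤ y ^ (3 * N) := by
      have e1 : (m * K * ((K : ℝ) / P)) ^ q ≤ y := by
        calc (m * K * ((K : ℝ) / P)) ^ q = m ^ q * ((K : ℝ) ^ 2 / P) ^ q := by
              rw [← mul_pow]; ring
          _ ≤ m ^ q * (2 * (4 ^ q * q.factorial) * (N * m * (p * psq q K P))) := by
              gcongr
              exact hs.trans (by gcongr)
          _ = N * (2 * (4 ^ q * q.factorial)) * m ^ (q + 1) * (p * psq q K P) := by ring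
          _ ≤ y := hy
      rw [mul_comm (3 * N) q, pow_mul]
      gcongr
    have h4 := iidExp_pow_overlaps_le hKP (r := 3 * N * q) (m := m) (x := (y ^ (3 * N))⁻¹)
      (N := m * K) (δ := y ^ (3 * N)) (by positivity) le_rfl h3
    rw [inv_mul_cancel₀ (by positivity), show (1 : ℝ) + 1 = 2 by norm_num] at h4
    have h5 : ∀ T : Fin m → KeyRing P K,
        (if Real.exp (-((1 - 3 * (N : ℝ)⁻¹) * (m * ((1 - z) * (p * psq q K P))))) <
          (keyModel q hKP hp).joint z T then (1 : ℝ) else 0) ≤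
          y ^ (3 * m) * (y ^ (3 * N))⁻¹ ^ overlaps (3 * N * q) T := by
      intro T
      split_ifs with h
      · have h7 := le_mul_overlaps hKP hp (by omega) (by omega) hz0 hz1 hr hs hm
          (T := T) (by linarith)
        rw [inv_pow, ← pow_mul, ← div_eq_mul_inv, one_le_div (by positivity)]
        refine pow_le_pow_of_le_one hy0.le hy1 ?_
        rw [mul_assoc]
        exact Nat.mul_le_mul_left 3 h7
      · positivity
    calc _ ≤ iidExp (keyWeight P K) (fun T : Fin m → KeyRing P K =>
          y ^ (3 * m) * (y ^ (3 * N))⁻¹ ^ overlaps (3 * N * q) T) := iidExp_mono hw h5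
      _ ≤ y ^ (3 * m) * 2 ^ m := by
          rw [iidExp_mul_left]
          gcongr
      _ = _ := by rw [pow_mul, mul_pow, mul_comm]

end KeyRing

namespace RingModel

variable {V R : Type*} [Fintype V] [DecidableEq V] [Fintype R] (M : RingModel R)

lemma exp_pow_cnt_eq_sum (h : ℕ) (t : ℝ) :
    M.exp (fun ω => t ^ M.cnt h ω (univ : Finset V)) = ∑ k ∈ range (Fintype.card V + 1),
      M.exp (fun ω : (V → R) × (Sym2 V → Bool) => if M.cnt h ω univ = k then 1 else 0) * t ^ k := by
  have h1 : ∀ ω : (V → R) × (Sym2 V → Bool), t ^ M.cnt h ω univ =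
      ∑ k ∈ range (Fintype.card V + 1), t ^ k * if M.cnt h ω univ = k then 1 else 0 := by
    intro ω
    have : M.cnt h ω univ ≤ #(univ : Finset V) := card_filter_le _ _
    simp only [mul_ite, mul_one, mul_zero]
    rw [Finset.sum_ite_eq, if_pos]
    exact mem_range.2 (Nat.lt_succ_of_le this)
  simp only [h1]
  rw [exp_sum]
  refine sum_congr rfl fun k _ => ?_
  rw [exp_mul_left, mul_comm]

lemma hasSum_exp_pow_cnt (h : ℕ) (t : ℝ) :
    HasSum (fun k => M.exp (fun ω : (V → R) × (Sym2 V → Bool) =>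
      if M.cnt h ω univ = k then 1 else 0) * t ^ k)
      (M.exp fun ω => t ^ M.cnt h ω (univ : Finset V)) := by
  rw [exp_pow_cnt_eq_sum]
  refine hasSum_sum_of_ne_finset_zero fun k hk => ?_
  have h1 : ∀ ω : (V → R) × (Sym2 V → Bool), M.cnt h ω univ ≠ k := by
    intro ω h2
    have : M.cnt h ω univ ≤ #(univ : Finset V) := card_filter_le _ _
    rw [card_univ] at this
    exact hk (mem_range.2 (by omega))
  simp [h1, exp_const]

lemma hasDerivAt_exp_pow_cnt (h : ℕ) (t : ℝ) :
    HasDerivAt (fun t : ℝ => M.exp fun ω => t ^ M.cnt h ω (univ : Finset V))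
      (M.exp fun ω => M.cnt h ω (univ : Finset V) * t ^ (M.cnt h ω univ - 1)) t := by
  simp only [exp, iidExp]
  exact HasDerivAt.fun_sum fun S _ => (HasDerivAt.fun_sum fun c _ =>
    (hasDerivAt_pow _ t).const_mul _).const_mul _

lemma binProb_of_lt {h d : ℕ} (hd : h < d) (j : ℕ) : M.binProb h j d = 0 := by
  induction j generalizing d with
  | zero => simp [binProb, hd.ne']
  | succ j ih => simp [binProb, ih hd, ih (hd.trans (Nat.lt_succ_self d))]

lemma binProb_add_eq (r j d : ℕ) :
    M.binProb (d + r) j d = j.choose r * M.pe ^ r * (1 - M.pe) ^ (j - r) := by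
  induction j generalizing r d with
  | zero => cases r <;> simp [binProb]
  | succ j ih =>
    cases r with
    | zero =>
      have h1 := ih 0 d
      rw [add_zero] at h1 ⊢
      simp [binProb, binProb_of_lt, h1, pow_succ, mul_comm]
    | succ r =>
      have h1 := ih r (d + 1)
      rw [show d + 1 + r = d + (r + 1) by ring] at h1
      rw [binProb, ih, h1, Nat.choose_succ_succ, Nat.succ_sub_succ]
      rcases lt_or_ge j (r + 1) with hj | hj
      · rw [Nat.choose_eq_zero_of_lt hj]
        push_cast
        ring
      · obtain ⟨i, rfl⟩ := Nat.exists_eq_add_of_le hj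
        rw [show r + 1 + i - (r + 1) = i by omega, show r + 1 + i - r = i + 1 by omega]
        push_cast
        ring

lemma binProb_zero_eq (h j : ℕ) :
    M.binProb h j 0 = j.choose h * M.pe ^ h * (1 - M.pe) ^ (j - h) := by
  simpa using M.binProb_add_eq h j 0

end RingModel

section Counting

variable {q n K P h : ℕ}

lemma degree_eq_deg (hKP : K ≤ P) {p : ℝ} (hp : p ∈ Set.Ioc (0 : ℝ) 1)
    (S : Fin n → KeyRing P K) (c : Sym2 (Fin n) → Bool) (i : Fin n) :
    degree q n P (fun i => (S i).1, c) i = (keyModel q hKP hp).deg (S, c) univ i := by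
  classical
  rw [degree, Nat.card_eq_fintype_card, Fintype.card_subtype, RingModel.deg]
  congr 1
  ext j
  rw [mem_filter, mem_filter]
  simp [Adj, RingModel.adj, keyModel, and_assoc]

lemma numDeg_eq_cnt (hKP : K ≤ P) {p : ℝ} (hp : p ∈ Set.Ioc (0 : ℝ) 1)
    (S : Fin n → KeyRing P K) (c : Sym2 (Fin n) → Bool) :
    numDeg q n P h (fun i => (S i).1, c) = (keyModel q hKP hp).cnt h (S, c) univ := by
  classical
  simp only [numDeg, degree_eq_deg hKP hp]
  rw [Nat.card_eq_fintype_card, Fintype.card_subtype, RingModel.cnt]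

lemma prob_numDeg_eq_exp (hKP : K ≤ P) {p : ℝ} (hp : p ∈ Set.Ioc (0 : ℝ) 1) (ℓ : ℕ) :
    prob n K P p {ω | numDeg q n P h ω = ℓ} = (keyModel q hKP hp).exp
      (fun ω : (Fin n → KeyRing P K) × (Sym2 (Fin n) → Bool) =>
        if (keyModel q hKP hp).cnt h ω univ = ℓ then 1 else 0) := by
  classical
  simp only [prob, RingModel.exp, iidExp, Fintype.sum_prod_type]
  symm
  refine Fintype.sum_of_injective (fun S i => (S i).1) ?_ _ _ ?_ ?_
  · intro S T hST
    ext1 i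
    exact Subtype.ext (congrFun hST i)
  · intro S hS
    refine sum_eq_zero fun c _ => ?_
    have h1 : ∃ i, #(S i) ≠ K := by
      by_contra! h2
      exact hS ⟨fun i => ⟨S i, h2 i⟩, rfl⟩
    obtain ⟨i, hi⟩ := h1
    rw [Set.indicator_apply]
    split_ifs
    · rw [weight, prod_eq_zero (mem_univ i) (if_neg hi), zero_mul]
    · rfl
  · intro S
    rw [mul_sum]
    refine sum_congr rfl fun c _ => ?_
    rw [Set.indicator_apply]
    simp only [Set.mem_ofPred_eq, numDeg_eq_cnt hKP hp]
    split_ifs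
    · rw [weight]
      simp [keyModel, keyWeight, bern, fun i => (S i).2]
    · simp

end Counting

lemma choose_div_choose_le_pow {n a m : ℕ} (ham : m ≤ a) :
    (n.choose m : ℝ) / a.choose m ≤ (n / (a + 1 - m)) ^ m := by
  have h0 : (0 : ℝ) < a + 1 - m := by
    have : (m : ℝ) ≤ a := by exact_mod_cast ham
    linarith
  have hf : (0 : ℝ) < m.factorial := by exact_mod_cast m.factorial_pos
  have h1 : (n.choose m : ℝ) * m.factorial ≤ n ^ m := by
    rw [← le_div_iff₀ hf]
    exact Nat.choose_le_pow_div m n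
  have h2 : ((a : ℝ) + 1 - m) ^ m ≤ a.choose m * m.factorial := by
    have h3 := Nat.pow_sub_le_descFactorial a m
    rw [Nat.descFactorial_eq_factorial_mul_choose, mul_comm] at h3
    have h4 : ((a : ℝ) + 1 - m) = ((a + 1 - m : ℕ) : ℝ) := by
      rw [Nat.cast_sub (by omega)]
      push_cast
      ring
    rw [h4]
    exact_mod_cast h3
  have hC : (0 : ℝ) < a.choose m := by exact_mod_cast Nat.choose_pos ham
  rw [div_pow, div_le_div_iff₀ hC (by positivity)]
  refine le_of_mul_le_mul_right ?_ hf
  calc (n.choose m : ℝ) * (a + 1 - m) ^ m * m.factorial =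
      n.choose m * m.factorial * (a + 1 - m) ^ m := by ring
    _ ≤ n ^ m * (a.choose m * m.factorial) := by gcongr
    _ = _ := by ring

lemma error_le {u n a D T b₀ b g : ℝ} (hu0 : 0 < u) (hu2 : u ≤ 1 / 2) (hn : n * u ^ 100 = 1)
    (ha1 : 1 ≤ a) (ha : a * u ^ 51 ≤ 1) (hD1 : 1 ≤ D) (hD : D * u ≤ 1) (hT0 : 0 ≤ T)
    (hT : T * u ≤ 1) (hb₀ : 0 ≤ b₀) (hμ : n * b₀ * u ≤ 1) (hb0 : 0 ≤ b) (hg : 0 ≤ g) {m : ℕ}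
    (hm : 100 ≤ m) (hb : b ≤ u ^ (2 * m)) :
    (b₀ + T * u ^ 175 * (a + D * a)) * (D * (a * g + b)) +
      n * (T * (u ^ 175 * ((1 + D) * (a * g + b)) + 2 * (n * u ^ (7 * m)))) ≤
      u ^ 20 * (g + u ^ m) := by
  have hn' : n = (u ^ 100)⁻¹ := eq_inv_of_mul_eq_one_left hn
  have ha' : a ≤ (u ^ 51)⁻¹ := by rwa [← one_div, le_div_iff₀ (by positivity)]
  have hD' : D ≤ u⁻¹ := by rwa [← one_div, le_div_iff₀ (by positivity)]
  have hT' : T ≤ u⁻¹ := by rwa [← one_div, le_div_iff₀ (by positivity)]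
  have hb' : b₀ ≤ u ^ 99 := by
    rw [hn', inv_mul_eq_div, div_mul_eq_mul_div, div_le_one (by positivity)] at hμ
    refine le_of_mul_le_mul_right (hμ.trans_eq (by ring)) hu0
  have hn0 : 0 < n := by rw [hn']; positivity
  have e1 : a * g + b ≤ a * (g + b) := by nlinarith
  have e2 : 0 ≤ a * g + b := by positivity
  have e3 : b₀ * D * a ≤ u ^ 47 := by
    calc _ ≤ u ^ 99 * u⁻¹ * (u ^ 51)⁻¹ := by gcongr
      _ = u ^ 47 := by field_simp
  have e4 : T * u ^ 175 * (a + D * a) * D * a ≤ u ^ 65 := by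
    calc _ ≤ T * u ^ 175 * (D * a + D * a) * D * a := by
          gcongr
          exact le_mul_of_one_le_left (by positivity) hD1
      _ ≤ u⁻¹ * u ^ 175 * (u⁻¹ * (u ^ 51)⁻¹ + u⁻¹ * (u ^ 51)⁻¹) * u⁻¹ * (u ^ 51)⁻¹ := by
          gcongr
      _ = 2 * u * u ^ 69 := by field_simp; ring
      _ ≤ 1 * u ^ 65 := mul_le_mul (by linarith)
          (pow_le_pow_of_le_one hu0.le (by linarith) (by norm_num)) (by positivity) (by norm_num)
      _ = _ := one_mul _
  have e5 : n * T * u ^ 175 * (1 + D) * a ≤ u ^ 21 := by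
    calc _ ≤ n * T * u ^ 175 * (D + D) * a := by gcongr
      _ ≤ (u ^ 100)⁻¹ * u⁻¹ * u ^ 175 * (u⁻¹ + u⁻¹) * (u ^ 51)⁻¹ := by
          rw [hn']
          gcongr
      _ = 2 * u * u ^ 21 := by field_simp; ring
      _ ≤ 1 * u ^ 21 := by gcongr; linarith
      _ = _ := one_mul _
  have e6 : 2 * n ^ 2 * T * u ^ (7 * m) ≤ u ^ 20 * u ^ (2 * m) := by
    obtain ⟨k, rfl⟩ := Nat.exists_eq_add_of_le hm
    calc _ ≤ 2 * ((u ^ 100)⁻¹) ^ 2 * u⁻¹ * u ^ (7 * (100 + k)) := by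
          rw [hn']
          gcongr
      _ = 2 * u * u ^ (498 + 7 * k) := by field_simp; ring
      _ ≤ 1 * u ^ (498 + 7 * k) := by gcongr; linarith
      _ ≤ u ^ (20 + 2 * (100 + k)) := by
          rw [one_mul]
          exact pow_le_pow_of_le_one hu0.le (by linarith) (by omega)
      _ = _ := pow_add _ _ _
  have e7 : u ^ 47 + u ^ 65 + u ^ 21 ≤ u ^ 20 := by
    have f1 : u ^ 47 ≤ u ^ 22 := pow_le_pow_of_le_one hu0.le (by linarith) (by norm_num)
    have f2 : u ^ 65 ≤ u ^ 22 := pow_le_pow_of_le_one hu0.le (by linarith) (by norm_num)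
    have f3 : u ^ 22 ≤ u ^ 21 / 2 := by rw [pow_succ]; nlinarith [pow_pos hu0 21]
    have f4 : u ^ 21 ≤ u ^ 20 / 2 := by rw [pow_succ]; nlinarith [pow_pos hu0 20]
    linarith
  have e8 : u ^ (2 * m) ≤ u ^ m / 2 := by
    rw [two_mul, pow_add, div_eq_mul_inv]
    gcongr
    calc u ^ m ≤ u ^ 1 := pow_le_pow_of_le_one hu0.le (by linarith) (by omega)
      _ ≤ _ := by rw [pow_one]; linarith
  calc _ = (b₀ * D + T * u ^ 175 * (a + D * a) * D + n * T * u ^ 175 * (1 + D)) * (a * g + b) +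
        2 * n ^ 2 * T * u ^ (7 * m) := by ring
    _ ≤ (b₀ * D + T * u ^ 175 * (a + D * a) * D + n * T * u ^ 175 * (1 + D)) * (a * (g + b)) +
        u ^ 20 * u ^ (2 * m) := by gcongr
    _ = (b₀ * D * a + T * u ^ 175 * (a + D * a) * D * a + n * T * u ^ 175 * (1 + D) * a) *
        (g + b) + u ^ 20 * u ^ (2 * m) := by ring
    _ ≤ (u ^ 47 + u ^ 65 + u ^ 21) * (g + b) + u ^ 20 * u ^ (2 * m) := by gcongr
    _ ≤ u ^ 20 * (g + u ^ (2 * m)) + u ^ 20 * u ^ (2 * m) := by gcongr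
    _ = u ^ 20 * (g + 2 * u ^ (2 * m)) := by ring
    _ ≤ _ := by gcongr; linarith

namespace RingModel

variable {V R : Type*} [Fintype V] [DecidableEq V] [Fintype R] (M : RingModel R)

lemma exp_low_le [Nonempty R] {u : ℝ} (hu0 : 0 < u) (hu2 : u ≤ 1 / 2)
    (hn : Fintype.card V * u ^ 100 = 1) {m a h : ℕ} (hm : 100 ≤ m) (hmu : m * u ≤ 1)
    (ha : 1 ≤ a * u ^ 50) (hh : 16 ^ (h + 1) * u ≤ 1) {κ₀ δ : ℝ} (hκ₀ : 0 ≤ κ₀) (hκ1 : κ₀ ≤ 1)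
    (hH : iidExp M.w (fun T : Fin m → R => if κ₀ < M.joint (1 / 16) T then 1 else 0) ≤ δ)
    (hδ : δ ≤ u ^ (85 * m)) (hκ : κ₀ ^ (Fintype.card V - 2 - m) ≤ u ^ (85 * m))
    {t : ℝ} (ht : 0 < t) (ht1 : t ≤ 1) {A : Finset V} (hA : Fintype.card V ≤ #A + 2) :
    M.exp (fun ω => #(M.low h ω A) * t ^ M.cnt h ω A) ≤
      a * M.exp (fun ω => t ^ M.cnt h ω A) + u ^ (2 * m) := by
  set n := Fintype.card V with hncard
  have hn' : (n : ℝ) = (u ^ 100)⁻¹ := eq_inv_of_mul_eq_one_left hn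
  have hm' : (m : ℝ) ≤ u⁻¹ := by rwa [← one_div, le_div_iff₀ (by positivity)]
  have ha' : (u ^ 50)⁻¹ ≤ a := by rwa [← one_div, div_le_iff₀ (by positivity)]
  have hu48 : (u ^ 48)⁻¹ ≤ a - m := by
    have h1 : u⁻¹ ≤ (u ^ 48)⁻¹ := inv_anti₀ (by positivity)
      (by simpa using pow_le_pow_of_le_one hu0.le (by linarith) (by norm_num : 1 ≤ 48))
    have h2 : 2 * (u ^ 48)⁻¹ ≤ (u ^ 50)⁻¹ := by
      rw [← div_eq_mul_inv, div_le_iff₀ (by positivity),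
        show (u ^ 50)⁻¹ * u ^ 48 = (u ^ 2)⁻¹ by field_simp, ← one_div, le_div_iff₀ (by positivity)]
      nlinarith
    linarith
  have ham : m ≤ a := by
    have : (m : ℝ) ≤ a := by
      have : 0 < (u ^ 48)⁻¹ := by positivity
      linarith
    exact_mod_cast this
  have hL := M.exp_choose_low_le (by norm_num : (0 : ℝ) < 1 / 16) (by norm_num) hκ₀ hH h A
  have hδ0 : 0 ≤ δ := le_trans (iidExp_nonneg M.isProbWeight fun T => by split_ifs <;> simp) hH
  have hL' : M.exp (fun ω => ((#(M.low h ω A)).choose m : ℝ)) ≤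
      n.choose m * ((((1 / 16 : ℝ))⁻¹ ^ (h + 1)) ^ m * (u ^ (85 * m) + u ^ (85 * m))) := by
    refine hL.trans ?_
    have h1 : #A ≤ n := card_le_univ A
    have h2 : κ₀ ^ (#A - m) ≤ u ^ (85 * m) :=
      (pow_le_pow_of_le_one hκ₀ hκ1 (by omega)).trans hκ
    gcongr
  refine (M.exp_low_mul_le ht ht1 ham hL').trans ?_
  gcongr
  have h16 : (16 : ℝ) ^ (h + 1) ≤ u⁻¹ := by rwa [← one_div, le_div_iff₀ (by positivity)]
  have h3 : (n : ℝ) / (a + 1 - m) ≤ (u ^ 52)⁻¹ := by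
    rw [div_le_iff₀ (by have : 0 < (u ^ 48)⁻¹ := by positivity
                        linarith), hn', inv_mul_eq_div, le_div_iff₀ (by positivity),
      show (u ^ 100)⁻¹ * u ^ 52 = (u ^ 48)⁻¹ by field_simp]
    linarith
  have h4 := choose_div_choose_le_pow (n := n) ham
  have h5 : 2 ≤ u⁻¹ := by rw [← one_div, le_div_iff₀ hu0]; linarith
  have h6 : (0 : ℝ) ≤ a + 1 - m := by
    have : (m : ℝ) ≤ a := by exact_mod_cast ham
    linarith
  obtain ⟨k, rfl⟩ := Nat.exists_eq_add_of_le hm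
  calc _ = n * (n.choose (100 + k) / a.choose (100 + k)) *
        ((16 ^ (h + 1)) ^ (100 + k) * (2 * u ^ (85 * (100 + k)))) := by
          rw [one_div, inv_inv]
          ring
    _ ≤ (u ^ 100)⁻¹ * ((u ^ 52)⁻¹) ^ (100 + k) *
        ((u⁻¹) ^ (100 + k) * (u⁻¹ * u ^ (85 * (100 + k)))) := by
          rw [hn'] at h3 h4 ⊢
          have h7 := h4.trans (pow_le_pow_left₀ (by positivity) h3 _)
          gcongr
    _ = u ^ (2 * (100 + k)) * u ^ (2899 + 30 * k) := by
          rw [show 85 * (100 + k) = 8500 + 85 * k by ring]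
          simp only [pow_add, pow_mul, inv_pow, mul_add]
          field_simp
          ring
    _ ≤ u ^ (2 * (100 + k)) * 1 := by
          gcongr
          exact pow_le_one₀ hu0.le (by linarith)
    _ = _ := mul_one _

lemma pow_mul_iidExp_tilt_pow_le [Nonempty R] {u : ℝ} (hu0 : 0 < u) (hu2 : u ≤ 1 / 2)
    (hpe : M.pe ≤ u ^ 99) {m : ℕ} (hm : 100 ≤ m) {κ₀ δ : ℝ}
    (hκ₀ : Real.exp (-(m * (15 / 16 * M.pe))) ≤ κ₀) (hκ1 : κ₀ ≤ 1)
    (hH : iidExp M.w (fun T : Fin m → R => if κ₀ < M.joint (1 / 16) T then 1 else 0) ≤ δ)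
    (hδ : δ ≤ u ^ (250 * m)) (hκ : κ₀ ^ (Fintype.card V - 2 - m) ≤ u ^ (85 * m))
    {B : Finset V} {v : V} {j : ℕ} (hv : v ∉ B) (hj : j + #B + 2 = Fintype.card V) :
    ((1 - (1 - 1 / 16) * M.pe) ^ j) ^ m * iidExp M.w (fun S : V → R => M.tilt (1 / 16) B v S ^ m) ≤
      u ^ (7 * m) * (u ^ 175) ^ (m - 1) := by
  have hpe0 := M.pe_nonneg
  have hpe1 := M.pe_le_one
  have hκ0 : 0 ≤ κ₀ := (Real.exp_pos _).le.trans hκ₀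
  have h1 := M.iidExp_tilt_pow_le (by norm_num : (0 : ℝ) ≤ 1 / 16) (by norm_num) hκ0 hH hv
  have h2 : ((1 - (1 - 1 / 16) * M.pe) ^ j) ^ m ≤ κ₀ ^ j := by
    rw [← pow_mul, mul_comm j m, pow_mul]
    have h3 : 1 - (1 - 1 / 16) * M.pe ≤ Real.exp (-(15 / 16 * M.pe)) := by
      have := Real.add_one_le_exp (-(15 / 16 * M.pe))
      linarith
    refine pow_le_pow_left₀ (pow_nonneg (by linarith) _) (le_trans ?_ hκ₀) _
    rw [← mul_neg, Real.exp_nat_mul]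
    exact pow_le_pow_left₀ (by linarith) h3 _
  have h3 : κ₀ ^ j * κ₀ ^ #B ≤ u ^ (85 * m) := by
    rw [← pow_add]
    exact (pow_le_pow_of_le_one hκ0 hκ1 (by omega)).trans hκ
  have h5 : 2 ≤ u⁻¹ := by rw [← one_div, le_div_iff₀ hu0]; linarith
  have hδ0 : 0 ≤ δ := le_trans (iidExp_nonneg M.isProbWeight fun T => by split_ifs <;> simp) hH
  have hu1 : u ≤ 1 := by linarith
  calc _ ≤ κ₀ ^ j * (2 ^ m * (M.pe ^ m * κ₀ ^ #B + δ)) := by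
        refine mul_le_mul h2 h1 (iidExp_nonneg M.isProbWeight fun S => ?_) (by positivity)
        exact pow_nonneg (M.tilt_nonneg (by norm_num) _ _ _) _
    _ = 2 ^ m * (M.pe ^ m * (κ₀ ^ j * κ₀ ^ #B) + κ₀ ^ j * δ) := by ring
    _ ≤ (u⁻¹) ^ m * ((u ^ 99) ^ m * u ^ (85 * m) + 1 * u ^ (250 * m)) := by
        have : κ₀ ^ j ≤ 1 := pow_le_one₀ hκ0 hκ1
        gcongr
    _ ≤ (u⁻¹) ^ m * (u ^ (184 * m) + u ^ (184 * m)) := by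
        rw [one_mul, ← pow_mul, ← pow_add, ← add_mul]
        gcongr ?_ * (?_ + ?_)
        · exact le_rfl
        · exact pow_le_pow_of_le_one hu0.le hu1 (by omega)
    _ = (u⁻¹) ^ m * (2 * u ^ (184 * m)) := by ring
    _ ≤ (u⁻¹) ^ m * (u⁻¹ * u ^ (184 * m)) := by gcongr
    _ ≤ u ^ (7 * m) * (u ^ 175) ^ (m - 1) := by
        obtain ⟨k, rfl⟩ := Nat.exists_eq_add_of_le hm
        rw [← pow_mul, ← pow_add]
        calc _ = u ^ (183 * k + 18299) := by
              rw [show 184 * (100 + k) = 18400 + 184 * k by ring, inv_pow, ← mul_assoc,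
                ← mul_inv, ← pow_succ, inv_mul_eq_div, div_eq_iff (by positivity), ← pow_add]
              congr 1
              omega
          _ ≤ _ := pow_le_pow_of_le_one hu0.le hu1 (by omega)

lemma abs_deriv_sub_le [Nonempty R] {u : ℝ} (hu0 : 0 < u) (hu2 : u ≤ 1 / 2)
    (hn : Fintype.card V * u ^ 100 = 1) (hpe : M.pe ≤ u ^ 99) {m h : ℕ} (hm : 100 ≤ m)
    (hmu : m * u ≤ 1) (hh : 16 ^ (h + 1) * u ≤ 1) {κ₀ δ : ℝ}
    (hκ₀ : Real.exp (-(m * (15 / 16 * M.pe))) ≤ κ₀) (hκ1 : κ₀ ≤ 1)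
    (hH : iidExp M.w (fun T : Fin m → R => if κ₀ < M.joint (1 / 16) T then 1 else 0) ≤ δ)
    (hδ : δ ≤ u ^ (250 * m)) (hκ : κ₀ ^ (Fintype.card V - 2 - m) ≤ u ^ (85 * m))
    (hμ : Fintype.card V * M.binProb h (Fintype.card V - 1) 0 * u ≤ 1) {c t : ℝ}
    (hc : Fintype.card V * M.pe ≤ c) (ht : 0 < t) (ht1 : t ≤ 1)
    (hT : t⁻¹ ^ h * 16 ^ h * u ≤ 1) (hD : 2 * (t⁻¹ + h + 1 + c) * u ≤ 1) :
    |M.exp (fun ω : (V → R) × (Sym2 V → Bool) => M.cnt h ω univ * t ^ (M.cnt h ω univ - 1)) -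
      Fintype.card V * M.binProb h (Fintype.card V - 1) 0 *
        M.exp (fun ω : (V → R) × (Sym2 V → Bool) => t ^ M.cnt h ω univ)| ≤
      u ^ 20 * (M.exp (fun ω : (V → R) × (Sym2 V → Bool) => t ^ M.cnt h ω univ) + u ^ m) := by
  have hpe0 := M.pe_nonneg
  have hκ0 : 0 ≤ κ₀ := (Real.exp_pos _).le.trans hκ₀
  have hu1 : u ≤ 1 := by linarith
  obtain ⟨a, ha1, ha2⟩ : ∃ a : ℕ, 1 ≤ a * u ^ 50 ∧ a * u ^ 51 ≤ 1 := by
    refine ⟨⌈(u ^ 50)⁻¹⌉₊, ?_, ?_⟩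
    · rw [← div_le_iff₀ (by positivity), one_div]
      exact Nat.le_ceil _
    · have h1 := (Nat.ceil_lt_add_one (by positivity : 0 ≤ (u ^ 50)⁻¹)).le
      have h2 : u ^ 51 ≤ u := by
        simpa using pow_le_pow_of_le_one hu0.le hu1 (by norm_num : 1 ≤ 51)
      calc _ ≤ ((u ^ 50)⁻¹ + 1) * u ^ 51 := by gcongr
        _ = u + u ^ 51 := by field_simp
        _ ≤ _ := by linarith
  have ha' : (a : ℝ) ≤ (u ^ 51)⁻¹ := by rwa [← one_div, le_div_iff₀ (by positivity)]
  have ha0 : (1 : ℝ) ≤ a := by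
    refine ha1.trans (mul_le_of_le_one_right (Nat.cast_nonneg _) (pow_le_one₀ hu0.le hu1))
  have hti : 0 < t⁻¹ := inv_pos.2 ht
  have hti1 : 1 ≤ t⁻¹ := (one_le_inv₀ ht).2 ht1
  have hc0 : 0 ≤ c := le_trans (by positivity) hc
  have hh0 : (0 : ℝ) ≤ h := Nat.cast_nonneg h
  refine (M.abs_exp_cnt_mul_pow_sub_le (by norm_num : (0 : ℝ) < 1 / 16) (by norm_num)
    (β := u ^ 175) (ξ := u ^ (7 * m)) (a := a) (b := u ^ (2 * m)) (by positivity) (by positivity)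
    ht ht1 (by omega : 1 ≤ m) (by positivity) (by positivity)
    (fun A hA => M.exp_low_le hu0 hu2 hn hm hmu ha1 hh hκ0 hκ1 hH
      (hδ.trans (pow_le_pow_of_le_one hu0.le hu1 (by omega))) hκ ht ht1 hA) ?_ hc
    (fun B v j hv hj =>
      M.pow_mul_iidExp_tilt_pow_le hu0 hu2 hpe hm hκ₀ hκ1 hH hδ hκ hv hj)).trans ?_
  · calc M.pe * a ≤ u ^ 99 * (u ^ 51)⁻¹ := by gcongr
      _ = u ^ 48 := by field_simp
      _ ≤ u ^ 1 := pow_le_pow_of_le_one hu0.le hu1 (by norm_num)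
      _ ≤ _ := by rwa [pow_one]
  · have hT' : t⁻¹ ^ h * (1 / 16)⁻¹ ^ h * u ≤ 1 := by rwa [one_div, inv_inv]
    exact error_le hu0 hu2 hn ha0 ha2 (by linarith) hD (by positivity) hT'
      (M.binProb_nonneg _ _ _) hμ (by positivity) (M.exp_nonneg fun ω => by positivity) hm le_rfl

lemma abs_exp_pow_cnt_mul_exp_sub_le [Nonempty R] {u : ℝ} (hu0 : 0 < u) (hu2 : u ≤ 1 / 2)
    (hn : Fintype.card V * u ^ 100 = 1) (hpe : M.pe ≤ u ^ 99) {m h : ℕ} (hm : 100 ≤ m)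
    (hmu : m * u ≤ 1) (hh : 16 ^ (h + 1) * u ≤ 1) {κ₀ δ : ℝ}
    (hκ₀ : Real.exp (-(m * (15 / 16 * M.pe))) ≤ κ₀) (hκ1 : κ₀ ≤ 1)
    (hH : iidExp M.w (fun T : Fin m → R => if κ₀ < M.joint (1 / 16) T then 1 else 0) ≤ δ)
    (hδ : δ ≤ u ^ (250 * m)) (hκ : κ₀ ^ (Fintype.card V - 2 - m) ≤ u ^ (85 * m)) {μ : ℝ}
    (hμ : μ = Fintype.card V * M.binProb h (Fintype.card V - 1) 0) (hμu : μ * u ≤ 1)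
    (hμm : u ^ m * Real.exp μ ≤ 1) {c t₀ t : ℝ} (hc : Fintype.card V * M.pe ≤ c) (ht₀ : 0 < t₀)
    (hT : t₀⁻¹ ^ h * 16 ^ h * u ≤ 1) (hD : 2 * (t₀⁻¹ + h + 1 + c) * u ≤ 1)
    (ht : t ∈ Set.Icc t₀ 1) :
    |M.exp (fun ω : (V → R) × (Sym2 V → Bool) => t ^ M.cnt h ω univ) * Real.exp μ -
      Real.exp (μ * t)| ≤ u ^ 18 * Real.exp (μ * t) := by
  have hu1 : u ≤ 1 := by linarith
  have hμ0 : 0 ≤ μ := by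
    rw [hμ]
    exact mul_nonneg (Nat.cast_nonneg _) (M.binProb_nonneg _ _ _)
  have h1 := abs_mul_exp_sub_one_le ht₀.le hμ0 (by positivity : 0 ≤ u ^ 20)
    (by positivity : 0 ≤ u ^ m) (M.hasDerivAt_exp_pow_cnt (V := V) h) (by simp [exp_const])
    (fun s hs => by
      have hs0 : 0 < s := ht₀.trans_le hs.1
      have hsi : s⁻¹ ≤ t₀⁻¹ := inv_anti₀ ht₀ hs.1
      rw [hμ]
      refine M.abs_deriv_sub_le hu0 hu2 hn hpe hm hmu hh hκ₀ hκ1 hH hδ hκ (by rwa [← hμ]) hc hs0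
        hs.2 (le_trans ?_ hT) (le_trans ?_ hD)
      · gcongr
      · gcongr) ht
  have h2 : Real.exp (u ^ 20) - 1 ≤ 2 * u ^ 20 := by
    have h3 : u ^ 20 ≤ 1 := pow_le_one₀ hu0.le hu1
    have := Real.abs_exp_sub_one_le (x := u ^ 20) (by rwa [abs_of_nonneg (by positivity)])
    rw [abs_of_nonneg (by positivity : 0 ≤ u ^ 20)] at this
    exact (le_abs_self _).trans this
  have h4 : (1 + u ^ m * Real.exp μ) * (Real.exp (u ^ 20) - 1) ≤ u ^ 18 := by
    have h5 : 0 ≤ Real.exp (u ^ 20) - 1 := by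
      have := Real.add_one_le_exp (u ^ 20)
      have : 0 < u ^ 20 := by positivity
      linarith
    calc _ ≤ (1 + 1) * (2 * u ^ 20) := by gcongr
      _ = (2 * u) * (2 * u) * u ^ 18 := by ring
      _ ≤ 1 * 1 * u ^ 18 := by gcongr <;> linarith
      _ = _ := by ring
  have h6 : M.exp (fun ω : (V → R) × (Sym2 V → Bool) => t ^ M.cnt h ω univ) * Real.exp μ -
      Real.exp (μ * t) = (M.exp (fun ω : (V → R) × (Sym2 V → Bool) => t ^ M.cnt h ω univ) *
        Real.exp (μ * (1 - t)) - 1) * Real.exp (μ * t) := by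
    rw [sub_mul, one_mul, mul_assoc, ← Real.exp_add]
    ring_nf
  rw [h6, abs_mul, Real.abs_exp]
  gcongr
  exact h1.trans h4

end RingModel

lemma tendsto_log_natCast : Tendsto (fun n : ℕ => Real.log n) atTop atTop :=
  Real.tendsto_log_atTop.comp tendsto_natCast_atTop_atTop

lemma eventually_mul_log_pow_mul_exp_le (c : ℝ) (k : ℕ) :
    ∀ᶠ n : ℕ in atTop, c * Real.log n ^ k * Real.exp (-(Real.log n / 100)) ≤ 1 := by
  have h1 := ((Real.tendsto_pow_mul_exp_neg_atTop_nhds_zero k).comp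
    (tendsto_log_natCast.atTop_div_const (by norm_num : (0 : ℝ) < 100))).const_mul (c * 100 ^ k)
  rw [mul_zero] at h1
  filter_upwards [h1.eventually_le_const one_pos] with n hn
  refine le_trans (le_of_eq ?_) hn
  simp only [Function.comp_apply, div_pow]
  field_simp

lemma natCast_mul_exp_pow {n : ℕ} (hn : 1 ≤ n) :
    (n : ℝ) * Real.exp (-(Real.log n / 100)) ^ 100 = 1 := by
  have h0 : (0 : ℝ) < n := by exact_mod_cast hn
  rw [← Real.exp_nat_mul, show ((100 : ℕ) : ℝ) * -(Real.log n / 100) = -Real.log n by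
    push_cast; ring, Real.exp_neg, Real.exp_log h0, mul_inv_cancel₀ h0.ne']

section PoissonMean

variable {n h : ℕ} {π : ℝ}

lemma binomial_mean_le (hn : h + 1 ≤ n) (h0 : 0 ≤ π) (h1 : π ≤ 1) :
    n * ((n - 1).choose h * π ^ h * (1 - π) ^ (n - 1 - h)) ≤
      n * (h.factorial : ℝ)⁻¹ * (n * π) ^ h * Real.exp (-(n * π)) * Real.exp ((1 + h) * π) := by
  have hf : (0 : ℝ) < h.factorial := by exact_mod_cast h.factorial_pos
  have e1 : ((n - 1).choose h : ℝ) ≤ (h.factorial : ℝ)⁻¹ * n ^ h := by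
    refine (Nat.choose_le_pow_div h (n - 1)).trans ?_
    rw [div_eq_inv_mul]
    have : ((n - 1 : ℕ) : ℝ) ≤ n := by exact_mod_cast Nat.sub_le n 1
    gcongr
  have e2 : (1 - π) ^ (n - 1 - h) ≤ Real.exp (-(n * π)) * Real.exp ((1 + h) * π) := by
    have e3 : 1 - π ≤ Real.exp (-π) := by
      have := Real.add_one_le_exp (-π)
      linarith
    refine (pow_le_pow_left₀ (by linarith) e3 _).trans_eq ?_
    rw [← Real.exp_nat_mul, ← Real.exp_add, Nat.sub_sub, Nat.cast_sub (by omega)]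
    push_cast
    ring_nf
  have e4 : 0 ≤ 1 - π := by linarith
  calc _ ≤ n * ((h.factorial : ℝ)⁻¹ * n ^ h * π ^ h *
        (Real.exp (-(n * π)) * Real.exp ((1 + h) * π))) := by gcongr
    _ = _ := by rw [mul_pow]; ring

lemma le_binomial_mean (hn : h + 1 ≤ n) (h0 : 0 ≤ π) (h1 : π ≤ 1) (hh : h ^ 2 ≤ (n : ℝ))
    (hπ : n * π ^ 2 ≤ 1) :
    n * (h.factorial : ℝ)⁻¹ * (n * π) ^ h * Real.exp (-(n * π)) *
        (1 - h ^ 2 / n - n * π ^ 2) ≤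
      n * ((n - 1).choose h * π ^ h * (1 - π) ^ (n - 1 - h)) := by
  have hn0 : (0 : ℝ) < n := by exact_mod_cast (by omega : 0 < n)
  have hf : (0 : ℝ) < h.factorial := by exact_mod_cast h.factorial_pos
  have hhn : (h : ℝ) / n ≤ 1 := by
    rw [div_le_one hn0]
    exact_mod_cast (by omega : h ≤ n)
  have e1 : (h.factorial : ℝ)⁻¹ * n ^ h * (1 - h ^ 2 / n) ≤ (n - 1).choose h := by
    have e2 := Nat.pow_sub_le_descFactorial (n - 1) h
    rw [Nat.descFactorial_eq_factorial_mul_choose, show n - 1 + 1 - h = n - h by omega] at e2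
    have e3 : ((n : ℝ) - h) ^ h ≤ h.factorial * (n - 1).choose h := by
      rw [← Nat.cast_sub (by omega)]
      exact_mod_cast e2
    have e4 : 1 - (h : ℝ) ^ 2 / n ≤ (1 - h / n) ^ h := by
      have := one_add_mul_le_pow (a := -((h : ℝ) / n)) (by linarith) h
      refine le_trans (le_of_eq ?_) (this.trans_eq (by rw [← sub_eq_add_neg]))
      ring
    rw [mul_assoc, inv_mul_le_iff₀ hf]
    calc _ ≤ (n : ℝ) ^ h * (1 - h / n) ^ h := by gcongr
      _ = (n - h) ^ h := by rw [← mul_pow, mul_sub, mul_div_cancel₀ _ hn0.ne', mul_one]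
      _ ≤ _ := e3
  have e5 : Real.exp (-(n * π)) * (1 - n * π ^ 2) ≤ (1 - π) ^ (n - 1 - h) := by
    have e6 : 1 - n * π ^ 2 ≤ (1 - π ^ 2) ^ n := by
      have := one_add_mul_le_pow (a := -(π ^ 2)) (by nlinarith) n
      refine le_trans (le_of_eq ?_) (this.trans_eq (by rw [← sub_eq_add_neg]))
      ring
    have e7 : (1 - π ^ 2) ^ n ≤ (1 - π) ^ n * Real.exp (n * π) := by
      rw [Real.exp_nat_mul, ← mul_pow]
      refine pow_le_pow_left₀ (by nlinarith) ?_ _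
      have := Real.add_one_le_exp π
      calc 1 - π ^ 2 = (1 - π) * (π + 1) := by ring
        _ ≤ _ := mul_le_mul_of_nonneg_left this (by linarith)
    calc _ ≤ Real.exp (-(n * π)) * ((1 - π) ^ n * Real.exp (n * π)) := by
          gcongr
          exact e6.trans e7
      _ = (1 - π) ^ n := by
          rw [mul_left_comm, ← Real.exp_add, neg_add_cancel, Real.exp_zero, mul_one]
      _ ≤ _ := pow_le_pow_of_le_one (by linarith) (by linarith) (by omega)
  have e8 : (h : ℝ) ^ 2 / n ≤ 1 := by rwa [div_le_one hn0]
  have e9 : 0 ≤ (h : ℝ) ^ 2 / n := by positivity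
  have e10 : 0 ≤ n * π ^ 2 := by positivity
  have e11 : 0 ≤ 1 - (h : ℝ) ^ 2 / n := by linarith
  have e12 : 0 ≤ 1 - n * π ^ 2 := by linarith
  calc _ ≤ n * (h.factorial : ℝ)⁻¹ * (n * π) ^ h * Real.exp (-(n * π)) *
        ((1 - h ^ 2 / n) * (1 - n * π ^ 2)) := by
        gcongr
        nlinarith
    _ = n * ((h.factorial : ℝ)⁻¹ * n ^ h * (1 - h ^ 2 / n) * π ^ h *
        (Real.exp (-(n * π)) * (1 - n * π ^ 2))) := by rw [mul_pow]; ring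
    _ ≤ _ := by gcongr

end PoissonMean

section Threshold

variable {π : ℕ → ℝ} {C : ℕ}

lemma exists_eventually_abs_sub_le_mul_log (hb : ∃ C : ℝ, ∀ᶠ n : ℕ in atTop,
      |((n : ℝ) * π n - Real.log n) / Real.log (Real.log n)| ≤ C) :
    ∃ C : ℕ, ∀ᶠ n : ℕ in atTop, |n * π n - Real.log n| ≤ C * Real.log (Real.log n) := by
  obtain ⟨C, hC⟩ := hb
  refine ⟨⌈C⌉₊, ?_⟩
  filter_upwards [hC, (Real.tendsto_log_atTop.comp tendsto_log_natCast).eventually_gt_atTop 0]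
    with n h1 h2
  simp only [Function.comp_apply] at h2
  rw [abs_div, abs_of_pos h2, div_le_iff₀ h2] at h1
  exact h1.trans (by gcongr; exact Nat.le_ceil C)

lemma eventually_mem_Icc_log (hC : ∀ᶠ n : ℕ in atTop,
      |n * π n - Real.log n| ≤ C * Real.log (Real.log n)) :
    ∀ᶠ n : ℕ in atTop, n * π n ∈ Set.Icc (99 / 100 * Real.log n) (2 * Real.log n) := by
  have h1 : ∀ᶠ x : ℝ in atTop, C * Real.log x ≤ x / 100 := by
    have h2 := Real.isLittleO_log_id_atTop.def (by positivity : (0 : ℝ) < 1 / (100 * (C + 1)))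
    filter_upwards [h2, eventually_ge_atTop 1] with x hx hx1
    rw [Real.norm_of_nonneg (Real.log_nonneg hx1), id, Real.norm_of_nonneg (by linarith)] at hx
    have h3 := Real.log_nonneg hx1
    rw [div_mul_eq_mul_div, le_div_iff₀ (by positivity)] at hx
    nlinarith
  filter_upwards [hC, tendsto_log_natCast.eventually h1, tendsto_log_natCast.eventually_ge_atTop 1]
    with n h2 h3 h4
  have h5 := abs_le.1 (h2.trans h3)
  constructor <;> linarith [h5.1, h5.2]

lemma eventually_mean_mem_Icc (hC : ∀ᶠ n : ℕ in atTop,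
      |n * π n - Real.log n| ≤ C * Real.log (Real.log n)) (h : ℕ) :
    ∀ᶠ n : ℕ in atTop,
      2 * (Real.log n)⁻¹ ^ (h + C + 2) ≤
        n * (h.factorial : ℝ)⁻¹ * (n * π n) ^ h * Real.exp (-(n * π n)) ∧
      2 * (n * (h.factorial : ℝ)⁻¹ * (n * π n) ^ h * Real.exp (-(n * π n))) ≤
        Real.log n ^ (h + C + 2) := by
  have hf : (0 : ℝ) < h.factorial := by exact_mod_cast h.factorial_pos
  have hf1 : (1 : ℝ) ≤ h.factorial := by exact_mod_cast h.factorial_pos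
  filter_upwards [hC, eventually_mem_Icc_log hC,
    tendsto_log_natCast.eventually_ge_atTop (2 * h.factorial),
    tendsto_log_natCast.eventually_ge_atTop (2 * 2 ^ h), eventually_ge_atTop 1] with
    n h1 h2 h3 h4 h5
  have hn : (0 : ℝ) < n := by exact_mod_cast h5
  set L := Real.log n with hL
  have hL2 : 2 ≤ L := by linarith
  have hL0 : 0 < L := by linarith
  have h6 : n * Real.exp (-(n * π n)) = Real.exp (L - n * π n) := by
    rw [sub_eq_add_neg, Real.exp_add, Real.exp_log hn]
  have h7 := abs_le.1 h1
  have h8 : Real.exp (C * Real.log L) = L ^ C := by rw [Real.exp_nat_mul, Real.exp_log hL0]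
  have h9 : Real.exp (L - n * π n) ≤ L ^ C := by
    rw [← h8]
    exact Real.exp_le_exp.2 (by linarith [h7.1])
  have h10 : L⁻¹ ^ C ≤ Real.exp (L - n * π n) := by
    rw [inv_pow, ← h8, ← Real.exp_neg]
    exact Real.exp_le_exp.2 (by linarith [h7.2])
  have h11 : n * (h.factorial : ℝ)⁻¹ * (n * π n) ^ h * Real.exp (-(n * π n)) =
      (h.factorial : ℝ)⁻¹ * (n * π n) ^ h * Real.exp (L - n * π n) := by
    rw [← h6]
    ring
  rw [h11]
  have h12 : 1 ≤ n * π n := by linarith [h2.1]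
  have hLi : L⁻¹ ≤ 1 := inv_le_one_of_one_le₀ (by linarith)
  have hLi0 : 0 < L⁻¹ := inv_pos.2 hL0
  constructor
  · calc 2 * L⁻¹ ^ (h + C + 2) ≤ 2 * L⁻¹ ^ (C + 1) := by
          gcongr ?_ * ?_
          exact pow_le_pow_of_le_one hLi0.le hLi (by omega)
      _ = 2 * L⁻¹ * 1 * L⁻¹ ^ C := by ring
      _ ≤ (h.factorial : ℝ)⁻¹ * (n * π n) ^ h * Real.exp (L - n * π n) := by
          have h13 : 2 * L⁻¹ ≤ (h.factorial : ℝ)⁻¹ := by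
            rw [← div_eq_mul_inv, div_le_iff₀ hL0, inv_mul_eq_div, le_div_iff₀ hf]
            exact h3
          have h14 : 1 ≤ (n * π n) ^ h := one_le_pow₀ h12
          gcongr
  · calc _ ≤ 2 * (1 * (2 * L) ^ h * L ^ C) := by
          have h13 : (h.factorial : ℝ)⁻¹ ≤ 1 := inv_le_one_of_one_le₀ hf1
          have h14 := h2.2
          gcongr
      _ = 2 * 2 ^ h * 1 * L ^ (h + C) := by ring
      _ ≤ L * L * L ^ (h + C) := by gcongr; linarith
      _ = _ := by ring

end Threshold

lemma eventually_mul_choose_le_choose_sub {K P : ℕ → ℕ} (q : ℕ)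
    (hK : Tendsto (fun n => (K n : ℝ)) atTop atTop)
    (hKP : Tendsto (fun n => (K n : ℝ) ^ 2 / (P n : ℝ)) atTop (nhds 0)) (r : ℕ) {δ : ℝ}
    (hδ : 0 < δ) :
    ∀ᶠ n in atTop, (1 - δ + (K n : ℝ) ^ 2 / P n) * (K n).choose q ≤ (K n - r).choose q := by
  filter_upwards [hKP.eventually_le_const (half_pos hδ),
    hK.eventually_ge_atTop (q * (r + q) / (δ / 2)), hK.eventually_ge_atTop (r + q + 1 : ℕ)]
    with n h1 h2 h3
  have hf : (0 : ℝ) < q.factorial := by exact_mod_cast q.factorial_pos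
  have hKrq : r + q + 1 ≤ K n := by exact_mod_cast h3
  have hK0 : (0 : ℝ) < K n := by exact_mod_cast (by omega : 0 < K n)
  have h4 : (q : ℝ) * ((r + q) / K n) ≤ δ / 2 := by
    rw [div_le_iff₀ (half_pos hδ)] at h2
    rw [← mul_div_assoc, div_le_iff₀ hK0]
    linarith
  have h5 : ((r : ℝ) + q) / K n ≤ 1 := by
    rw [div_le_one hK0]
    exact_mod_cast (by omega : r + q ≤ K n)
  have h6 : (q.factorial : ℝ) * (K n).choose q ≤ K n ^ q := by
    rw [mul_comm, ← le_div_iff₀ hf]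
    exact Nat.choose_le_pow_div q (K n)
  have h7 : ((K n : ℝ) - (r + q)) ^ q ≤ q.factorial * (K n - r).choose q := by
    have h8 := Nat.pow_sub_le_descFactorial (K n - r) q
    rw [Nat.descFactorial_eq_factorial_mul_choose] at h8
    calc ((K n : ℝ) - (r + q)) ^ q = ((K n - (r + q) : ℕ) : ℝ) ^ q := by
          rw [Nat.cast_sub (by omega)]
          push_cast
          rfl
      _ ≤ ((K n - r + 1 - q : ℕ) : ℝ) ^ q :=
          pow_le_pow_left₀ (Nat.cast_nonneg _) (by exact_mod_cast (by omega)) q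
      _ ≤ _ := by exact_mod_cast h8
  have h9 : 1 - δ / 2 ≤ (1 - (r + q) / (K n : ℝ)) ^ q := by
    have := one_add_mul_le_pow (a := -((r + q) / (K n : ℝ))) (by linarith) q
    rw [← sub_eq_add_neg] at this
    linarith
  refine le_of_mul_le_mul_left ?_ hf
  calc (q.factorial : ℝ) * ((1 - δ + (K n : ℝ) ^ 2 / P n) * (K n).choose q)
      ≤ q.factorial * ((1 - δ / 2) * (K n).choose q) := by
        gcongr
        linarith
    _ ≤ q.factorial * ((1 - (r + q) / (K n : ℝ)) ^ q * (K n).choose q) := by gcongr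
    _ = (1 - (r + q) / (K n : ℝ)) ^ q * (q.factorial * (K n).choose q) := by ring
    _ ≤ (1 - (r + q) / (K n : ℝ)) ^ q * K n ^ q := by
        gcongr
    _ = ((K n : ℝ) - (r + q)) ^ q := by
        rw [← mul_pow, sub_mul, one_mul, div_mul_cancel₀ _ hK0.ne']
    _ ≤ _ := h7

lemma exp_pow_sub_le {L x : ℝ} {n m : ℕ} (hL : 100 ≤ L) (hx : 0 ≤ x) (hn : 99 / 100 * L ≤ n * x)
    (hm : (100 : ℝ) ≤ m) (hmx : m * x ≤ 1) :
    Real.exp (-((1 - 3 * ((48 : ℕ) : ℝ)⁻¹) * (m * ((1 - 1 / 16) * x)))) ^ (n - 2 - m) ≤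
      Real.exp (-(L / 100)) ^ (85 * m) := by
  rw [← Real.exp_nat_mul, ← Real.exp_nat_mul]
  refine Real.exp_le_exp.2 ?_
  have h1 : (n : ℝ) - 2 - m ≤ (n - 2 - m : ℕ) := by
    have : n ≤ (n - 2 - m) + 2 + m := by omega
    have : (n : ℝ) ≤ (n - 2 - m : ℕ) + 2 + m := by exact_mod_cast this
    linarith
  have h2 : 99 / 100 * L - 2 ≤ (n - 2 - m : ℕ) * x := by
    have h4 := mul_le_mul_of_nonneg_right h1 hx
    nlinarith
  have h3 : 85 * L / 100 ≤ 225 / 256 * ((n - 2 - m : ℕ) * x) := by linarith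
  have h4 := mul_le_mul_of_nonneg_left h3 (by positivity : (0 : ℝ) ≤ m)
  push_cast
  linarith

set_option maxHeartbeats 800000 in
/-- The generating function of the number of vertices of degree `h` is close to that of a Poisson
variable with the same mean. -/
lemma eventually_abs_exp_pow_cnt_sub_le (q h : ℕ) {K P : ℕ → ℕ} {p : ℕ → ℝ}
    (hKP : ∀ n, K n ≤ P n) (hp : ∀ n, p n ∈ Set.Ioc (0 : ℝ) 1)
    (hK : Tendsto (fun n => (K n : ℝ)) atTop atTop)
    (hKsqP : Tendsto (fun n => (K n : ℝ) ^ 2 / (P n : ℝ)) atTop (nhds 0))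
    (hπ : ∀ᶠ n : ℕ in atTop, (n : ℝ) * (keyModel q (hKP n) (hp n)).pe ∈
      Set.Icc (99 / 100 * Real.log n) (2 * Real.log n)) {c : ℕ}
    (hμ : ∀ᶠ n : ℕ in atTop,
      (n : ℝ) * (keyModel q (hKP n) (hp n)).binProb h (n - 1) 0 ≤ Real.log n ^ c) (A r : ℕ) :
    ∀ᶠ n : ℕ in atTop, ∀ t ∈ Set.Icc ((Real.log n)⁻¹ ^ A) 1,
      |(keyModel q (hKP n) (hp n)).exp
          (fun ω : (Fin n → KeyRing (P n) (K n)) × (Sym2 (Fin n) → Bool) =>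
            t ^ (keyModel q (hKP n) (hp n)).cnt h ω univ) *
          Real.exp (n * (keyModel q (hKP n) (hp n)).binProb h (n - 1) 0) -
        Real.exp (n * (keyModel q (hKP n) (hp n)).binProb h (n - 1) 0 * t)| ≤
      (Real.log n)⁻¹ ^ r *
        Real.exp (n * (keyModel q (hKP n) (hp n)).binProb h (n - 1) 0 * t) := by
  filter_upwards [hπ, hμ, eventually_mul_choose_le_choose_sub q hK hKsqP (3 * 48 * q)
      (by norm_num : (0 : ℝ) < ((48 : ℕ) : ℝ)⁻¹),
    hK.eventually_ge_atTop (2 * q + 1 : ℕ), tendsto_log_natCast.eventually_ge_atTop 100,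
    eventually_ge_atTop 1, eventually_mul_log_pow_mul_exp_le 2 1,
    eventually_mul_log_pow_mul_exp_le (16 ^ (h + 1)) 0,
    eventually_mul_log_pow_mul_exp_le 2 (c + 1),
    eventually_mul_log_pow_mul_exp_le (96 * (4 ^ q * (2 * (4 ^ q * q.factorial)) ^ 2)) (c + 1),
    eventually_mul_log_pow_mul_exp_le (48 * (2 * (4 ^ q * q.factorial)) * 2 ^ (q + 1))
      ((c + 1) * (q + 1)),
    eventually_mul_log_pow_mul_exp_le (16 ^ h) (A * h),
    eventually_mul_log_pow_mul_exp_le (2 * (1 + h + 1 + 2)) (A + 1),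
    eventually_mul_log_pow_mul_exp_le 1 r] with
    n hπ hμ hchoose hqK hL hn e1 e2 e3 e4 e5 e6 e7 e8 t ht
  have := nonempty_keyRing (hKP n)
  set M := keyModel q (hKP n) (hp n) with hM
  set L := Real.log n with hLdef
  set u := Real.exp (-(L / 100)) with hu
  have hL0 : 0 < L := by linarith
  have hL1 : 1 ≤ L := by linarith
  have hu0 : 0 < u := Real.exp_pos _
  have hnu : (n : ℝ) * u ^ 100 = 1 := natCast_mul_exp_pow hn
  have hu2 : u ≤ 1 / 2 := by nlinarith
  have hu1 : u ≤ 1 := by linarith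
  have hpe0 : 0 ≤ M.pe := M.pe_nonneg
  have hpe : M.pe ≤ u ^ 99 := by
    calc M.pe = n * M.pe * u * u ^ 99 := by linear_combination -M.pe * hnu
      _ ≤ 1 * u ^ 99 := by
        gcongr
        rw [pow_one] at e1
        exact (mul_le_mul_of_nonneg_right hπ.2 hu0.le).trans e1
      _ = u ^ 99 := one_mul _
  have hpu : M.pe ≤ u := hpe.trans (pow_le_of_le_one hu0.le hu1 (by norm_num))
  obtain ⟨m, hm⟩ : ∃ m, m = ⌈L ^ (c + 1)⌉₊ := ⟨_, rfl⟩
  have hLc : 1 ≤ L ^ (c + 1) := one_le_pow₀ hL1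
  have hmL : L ^ (c + 1) ≤ m := hm ▸ Nat.le_ceil _
  have hmL2 : (m : ℝ) ≤ 2 * L ^ (c + 1) := by
    have := Nat.ceil_lt_add_one (by positivity : 0 ≤ L ^ (c + 1))
    rw [← hm] at this
    linarith
  have hm100 : 100 ≤ m := by
    have : (100 : ℝ) ≤ m := by
      calc (100 : ℝ) ≤ L := hL
        _ = 1 * L := (one_mul L).symm
        _ ≤ L ^ c * L := by gcongr; exact one_le_pow₀ hL1
        _ = L ^ (c + 1) := (pow_succ L c).symm
        _ ≤ m := hmL
    exact_mod_cast this
  have hm0 : (100 : ℝ) ≤ m := by exact_mod_cast hm100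
  have hmu : m * u ≤ 1 := (mul_le_mul_of_nonneg_right hmL2 hu0.le).trans e3
  have hD0 : (0 : ℝ) < 2 * (4 ^ q * q.factorial) := by
    have : (0 : ℝ) < q.factorial := by exact_mod_cast q.factorial_pos
    positivity
  have hm1 : m * M.pe * (4 ^ q * (2 * (4 ^ q * q.factorial)) ^ 2) ≤ ((48 : ℕ) : ℝ)⁻¹ := by
    calc _ ≤ 2 * L ^ (c + 1) * u * (4 ^ q * (2 * (4 ^ q * q.factorial)) ^ 2) := by gcongr
      _ = (96 * (4 ^ q * (2 * (4 ^ q * q.factorial)) ^ 2) * L ^ (c + 1) * u) / 48 := by ring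
      _ ≤ 1 / 48 := by gcongr
      _ = _ := by norm_num
  have hy : ((48 : ℕ) : ℝ) * (2 * (4 ^ q * q.factorial)) * m ^ (q + 1) * M.pe ≤ u ^ 98 := by
    calc _ ≤ ((48 : ℕ) : ℝ) * (2 * (4 ^ q * q.factorial)) * (2 * L ^ (c + 1)) ^ (q + 1) *
          u ^ 99 := by
          gcongr
      _ = 48 * (2 * (4 ^ q * q.factorial)) * 2 ^ (q + 1) * L ^ ((c + 1) * (q + 1)) * u *
          u ^ 98 := by
          push_cast
          rw [mul_pow, ← pow_mul]
          ring
      _ ≤ 1 * u ^ 98 := by gcongr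
      _ = u ^ 98 := one_mul _
  have hH := iidExp_joint_tail_le (hKP n) (hp n) (by exact_mod_cast hqK) (N := 48) (m := m)
    (by norm_num) (y := u ^ 98) (z := 1 / 16) (by norm_num) (by norm_num) hchoose hm1 hy
    (by positivity) (pow_le_one₀ hu0.le hu1)
  have hpeq : p n * psq q (K n) (P n) = M.pe := rfl
  rw [hpeq, ← hM] at hH
  have hδ : (2 * (u ^ 98) ^ 3) ^ m ≤ u ^ (250 * m) := by
    rw [pow_mul]
    gcongr
    calc 2 * (u ^ 98) ^ 3 = (2 * u) * u ^ 43 * u ^ 250 := by ring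
      _ ≤ 1 * 1 * u ^ 250 := by
          gcongr
          · linarith
          · exact pow_le_one₀ hu0.le hu1
      _ = u ^ 250 := by ring
  have hκ₀ : Real.exp (-(m * (15 / 16 * M.pe))) ≤
      Real.exp (-((1 - 3 * ((48 : ℕ) : ℝ)⁻¹) * (m * ((1 - 1 / 16) * M.pe)))) := by
    refine Real.exp_le_exp.2 (neg_le_neg ?_)
    have : 0 ≤ m * M.pe := by positivity
    norm_num
    linarith
  have hκ1 : Real.exp (-((1 - 3 * ((48 : ℕ) : ℝ)⁻¹) * (m * ((1 - 1 / 16) * M.pe)))) ≤ 1 := by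
    refine Real.exp_le_one_iff.2 (neg_nonpos.2 ?_)
    have : 0 ≤ m * M.pe := by positivity
    norm_num
    linarith
  have hκ : Real.exp (-((1 - 3 * ((48 : ℕ) : ℝ)⁻¹) * (m * ((1 - 1 / 16) * M.pe)))) ^
      (Fintype.card (Fin n) - 2 - m) ≤ u ^ (85 * m) := by
    rw [Fintype.card_fin]
    exact exp_pow_sub_le hL hpe0 hπ.1 hm0
      ((mul_le_mul_of_nonneg_left hpu (by positivity)).trans hmu)
  have hμu : n * M.binProb h (n - 1) 0 * u ≤ 1 := by
    refine (mul_le_mul_of_nonneg_right (hμ.trans ?_) hu0.le).trans e3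
    have := pow_le_pow_right₀ hL1 (by omega : c ≤ c + 1)
    linarith
  have hμm : u ^ m * Real.exp (n * M.binProb h (n - 1) 0) ≤ 1 := by
    rw [hu, ← Real.exp_nat_mul, ← Real.exp_add]
    refine Real.exp_le_one_iff.2 ?_
    have h1 : L ^ c ≤ L ^ (c + 1) := pow_le_pow_right₀ hL1 (by omega)
    have h2 : (m : ℝ) * 100 ≤ m * L := by gcongr
    linarith
  have hAi : ((L⁻¹ ^ A)⁻¹ : ℝ) = L ^ A := by rw [inv_pow, inv_inv]
  have hLA : 1 ≤ L ^ A := one_le_pow₀ hL1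
  have hLA1 : L ^ A ≤ L ^ (A + 1) := pow_le_pow_right₀ hL1 (by omega)
  have hLA2 : L ≤ L ^ (A + 1) := by
    rw [pow_succ]
    nlinarith
  refine (M.abs_exp_pow_cnt_mul_exp_sub_le hu0 hu2 (by rw [Fintype.card_fin, hnu]) hpe hm100 hmu
    (by simpa using e2) hκ₀ hκ1 hH hδ hκ (μ := n * M.binProb h (n - 1) 0)
    (by rw [Fintype.card_fin]) hμu hμm (c := 2 * L) (t₀ := L⁻¹ ^ A)
    (by rw [Fintype.card_fin]; exact hπ.2) (by positivity) ?_ ?_ ht).trans ?_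
  · rw [hAi, ← pow_mul]
    linarith
  · rw [hAi]
    have h1 : (h : ℝ) ≤ h * L ^ (A + 1) := le_mul_of_one_le_right (by positivity) (by linarith)
    have h2 : L ^ A + h + 1 + 2 * L ≤ (1 + h + 1 + 2) * L ^ (A + 1) := by linarith
    have h3 := mul_le_mul_of_nonneg_right h2 hu0.le
    linarith
  · gcongr
    calc u ^ 18 ≤ u := pow_le_of_le_one hu0.le hu1 (by norm_num)
      _ ≤ L⁻¹ ^ r := by
        rw [one_mul] at e8
        rw [inv_pow, ← one_div, le_div_iff₀ (by positivity)]
        linarith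

lemma eventually_abs_binomial_mean_sub_le {π : ℕ → ℝ} (h0 : ∀ n, 0 ≤ π n) (h1 : ∀ n, π n ≤ 1)
    (hπ : ∀ᶠ n : ℕ in atTop, n * π n ≤ 2 * Real.log n) (h : ℕ) :
    ∀ᶠ n : ℕ in atTop,
      |n * ((n - 1).choose h * π n ^ h * (1 - π n) ^ (n - 1 - h)) -
        n * (h.factorial : ℝ)⁻¹ * (n * π n) ^ h * Real.exp (-(n * π n))| ≤
      Real.exp (-(Real.log n / 100)) *
        (n * (h.factorial : ℝ)⁻¹ * (n * π n) ^ h * Real.exp (-(n * π n))) := by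
  filter_upwards [hπ, eventually_ge_atTop (h + 1), tendsto_log_natCast.eventually_ge_atTop 1,
    eventually_mul_log_pow_mul_exp_le (4 * (1 + h)) 1,
    eventually_mul_log_pow_mul_exp_le (2 * h ^ 2) 0,
    eventually_mul_log_pow_mul_exp_le 8 2] with n hπ hn hL e1 e2 e3
  have hnu : (n : ℝ) * Real.exp (-(Real.log n / 100)) ^ 100 = 1 := natCast_mul_exp_pow (by omega)
  set L := Real.log n
  set u := Real.exp (-(L / 100)) with hu
  set l := n * (h.factorial : ℝ)⁻¹ * (n * π n) ^ h * Real.exp (-(n * π n)) with hl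
  have hp0 := h0 n
  have hl0 : 0 ≤ l := by positivity
  have hu0 : 0 < u := Real.exp_pos _
  have hu1 : u ≤ 1 := Real.exp_le_one_iff.2 (by linarith)
  have hn0 : (0 : ℝ) < n := by exact_mod_cast (by omega : 0 < n)
  have hu2 : u ^ 100 ≤ u * u := by
    rw [← pow_two]
    exact pow_le_pow_of_le_one hu0.le hu1 (by norm_num)
  have hπu : π n ≤ 2 * L * (u * u) := by
    calc π n = n * π n * u ^ 100 := by linear_combination -π n * hnu
      _ ≤ 2 * L * (u * u) := by gcongr
  have hexp : (1 + h) * π n ≤ u / 2 := by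
    calc (1 + h) * π n ≤ (1 + h) * (2 * L * (u * u)) := by gcongr
      _ = (4 * (1 + h) * L ^ 1 * u) * u / 2 := by ring
      _ ≤ 1 * u / 2 := by gcongr
      _ = u / 2 := by ring
  have hsq : n * π n ^ 2 ≤ u / 2 := by
    calc n * π n ^ 2 = n * π n * π n := by ring
      _ ≤ 2 * L * (2 * L * (u * u)) := by gcongr
      _ = (8 * L ^ 2 * u) * u / 2 := by ring
      _ ≤ 1 * u / 2 := by gcongr
      _ = u / 2 := by ring
  have hhn : (h : ℝ) ^ 2 / n ≤ u / 2 := by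
    calc (h : ℝ) ^ 2 / n = h ^ 2 * u ^ 100 := by
          rw [div_eq_iff hn0.ne']
          linear_combination -(h : ℝ) ^ 2 * hnu
      _ ≤ h ^ 2 * (u * u) := by gcongr
      _ = (2 * h ^ 2 * L ^ 0 * u) * u / 2 := by ring
      _ ≤ 1 * u / 2 := by gcongr
      _ = u / 2 := by ring
  have hh : (h : ℝ) ^ 2 ≤ n := by
    rw [← div_le_one hn0]
    linarith
  have h2 := binomial_mean_le hn hp0 (h1 n)
  have h3 := le_binomial_mean hn hp0 (h1 n) hh (by linarith)
  have hx0 : 0 ≤ (1 + h) * π n := by positivity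
  have h4 := Real.abs_exp_sub_one_le (x := (1 + h) * π n) (by rw [abs_of_nonneg hx0]; linarith)
  rw [abs_of_nonneg hx0] at h4
  have h5 := (abs_le.1 h4).2
  rw [← hl] at h2 h3
  have h6 : l * Real.exp ((1 + h) * π n) ≤ l * (1 + u) := by
    gcongr
    linarith
  have h7 : l * (1 - u) ≤ l * (1 - h ^ 2 / n - n * π n ^ 2) :=
    mul_le_mul_of_nonneg_left (by linarith) hl0
  rw [abs_le]
  constructor <;> linarith

/-- Poisson probabilities with asymptotically equal means are asymptotically equivalent. -/
lemma tendsto_div_poisson_of_abs_sub_le {a μ l u : ℕ → ℝ} {ℓ : ℕ}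
    (hu : Tendsto u atTop (nhds 0)) (hul : Tendsto (fun n => u n * l n) atTop (nhds 0))
    (hl : ∀ᶠ n in atTop, 0 < l n) (hμ : ∀ᶠ n in atTop, 0 < μ n)
    (hd : ∀ᶠ n in atTop, |μ n - l n| ≤ u n * l n)
    (ha : Tendsto (fun n => a n / ((ℓ.factorial : ℝ)⁻¹ * μ n ^ ℓ * Real.exp (-μ n))) atTop
      (nhds 1)) :
    Tendsto (fun n => a n / ((ℓ.factorial : ℝ)⁻¹ * l n ^ ℓ * Real.exp (-l n))) atTop (nhds 1) := by
  have h1 : Tendsto (fun n => μ n - l n) atTop (nhds 0) := squeeze_zero_norm' hd hul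
  have h2 : Tendsto (fun n => μ n / l n - 1) atTop (nhds 0) := by
    refine squeeze_zero_norm' ?_ hu
    filter_upwards [hl, hd] with n h3 h4
    rw [div_sub_one h3.ne', Real.norm_eq_abs, abs_div, abs_of_pos h3, div_le_iff₀ h3]
    exact h4
  have h3 : Tendsto (fun n => μ n / l n) atTop (nhds 1) := by
    simpa using h2.add_const 1
  have h4 := (ha.mul (h3.pow ℓ)).mul (Real.continuous_exp.continuousAt.tendsto.comp h1.neg)
  rw [one_pow, neg_zero, Real.exp_zero, mul_one, mul_one] at h4
  refine h4.congr' ?_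
  filter_upwards [hl, hμ] with n h5 h6
  have hf : (0 : ℝ) < ℓ.factorial := by exact_mod_cast ℓ.factorial_pos
  simp only [Function.comp_apply]
  rw [neg_sub, Real.exp_sub, Real.exp_neg, Real.exp_neg, div_pow]
  have := Real.exp_pos (μ n)
  have := Real.exp_pos (l n)
  field_simp

end RingGraph

/-- if `K_n → ∞`, `K_n²/P_n → 0` and `(n p_{e,q}(n) − ln n)/ln ln n`
is bounded, then for every fixed `h`, the number of vertices of degree `h` is in
distribution asymptotically equivalent to a Poisson variable with mean
`λ_{n,h} = n (h!)⁻¹ (n p_{e,q}(n))^h e^{−n p_{e,q}(n)}`: for every `ℓ`,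
`P[Φ_{n,h} = ℓ] / ((ℓ!)⁻¹ λ_{n,h}^ℓ e^{−λ_{n,h}}) → 1`. -/
theorem number_of_degree_h_vertices_poisson
    (q : ℕ) (hq : 1 ≤ q) (h : ℕ)
    (K P : ℕ → ℕ) (p : ℕ → ℝ)
    (hK1 : ∀ n, 1 ≤ K n) (hKP : ∀ n, K n ≤ P n)
    (hp : ∀ n, p n ∈ Set.Ioc (0 : ℝ) 1)
    (hKinf : Tendsto (fun n => (K n : ℝ)) atTop atTop)
    (hKsqP : Tendsto (fun n => ((K n : ℝ)) ^ 2 / (P n : ℝ)) atTop (nhds 0))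
    (hbounded : ∃ C : ℝ, ∀ᶠ (n : ℕ) in atTop,
      |((n : ℝ) * peq q (K n) (P n) (p n) - Real.log (n : ℝ)) / Real.log (Real.log (n : ℝ))| ≤ C) :
    ∀ ℓ : ℕ,
      Tendsto (fun n =>
          prob n (K n) (P n) (p n) {ω | numDeg q n (P n) h ω = ℓ} /
            (((Nat.factorial ℓ : ℝ))⁻¹ *
              ((n : ℝ) * ((Nat.factorial h : ℝ))⁻¹ *
                  ((n : ℝ) * peq q (K n) (P n) (p n)) ^ h *
                  Real.exp (-((n : ℝ) * peq q (K n) (P n) (p n)))) ^ ℓ *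
              Real.exp (-((n : ℝ) * ((Nat.factorial h : ℝ))⁻¹ *
                  ((n : ℝ) * peq q (K n) (P n) (p n)) ^ h *
                  Real.exp (-((n : ℝ) * peq q (K n) (P n) (p n)))))))
        atTop (nhds 1) := by
  intro ℓ
  have hne := fun n => RingGraph.nonempty_keyRing (hKP n)
  set M := fun n => RingGraph.keyModel q (hKP n) (hp n) with hM
  have hpe : ∀ n, peq q (K n) (P n) (p n) = (M n).pe := fun _ => rfl
  simp only [hpe] at hbounded ⊢
  obtain ⟨C, hC⟩ := RingGraph.exists_eventually_abs_sub_le_mul_log hbounded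
  have hIcc := RingGraph.eventually_mem_Icc_log hC
  have hmean := RingGraph.eventually_mean_mem_Icc hC h
  have hclose := RingGraph.eventually_abs_binomial_mean_sub_le (fun n => (M n).pe_nonneg)
    (fun n => (M n).pe_le_one) (hIcc.mono fun n hn => hn.2) h
  simp only [← RingGraph.RingModel.binProb_zero_eq] at hclose
  have hLinv : Tendsto (fun n : ℕ => (Real.log n)⁻¹) atTop (nhds 0) :=
    RingGraph.tendsto_log_natCast.inv_tendsto_atTop
  have hL0 : ∀ᶠ n : ℕ in atTop, 0 < (Real.log n)⁻¹ :=
    RingGraph.tendsto_log_natCast.eventually_gt_atTop 0 |>.mono fun n hn => inv_pos.2 hn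
  have hu : Tendsto (fun n : ℕ => Real.exp (-(Real.log n / 100))) atTop (nhds 0) :=
    Real.tendsto_exp_neg_atTop_nhds_zero.comp
      (RingGraph.tendsto_log_natCast.atTop_div_const (by norm_num))
  have hμ : ∀ᶠ n : ℕ in atTop,
      (Real.log n)⁻¹ ^ (h + C + 2) ≤ n * (M n).binProb h (n - 1) 0 ∧
      n * (M n).binProb h (n - 1) 0 ≤ Real.log n ^ (h + C + 2) := by
    filter_upwards [hmean, hclose, hu.eventually_le_const (by norm_num : (0 : ℝ) < 1 / 2), hL0]
      with n h1 h2 h3 h4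
    have h5 : 0 < (Real.log n)⁻¹ ^ (h + C + 2) := pow_pos h4 _
    have h6 := h2.trans (mul_le_mul_of_nonneg_right h3 (by linarith [h1.1]))
    rw [abs_le] at h6
    constructor <;> linarith [h1.1, h1.2, h6.1, h6.2]
  refine RingGraph.tendsto_div_poisson_of_abs_sub_le
    (μ := fun n : ℕ => n * (M n).binProb h (n - 1) 0) hu ?_ ?_ ?_ hclose ?_
  · refine squeeze_zero' ?_ ?_ hLinv
    · filter_upwards [hmean, hL0] with n h1 h2
      have h3 : 0 < (Real.log n)⁻¹ ^ (h + C + 2) := pow_pos h2 _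
      exact mul_nonneg (Real.exp_pos _).le (by linarith [h1.1])
    · filter_upwards [hmean, hL0,
        RingGraph.eventually_mul_log_pow_mul_exp_le 1 (h + C + 3)] with n h1 h2 h3
      have h4 : 0 < Real.log n := inv_pos.1 h2
      have h5 : 0 < (Real.log n)⁻¹ ^ (h + C + 2) := pow_pos h2 _
      rw [one_mul, pow_succ] at h3
      have h6 := h1.2
      calc _ ≤ Real.exp (-(Real.log n / 100)) * Real.log n ^ (h + C + 2) :=
            mul_le_mul_of_nonneg_left (by linarith [h1.1]) (Real.exp_pos _).le
        _ = Real.log n ^ (h + C + 2) * Real.log n * Real.exp (-(Real.log n / 100)) *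
            (Real.log n)⁻¹ := by field_simp
        _ ≤ 1 * (Real.log n)⁻¹ := by gcongr
        _ = _ := one_mul _
  · filter_upwards [hmean, hL0] with n h1 h2
    have h3 : 0 < (Real.log n)⁻¹ ^ (h + C + 2) := pow_pos h2 _
    linarith [h1.1]
  · filter_upwards [hμ, hL0] with n h1 h2
    exact (pow_pos h2 _).trans_le h1.1
  · have hprob := fun n (k : ℕ) =>
      RingGraph.prob_numDeg_eq_exp (q := q) (n := n) (h := h) (hKP n) (hp n) k
    simp only [hprob]
    refine RingGraph.tendsto_coeff_div (c := h + C + 2)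
      (a := fun n k => (M n).exp
        (fun ω : (Fin n → RingGraph.KeyRing (P n) (K n)) × (Sym2 (Fin n) → Bool) =>
          if (M n).cnt h ω univ = k then 1 else 0)) hLinv hL0
      (fun n k => (M n).exp_nonneg fun ω => by positivity)
      (fun n t => (M n).hasSum_exp_pow_cnt h t) (hμ.mono fun n hn => hn.1) ?_
      (fun A r => RingGraph.eventually_abs_exp_pow_cnt_sub_le q h hKP hp hKinf hKsqP hIcc
        (hμ.mono fun n hn => hn.2) A r) ℓ
    filter_upwards [hμ, hL0] with n h1 h2
    have h3 : 0 < Real.log n := inv_pos.1 h2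
    rw [inv_pow, ← div_eq_mul_inv, div_le_one (by positivity)]
    exact h1.2
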